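/- Let p ∈ (-n, 1) and let μ be a Borel measure on S^{n-1} with dμ = f dH^{n-1}, where f is bounded and inf_{u ∈ S^{n-1}} f(u) > 0. Then there exists a convex body K ∈ K_0^n with μ = S_{K,p}. Moreover, if μ is invariant under a closed subgroup G of O(n), then K can be chosen invariant under G, and if p ∈ (-n, 2-n] then the origin lies in the interior of K. -/

import Mathlib

open MeasureTheory Metric Set Filter
open scoped ENNReal RealInnerProductSpace NNReal

noncomputable section

abbrev Eu (n : ℕ) : Type := EuclideanSpace ℝ (Fin n)

def IsConvexBody {n : ℕ} (K : Set (Eu n)) : Prop :=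
  Convex ℝ K ∧ IsCompact K ∧ (interior K).Nonempty

def suppFn {n : ℕ} (K : Set (Eu n)) (u : Eu n) : ℝ :=
  sSup ((fun x => ⟪x, u⟫) '' K)

def IsOuterNormal {n : ℕ} (K : Set (Eu n)) (x u : Eu n) : Prop :=
  ‖u‖ = 1 ∧ ∀ y ∈ K, ⟪y, u⟫ ≤ ⟪x, u⟫

def gaussMap {n : ℕ} (K : Set (Eu n)) (x : Eu n) : Eu n :=
  open scoped Classical in
  if h : ∃ u, IsOuterNormal K x u then h.choose else 0

def lpSurf {n : ℕ} (p : ℝ) (K : Set (Eu n)) (ω : Set (Eu n)) : ℝ≥0∞ :=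
  ∫⁻ x in {x ∈ frontier K | gaussMap K x ∈ ω},
    ENNReal.ofReal (⟪x, gaussMap K x⟫ ^ (1 - p)) ∂(μH[(n:ℝ) - 1])

/-- Action of an `n × n` matrix on Euclidean space. -/
def matAct {n : ℕ} (A : Matrix (Fin n) (Fin n) ℝ) (x : Eu n) : Eu n :=
  (EuclideanSpace.equiv (Fin n) ℝ).symm (A.mulVec (EuclideanSpace.equiv (Fin n) ℝ x))

section SupportFunction

variable {n : ℕ} {K : Set (Eu n)}

theorem bddAbove_inner_image (hK : IsCompact K) (u : Eu n) :
    BddAbove ((fun x => ⟪x, u⟫) '' K) :=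
  (hK.image (by fun_prop : Continuous fun x : Eu n => ⟪x, u⟫)).bddAbove

theorem inner_le_suppFn (hK : IsCompact K) {x : Eu n} (hx : x ∈ K) (u : Eu n) :
    ⟪x, u⟫ ≤ suppFn K u :=
  le_csSup (bddAbove_inner_image hK u) ⟨x, hx, rfl⟩

theorem suppFn_le (hne : K.Nonempty) {u : Eu n} {c : ℝ} (h : ∀ x ∈ K, ⟪x, u⟫ ≤ c) :
    suppFn K u ≤ c :=
  csSup_le (hne.image _) (by rintro _ ⟨x, hx, rfl⟩; exact h x hx)

theorem exists_inner_eq_suppFn (hK : IsCompact K) (hne : K.Nonempty) (u : Eu n) :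
    ∃ x ∈ K, ⟪x, u⟫ = suppFn K u := by
  obtain ⟨x, hx, h⟩ := hK.exists_isMaxOn hne
    (by fun_prop : ContinuousOn (fun x : Eu n => ⟪x, u⟫) K)
  exact ⟨x, hx, le_antisymm (inner_le_suppFn hK hx u) (suppFn_le hne fun y hy => h hy)⟩

theorem suppFn_smul (hK : IsCompact K) (hne : K.Nonempty) {c : ℝ} (hc : 0 ≤ c) (u : Eu n) :
    suppFn K (c • u) = c * suppFn K u := by
  apply le_antisymm
  · refine suppFn_le hne fun x hx => ?_
    rw [inner_smul_right]
    exact mul_le_mul_of_nonneg_left (inner_le_suppFn hK hx u) hc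
  · obtain ⟨x, hx, h⟩ := exists_inner_eq_suppFn hK hne u
    rw [← h, ← inner_smul_right]
    exact inner_le_suppFn hK hx _

theorem suppFn_sub_le (hK : IsCompact K) (hne : K.Nonempty) {R : ℝ}
    (hR : K ⊆ closedBall 0 R) (u v : Eu n) : suppFn K u - suppFn K v ≤ R * ‖u - v‖ := by
  obtain ⟨x, hx, h⟩ := exists_inner_eq_suppFn hK hne u
  have h1 := inner_le_suppFn hK hx v
  have h2 : ⟪x, u - v⟫ ≤ ‖x‖ * ‖u - v‖ := real_inner_le_norm _ _
  have h3 : ‖x‖ ≤ R := by simpa using hR hx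
  rw [inner_sub_right] at h2
  have := mul_le_mul_of_nonneg_right h3 (norm_nonneg (u - v))
  linarith

theorem continuous_suppFn (hK : IsCompact K) (hne : K.Nonempty) : Continuous (suppFn K) := by
  obtain ⟨R, hR⟩ := hK.isBounded.subset_closedBall 0
  have hR0 : 0 ≤ R := by
    obtain ⟨x, hx⟩ := hne
    have := hR hx
    simp only [mem_closedBall, dist_zero_right] at this
    exact (norm_nonneg x).trans this
  have : LipschitzWith ⟨R, hR0⟩ (suppFn K) := by
    refine LipschitzWith.of_dist_le_mul fun u v => ?_
    rw [Real.dist_eq, dist_eq_norm, abs_le]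
    have h1 := suppFn_sub_le hK hne hR u v
    have h2 := suppFn_sub_le hK hne hR v u
    rw [norm_sub_rev] at h2
    constructor
    · change -(R * ‖u - v‖) ≤ _
      linarith
    · exact h1
  exact this.continuous

theorem suppFn_image_sub (hK : IsCompact K) (hne : K.Nonempty) (y u : Eu n) :
    suppFn ((fun x => x - y) '' K) u = suppFn K u - ⟪y, u⟫ := by
  have hK' : IsCompact ((fun x => x - y) '' K) := hK.image (by fun_prop)
  apply le_antisymm
  · refine suppFn_le (hne.image _) ?_
    rintro _ ⟨x, hx, rfl⟩
    rw [inner_sub_left]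
    linarith [inner_le_suppFn hK hx u]
  · obtain ⟨x, hx, h⟩ := exists_inner_eq_suppFn hK hne u
    rw [← h, ← inner_sub_left]
    exact inner_le_suppFn hK' ⟨x, hx, rfl⟩ _

theorem suppFn_image_smul (hK : IsCompact K) (hne : K.Nonempty) {c : ℝ} (hc : 0 ≤ c) (u : Eu n) :
    suppFn ((fun x => c • x) '' K) u = c * suppFn K u := by
  have hK' : IsCompact ((fun x => c • x) '' K) := hK.image (by fun_prop)
  apply le_antisymm
  · refine suppFn_le (hne.image _) ?_
    rintro _ ⟨x, hx, rfl⟩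
    rw [real_inner_smul_left]
    exact mul_le_mul_of_nonneg_left (inner_le_suppFn hK hx u) hc
  · obtain ⟨x, hx, h⟩ := exists_inner_eq_suppFn hK hne u
    rw [← h, ← real_inner_smul_left]
    exact inner_le_suppFn hK' ⟨x, hx, rfl⟩ _

theorem inv_norm_smul_mem_sphere {x : Eu n} (hx : x ≠ 0) : ‖x‖⁻¹ • x ∈ sphere (0 : Eu n) 1 := by
  simp [norm_smul, norm_ne_zero_iff.2 hx]

/-- An inequality between positively homogeneous functions can be checked on the sphere. -/
theorem inner_le_suppFn_of_sphere (hK : IsCompact K) (hne : K.Nonempty) {x : Eu n}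
    (h : ∀ u ∈ sphere (0 : Eu n) 1, ⟪x, u⟫ ≤ suppFn K u) (u : Eu n) : ⟪x, u⟫ ≤ suppFn K u := by
  rcases eq_or_ne u 0 with rfl | hu
  · have := suppFn_smul hK hne le_rfl (0 : Eu n)
    simp only [smul_zero, zero_mul] at this
    simp [this]
  · have h1 := h _ (inv_norm_smul_mem_sphere hu)
    rw [suppFn_smul hK hne (by positivity), inner_smul_right] at h1
    exact le_of_mul_le_mul_left h1 (by positivity)

theorem mem_of_inner_le_suppFn (hc : Convex ℝ K) (hK : IsCompact K) (hne : K.Nonempty) {x : Eu n}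
    (h : ∀ u ∈ sphere (0 : Eu n) 1, ⟪x, u⟫ ≤ suppFn K u) : x ∈ K := by
  by_contra hx
  obtain ⟨f, c, h1, h2⟩ := geometric_hahn_banach_closed_point hc hK.isClosed hx
  obtain ⟨w, hw⟩ := (InnerProductSpace.toDual ℝ (Eu n)).surjective f
  have hf : ∀ y, f y = ⟪y, w⟫ := fun y => by
    rw [← hw, InnerProductSpace.toDual_apply_apply, real_inner_comm]
  obtain ⟨y, hy, hyw⟩ := exists_inner_eq_suppFn hK hne w
  have h3 := inner_le_suppFn_of_sphere hK hne h w
  have h4 := h1 y hy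
  rw [hf] at h2 h4
  linarith

theorem closedBall_subset_of_suppFn (hc : Convex ℝ K) (hK : IsCompact K) (hne : K.Nonempty)
    {x : Eu n} {r : ℝ} (h : ∀ u ∈ sphere (0 : Eu n) 1, ⟪x, u⟫ + r ≤ suppFn K u) :
    closedBall x r ⊆ K := by
  intro y hy
  refine mem_of_inner_le_suppFn hc hK hne fun u hu => ?_
  have h1 : ⟪y - x, u⟫ ≤ ‖y - x‖ * ‖u‖ := real_inner_le_norm _ _
  have hu' : ‖u‖ = 1 := by simpa using hu
  have h2 : ‖y - x‖ ≤ r := by simpa [dist_eq_norm] using hy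
  rw [hu', inner_sub_left] at h1
  linarith [h u hu]

theorem suppFn_ge_of_closedBall_subset (hK : IsCompact K) {x : Eu n} {r : ℝ} (hr : 0 ≤ r)
    (h : closedBall x r ⊆ K) {u : Eu n} (hu : u ∈ sphere (0 : Eu n) 1) :
    ⟪x, u⟫ + r ≤ suppFn K u := by
  have hu' : ‖u‖ = 1 := by simpa using hu
  have h1 : x + r • u ∈ K := h (by simp [norm_smul, hu', abs_of_nonneg hr])
  have h2 := inner_le_suppFn hK h1 u
  rwa [inner_add_left, real_inner_smul_left, real_inner_self_eq_norm_sq, hu', one_pow,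
    mul_one] at h2

theorem exists_suppFn_ge_of_mem_interior (hK : IsCompact K) {x : Eu n} (hx : x ∈ interior K) :
    ∃ r > 0, closedBall x r ⊆ K ∧ ∀ u ∈ sphere (0 : Eu n) 1, ⟪x, u⟫ + r ≤ suppFn K u := by
  obtain ⟨r, hr, h⟩ := nhds_basis_closedBall.mem_iff.1 (mem_interior_iff_mem_nhds.1 hx)
  exact ⟨r, hr, h, fun u hu => suppFn_ge_of_closedBall_subset hK hr.le h hu⟩

theorem mem_interior_of_inner_lt_suppFn (hc : Convex ℝ K) (hK : IsCompact K) (hne : K.Nonempty)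
    {x : Eu n} (h : ∀ u ∈ sphere (0 : Eu n) 1, ⟪x, u⟫ < suppFn K u) : x ∈ interior K := by
  have hcont : ContinuousOn (fun u => suppFn K u - ⟪x, u⟫) (sphere (0 : Eu n) 1) :=
    ((continuous_suppFn hK hne).sub (by fun_prop)).continuousOn
  rcases (sphere (0 : Eu n) 1).eq_empty_or_nonempty with he | hS
  · have : closedBall x 1 ⊆ K := closedBall_subset_of_suppFn hc hK hne (by simp [he])
    exact mem_interior_iff_mem_nhds.2 (mem_of_superset (closedBall_mem_nhds _ one_pos) this)
  · obtain ⟨u₀, hu₀, hmin⟩ := (isCompact_sphere (0 : Eu n) 1).exists_isMinOn hS hcont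
    have hpos : 0 < suppFn K u₀ - ⟪x, u₀⟫ := sub_pos.2 (h u₀ hu₀)
    have : closedBall x (suppFn K u₀ - ⟪x, u₀⟫) ⊆ K := by
      refine closedBall_subset_of_suppFn hc hK hne fun u hu => ?_
      have : suppFn K u₀ - ⟪x, u₀⟫ ≤ suppFn K u - ⟪x, u⟫ := hmin hu
      linarith
    exact mem_interior_iff_mem_nhds.2 (mem_of_superset (closedBall_mem_nhds _ hpos) this)

theorem suppFn_pos_of_zero_mem_interior (hK : IsCompact K) (h0 : (0 : Eu n) ∈ interior K)
    {u : Eu n} (hu : u ∈ sphere (0 : Eu n) 1) : 0 < suppFn K u := by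
  obtain ⟨r, hr, -, h⟩ := exists_suppFn_ge_of_mem_interior hK h0
  have := h u hu
  rw [inner_zero_left] at this
  linarith

theorem suppFn_nonneg (hK : IsCompact K) (h0 : (0 : Eu n) ∈ K) (u : Eu n) : 0 ≤ suppFn K u := by
  simpa using inner_le_suppFn hK h0 u

/-- The Wulff shape of a function on the sphere. -/
def wulff (h : Eu n → ℝ) : Set (Eu n) := {x | ∀ u ∈ sphere (0 : Eu n) 1, ⟪x, u⟫ ≤ h u}

theorem wulff_eq_iInter (h : Eu n → ℝ) :
    wulff h = ⋂ u ∈ sphere (0 : Eu n) 1, {x | ⟪x, u⟫ ≤ h u} := by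
  ext x; simp [wulff]

theorem convex_wulff (h : Eu n → ℝ) : Convex ℝ (wulff h) := by
  intro x hx y hy a b ha hb hab u hu
  rw [inner_add_left, real_inner_smul_left, real_inner_smul_left]
  have h1 := mul_le_mul_of_nonneg_left (hx u hu) ha
  have h2 := mul_le_mul_of_nonneg_left (hy u hu) hb
  calc a * ⟪x, u⟫ + b * ⟪y, u⟫ ≤ a * h u + b * h u := add_le_add h1 h2
    _ = h u := by rw [← add_mul, hab, one_mul]

theorem isClosed_wulff (h : Eu n → ℝ) : IsClosed (wulff h) := by
  rw [wulff_eq_iInter]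
  exact isClosed_biInter fun u _ => isClosed_le (by fun_prop) continuous_const

theorem wulff_subset_closedBall {h : Eu n → ℝ} {R : ℝ} (hR0 : 0 ≤ R)
    (hR : ∀ u ∈ sphere (0 : Eu n) 1, h u ≤ R) : wulff h ⊆ closedBall 0 R := by
  intro x hx
  rw [mem_closedBall, dist_zero_right]
  rcases eq_or_ne x 0 with rfl | hx0
  · simpa using hR0
  · have h1 := (hx _ (inv_norm_smul_mem_sphere hx0)).trans (hR _ (inv_norm_smul_mem_sphere hx0))
    rwa [inner_smul_right, real_inner_self_eq_norm_sq, sq, inv_mul_cancel_left₀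
      (norm_ne_zero_iff.2 hx0)] at h1

theorem isCompact_wulff {h : Eu n → ℝ} (hh : Continuous h) : IsCompact (wulff h) := by
  obtain ⟨R, hR⟩ := ((isCompact_sphere (0 : Eu n) 1).image hh).bddAbove
  refine (isCompact_closedBall (0 : Eu n) (max R 0)).of_isClosed_subset (isClosed_wulff h)
    (wulff_subset_closedBall (le_max_right _ _) fun u hu => ?_)
  exact (hR ⟨u, hu, rfl⟩).trans (le_max_left _ _)

theorem wulff_suppFn (hc : Convex ℝ K) (hK : IsCompact K) (hne : K.Nonempty) :
    wulff (suppFn K) = K :=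
  Subset.antisymm (fun _ hx => mem_of_inner_le_suppFn hc hK hne hx)
    fun _ hx u _ => inner_le_suppFn hK hx u

theorem suppFn_wulff_le {h : Eu n → ℝ} (hne : (wulff h).Nonempty) {u : Eu n}
    (hu : u ∈ sphere (0 : Eu n) 1) : suppFn (wulff h) u ≤ h u :=
  suppFn_le hne fun _ hx => hx u hu

theorem wulff_sub_inner (h : Eu n → ℝ) (y : Eu n) :
    wulff (fun u => h u - ⟪y, u⟫) = (fun x => x - y) '' wulff h := by
  ext x
  constructor
  · intro hx
    refine ⟨x + y, fun u hu => ?_, by simp⟩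
    rw [inner_add_left]
    linarith [hx u hu]
  · rintro ⟨z, hz, rfl⟩ u hu
    rw [inner_sub_left]
    linarith [hz u hu]

end SupportFunction

section ConeMeasure

open scoped Pointwise

variable {n : ℕ}

/-- The open cone with apex `0` over a subset of the hyperplane `⟪a, z⟫ = 1`. -/
def flatCone (a : Eu n) (B : Set (Eu n)) : Set (Eu n) :=
  {x | 0 < ⟪a, x⟫ ∧ ⟪a, x⟫ < 1 ∧ ⟪a, x⟫⁻¹ • x ∈ B}

theorem measurableSet_flatCone (a : Eu n) {B : Set (Eu n)} (hB : MeasurableSet B) :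
    MeasurableSet (flatCone a B) := by
  have hm : Measurable fun x : Eu n => ⟪a, x⟫ := by fun_prop
  refine (measurableSet_lt measurable_const hm).inter
    ((measurableSet_lt hm measurable_const).inter ?_)
  exact (by fun_prop : Measurable fun x : Eu n => ⟪a, x⟫⁻¹ • x) hB

theorem exists_hausdorffMeasure_eq_mul_volume_flatCone (e : Eu n) (he : ‖e‖ = 1) :
    ∃ C : ℝ≥0∞, C ≠ 0 ∧ C ≠ ∞ ∧ ∀ B : Set (Eu n), MeasurableSet B → B ⊆ {z | ⟪e, z⟫ = 1} →
      μH[(n : ℝ) - 1] B = C * volume (flatCone e B) := by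
  have hee : ⟪e, e⟫ = 1 := by rw [real_inner_self_eq_norm_sq, he, one_pow]
  have he0 : e ≠ 0 := by rintro rfl; simp at he
  set W : Submodule ℝ (Eu n) := (ℝ ∙ e)ᗮ with hW
  have hmem : ∀ {w : Eu n}, w ∈ W ↔ ⟪e, w⟫ = 0 :=
    Submodule.mem_orthogonal_singleton_iff_inner_right
  have hfr : Module.finrank ℝ W + 1 = n := by
    have := Submodule.finrank_add_finrank_orthogonal (ℝ ∙ e)
    rw [finrank_span_singleton he0, finrank_euclideanSpace_fin] at this
    rw [hW]
    omega
  have hfr' : (n : ℝ) - 1 = (Module.finrank ℝ W : ℝ) := by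
    have : ((Module.finrank ℝ W : ℝ)) + 1 = n := by exact_mod_cast hfr
    linarith
  have hqm : ∀ x : Eu n, ⟪e, x⟫⁻¹ • (x - ⟪e, x⟫ • e) ∈ W := fun x =>
    W.smul_mem _ (hmem.2 (by rw [inner_sub_right, inner_smul_right, hee, mul_one, sub_self]))
  set q : Eu n → W := fun x => ⟨⟪e, x⟫⁻¹ • (x - ⟪e, x⟫ • e), hqm x⟩ with hq
  have hqmeas : Measurable q := Measurable.subtype_mk (by fun_prop)
  set D : Set (Eu n) := {x | 0 < ⟪e, x⟫ ∧ ⟪e, x⟫ < 1} with hD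
  have hcont : Continuous fun x : Eu n => ⟪e, x⟫ := by fun_prop
  have hDo : IsOpen D :=
    (isOpen_lt continuous_const hcont).inter (isOpen_lt hcont continuous_const)
  set ν : Measure W := Measure.map q (volume.restrict D) with hν
  have hinv : ν.IsAddLeftInvariant := by
    refine ⟨fun w => ?_⟩
    set f : Module.Dual ℝ (Eu n) := (innerₛₗ ℝ e) with hf
    have hfw : f (w : Eu n) = 0 := hmem.1 w.2
    set s : Eu n → Eu n := fun x => LinearMap.transvection f (w : Eu n) x with hs
    have hsx : ∀ x, s x = x + ⟪e, x⟫ • (w : Eu n) := fun x => rfl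
    have hdet : LinearMap.det (LinearMap.transvection f (w : Eu n)) = 1 := by
      rw [LinearMap.transvection.det, hfw, add_zero]
    have hse : ∀ x, ⟪e, s x⟫ = ⟪e, x⟫ := fun x => by
      rw [hsx, inner_add_right, inner_smul_right, hmem.1 w.2, mul_zero, add_zero]
    have hsmap : Measure.map s (volume : Measure (Eu n)) = volume := by
      have := Measure.map_linearMap_addHaar_eq_smul_addHaar (volume : Measure (Eu n))
        (f := LinearMap.transvection f (w : Eu n)) (by rw [hdet]; exact one_ne_zero)
      rw [hdet] at this
      simpa using this
    have hsm : Measurable s := (LinearMap.transvection f (w : Eu n)).continuous_of_finiteDimensional.measurable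
    have hsD : s ⁻¹' D = D := by ext x; simp [hD, hse]
    have hmapD : Measure.map s (volume.restrict D) = volume.restrict D := by
      conv_lhs => rw [← hsD]
      rw [← Measure.restrict_map hsm hDo.measurableSet, hsmap]
    conv_rhs => rw [hν, ← hmapD]
    rw [hν, Measure.map_map (measurable_const_add w) hqmeas, Measure.map_map hqmeas hsm]
    refine Measure.map_congr ?_
    filter_upwards [ae_restrict_mem hDo.measurableSet] with x hx
    apply Subtype.ext
    simp only [Function.comp, hq, Submodule.coe_add, hse]
    rw [hsx, add_sub_right_comm, smul_add, smul_smul, inv_mul_cancel₀ hx.1.ne', one_smul, add_comm]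
  have hpos : ν (closedBall 0 1) ≠ 0 := by
    rw [hν, Measure.map_apply hqmeas isClosed_closedBall.measurableSet,
      Measure.restrict_apply (hqmeas isClosed_closedBall.measurableSet)]
    have hb : ball ((1 / 2 : ℝ) • e) (1 / 8) ⊆ q ⁻¹' closedBall 0 1 ∩ D := by
      intro x hx
      rw [mem_ball, dist_eq_norm] at hx
      have h1 : |⟪e, x - (1 / 2 : ℝ) • e⟫| ≤ ‖e‖ * ‖x - (1 / 2 : ℝ) • e‖ :=
        abs_real_inner_le_norm _ _
      rw [inner_sub_right, inner_smul_right, hee, he, one_mul, mul_one] at h1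
      have h2 := abs_le.1 (h1.trans hx.le)
      have hx1 : 0 < ⟪e, x⟫ := by linarith
      refine ⟨?_, hx1, by linarith⟩
      rw [mem_preimage, mem_closedBall_zero_iff, Submodule.coe_norm]
      change ‖⟪e, x⟫⁻¹ • (x - ⟪e, x⟫ • e)‖ ≤ 1
      rw [norm_smul, norm_inv, Real.norm_of_nonneg hx1.le, inv_mul_le_iff₀ hx1, mul_one]
      have h3 : x - ⟪e, x⟫ • e = (x - (1 / 2 : ℝ) • e) - (⟪e, x⟫ - 1 / 2) • e := by
        rw [sub_smul]; abel
      have h4 : ‖x - ⟪e, x⟫ • e‖ ≤ 1 / 8 + 1 / 8 := by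
        rw [h3]
        refine (norm_sub_le _ _).trans (add_le_add hx.le ?_)
        rw [norm_smul, he, mul_one]
        exact h1.trans hx.le
      linarith
    exact ((measure_ball_pos volume _ (by norm_num)).trans_le (measure_mono hb)).ne'
  have hfin : ν (closedBall 0 1) ≠ ∞ := by
    rw [hν, Measure.map_apply hqmeas isClosed_closedBall.measurableSet,
      Measure.restrict_apply (hqmeas isClosed_closedBall.measurableSet)]
    have hb : q ⁻¹' closedBall 0 1 ∩ D ⊆ closedBall 0 2 := by
      rintro x ⟨hx, hx0, hx1⟩
      rw [mem_preimage, mem_closedBall_zero_iff, Submodule.coe_norm] at hx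
      change ‖⟪e, x⟫⁻¹ • (x - ⟪e, x⟫ • e)‖ ≤ 1 at hx
      rw [norm_smul, norm_inv, Real.norm_of_nonneg hx0.le, inv_mul_le_iff₀ hx0, mul_one] at hx
      rw [mem_closedBall_zero_iff]
      calc ‖x‖ = ‖(x - ⟪e, x⟫ • e) + ⟪e, x⟫ • e‖ := by rw [sub_add_cancel]
        _ ≤ ‖x - ⟪e, x⟫ • e‖ + ‖⟪e, x⟫ • e‖ := norm_add_le _ _
        _ ≤ 1 + 1 := add_le_add (hx.trans hx1.le) (by
            rw [norm_smul, he, mul_one, Real.norm_of_nonneg hx0.le]; exact hx1.le)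
        _ = 2 := by norm_num
    exact ((measure_mono hb).trans_lt measure_closedBall_lt_top).ne
  have hHaar : ν.IsAddHaarMeasure :=
    Measure.isAddHaarMeasure_of_isCompact_nonempty_interior ν (closedBall 0 1)
      (isCompact_closedBall _ _) ⟨0, by
        rw [mem_interior_iff_mem_nhds]; exact closedBall_mem_nhds _ one_pos⟩ hpos hfin
  have heq := Measure.isAddLeftInvariant_eq_smul (μH[Module.finrank ℝ W] : Measure W) ν
  set c := Measure.addHaarScalarFactor (μH[Module.finrank ℝ W] : Measure W) ν with hc
  refine ⟨c, ?_, ENNReal.coe_ne_top, fun B hB hBe => ?_⟩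
  · exact_mod_cast (Measure.addHaarScalarFactor_pos_of_isAddHaarMeasure _ _).ne'
  · set j : W → Eu n := fun w => (w : Eu n) + e with hj
    have hji : Isometry j := Isometry.of_dist_eq fun x y => by
      simp [hj, Subtype.dist_eq]
    have hBj : B = j '' (j ⁻¹' B) := by
      rw [image_preimage_eq_inter_range, eq_comm, inter_eq_left]
      intro z hz
      refine ⟨⟨z - e, hmem.2 ?_⟩, by simp [hj]⟩
      rw [inner_sub_right, hBe hz, hee, sub_self]
    rw [hBj, hji.hausdorffMeasure_image (Or.inl (by rw [hfr']; positivity)), hfr', ← hBj, heq,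
      Measure.smul_apply, hν, Measure.map_apply hqmeas (hji.continuous.measurable hB),
      Measure.restrict_apply (hqmeas (hji.continuous.measurable hB))]
    change (c : ℝ≥0∞) * _ = _
    congr 2
    ext x
    simp only [mem_inter_iff, mem_preimage, hD, mem_ofPred_eq, flatCone]
    have key : 0 < ⟪e, x⟫ → j (q x) = ⟪e, x⟫⁻¹ • x := fun hx => by
      simp only [hj, hq]
      rw [smul_sub, smul_smul, inv_mul_cancel₀ hx.ne', one_smul, sub_add_cancel]
    constructor
    · rintro ⟨h1, h2, h3⟩
      exact ⟨h2, h3, by rwa [← key h2]⟩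
    · rintro ⟨h2, h3, h1⟩
      exact ⟨by rwa [key h2], h2, h3⟩

theorem exists_hausdorffMeasure_eq_flatCone (hn : 0 < n) :
    ∃ C : ℝ≥0∞, C ≠ 0 ∧ C ≠ ∞ ∧ ∀ a : Eu n, a ≠ 0 → ∀ B : Set (Eu n), MeasurableSet B →
      B ⊆ {z | ⟪a, z⟫ = 1} →
      μH[(n : ℝ) - 1] B = C * (ENNReal.ofReal ‖a‖ * volume (flatCone a B)) := by
  have hn1 : (0 : ℝ) ≤ (n : ℝ) - 1 := by
    have : (1 : ℝ) ≤ n := by exact_mod_cast hn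
    linarith
  set e₀ : Eu n := EuclideanSpace.single ⟨0, hn⟩ 1 with he₀
  have he₀' : ‖e₀‖ = 1 := by simp [he₀]
  obtain ⟨C, hC0, hC1, hC⟩ := exists_hausdorffMeasure_eq_mul_volume_flatCone e₀ he₀'
  have unit : ∀ e : Eu n, ‖e‖ = 1 → ∀ B : Set (Eu n), MeasurableSet B → B ⊆ {z | ⟪e, z⟫ = 1} →
      μH[(n : ℝ) - 1] B = C * volume (flatCone e B) := by
    intro e he B hB hBe
    set R : Eu n ≃ₗᵢ[ℝ] Eu n := Submodule.reflection (ℝ ∙ (e₀ - e))ᗮ with hR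
    have hRe : R e₀ = e := Submodule.reflection_sub (by rw [he₀', he])
    have h1 := hC (R ⁻¹' B) (R.continuous.measurable hB) (fun z hz => by
      have := hBe hz
      simp only [mem_ofPred_eq] at this ⊢
      rwa [← hRe, LinearIsometryEquiv.inner_map_map] at this)
    have h2 : flatCone e₀ (R ⁻¹' B) = R ⁻¹' flatCone e B := by
      ext x
      simp only [flatCone, mem_ofPred_eq, mem_preimage, map_smul]
      rw [← hRe, LinearIsometryEquiv.inner_map_map]
    rw [h2, R.measurePreserving.measure_preimage (measurableSet_flatCone e hB).nullMeasurableSet]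
      at h1
    rw [← h1]
    exact (R.toIsometryEquiv.hausdorffMeasure_preimage _ _).symm
  refine ⟨C, hC0, hC1, fun a ha B hB hBa => ?_⟩
  have hα : 0 < ‖a‖ := norm_pos_iff.2 ha
  set e := ‖a‖⁻¹ • a with he
  have hae : ∀ x, ⟪e, x⟫ = ‖a‖⁻¹ * ⟪a, x⟫ := fun x => by rw [he, real_inner_smul_left]
  have hB' : MeasurableSet (‖a‖ • B) := hB.const_smul₀ _
  have h1 := unit e (by rw [he, norm_smul, norm_inv, norm_norm, inv_mul_cancel₀ hα.ne'])
    (‖a‖ • B) hB' (by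
      rintro _ ⟨z, hz, rfl⟩
      have : ⟪a, z⟫ = 1 := hBa hz
      simp only [mem_ofPred_eq, hae, inner_smul_right, this]
      rw [mul_one, inv_mul_cancel₀ hα.ne'])
  have h2 : flatCone e (‖a‖ • B) = ‖a‖ • flatCone a B := by
    ext x
    rw [mem_smul_set_iff_inv_smul_mem₀ hα.ne']
    simp only [flatCone, mem_ofPred_eq, mem_smul_set_iff_inv_smul_mem₀ hα.ne', hae,
      inner_smul_right, smul_smul, mul_inv, inv_inv]
    rw [← mul_assoc, inv_mul_cancel₀ hα.ne', one_mul, mul_right_comm, mul_inv_cancel₀ hα.ne',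
      one_mul]
  rw [h2, Measure.hausdorffMeasure_smul₀ hn1 hα.ne', Measure.addHaar_smul,
    finrank_euclideanSpace_fin] at h1
  have hα0 : ENNReal.ofReal ‖a‖ ≠ 0 := by simpa using ha
  have hpow : ENNReal.ofReal |‖a‖ ^ n| = ENNReal.ofReal ‖a‖ ^ ((n : ℝ) - 1) * ENNReal.ofReal ‖a‖ := by
    rw [abs_of_nonneg (by positivity), ENNReal.ofReal_pow hα.le]
    conv_rhs => rw [← ENNReal.rpow_one (ENNReal.ofReal ‖a‖), ← ENNReal.rpow_mul, one_mul]
    rw [← ENNReal.rpow_add _ _ hα0 ENNReal.ofReal_ne_top, sub_add_cancel, ENNReal.rpow_natCast]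
  have hsm : (‖(‖a‖ : ℝ)‖₊ ^ ((n : ℝ) - 1) • μH[(n : ℝ) - 1] B : ℝ≥0∞) =
      ENNReal.ofReal ‖a‖ ^ ((n : ℝ) - 1) * μH[(n : ℝ) - 1] B := by
    rw [ENNReal.smul_def, smul_eq_mul, ENNReal.coe_rpow_of_nonneg _ hn1]
    congr 2
    rw [← Real.enorm_of_nonneg hα.le]; rfl
  rw [hsm, hpow, mul_assoc, mul_left_comm] at h1
  refine (ENNReal.mul_right_inj (a := ENNReal.ofReal ‖a‖ ^ ((n : ℝ) - 1)) ?_ ?_).1 h1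
  · exact (ENNReal.rpow_pos (pos_iff_ne_zero.2 hα0) ENNReal.ofReal_ne_top).ne'
  · exact ENNReal.rpow_ne_top_of_nonneg hn1 ENNReal.ofReal_ne_top

end ConeMeasure

section GaugeFacts

variable {n : ℕ} {K : Set (Eu n)}

theorem exists_gauge_bounds (hc : Convex ℝ K) (hK : IsCompact K) (h0 : (0 : Eu n) ∈ interior K) :
    ∃ r R : ℝ, 0 < r ∧ 0 < R ∧ (∀ x, ‖x‖ ≤ R * gauge K x) ∧ (∀ x, gauge K x ≤ r⁻¹ * ‖x‖) ∧
      LipschitzWith (Real.toNNReal r⁻¹) (gauge K) := by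
  obtain ⟨r, hr, hrK⟩ := Metric.isOpen_iff.1 isOpen_interior 0 h0
  obtain ⟨R, hR, hRK⟩ := hK.isBounded.subset_closedBall_lt 0 0
  have hL : LipschitzWith (Real.toNNReal r)⁻¹ (gauge K) :=
    hc.lipschitzWith_gauge (Real.toNNReal_pos.2 hr)
      (by rw [Real.coe_toNNReal _ hr.le]; exact hrK.trans interior_subset)
  rw [← Real.toNNReal_inv] at hL
  refine ⟨r, R, hr, hR, fun x => ?_, fun x => ?_, hL⟩
  · have habs : Absorbent ℝ K := absorbent_nhds_zero (mem_interior_iff_mem_nhds.1 h0)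
    have := le_gauge_of_subset_closedBall habs hR.le hRK (x := x)
    rwa [div_le_iff₀ hR, mul_comm] at this
  · have := hL.dist_le_mul x 0
    rwa [gauge_zero, dist_zero_right, dist_zero_right, Real.norm_of_nonneg (gauge_nonneg _),
      Real.coe_toNNReal _ (inv_pos.2 hr).le] at this

theorem gauge_pos_of_ne_zero (hc : Convex ℝ K) (hK : IsCompact K) (h0 : (0 : Eu n) ∈ interior K)
    {x : Eu n} (hx : x ≠ 0) : 0 < gauge K x := by
  obtain ⟨r, R, -, hR, h1, -, -⟩ := exists_gauge_bounds hc hK h0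
  have h2 := h1 x
  have h3 := norm_pos_iff.2 hx
  by_contra! h
  have := mul_nonpos_of_nonneg_of_nonpos hR.le h
  linarith

theorem gauge_smul_pos {c : ℝ} (hc : 0 < c) (x : Eu n) : gauge K (c • x) = c * gauge K x := by
  rw [gauge_smul_of_nonneg hc.le, smul_eq_mul]

theorem continuous_gauge_of_convex (hc : Convex ℝ K) (h0 : (0 : Eu n) ∈ interior K) :
    Continuous (gauge K) :=
  continuous_gauge hc (mem_interior_iff_mem_nhds.1 h0)

theorem gauge_lt_one_iff (hc : Convex ℝ K) (h0 : (0 : Eu n) ∈ interior K) {x : Eu n} :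
    gauge K x < 1 ↔ x ∈ interior K :=
  gauge_lt_one_iff_mem_interior hc (mem_interior_iff_mem_nhds.1 h0)

theorem gauge_le_one_iff (hc : Convex ℝ K) (hK : IsCompact K) (h0 : (0 : Eu n) ∈ interior K)
    {x : Eu n} : gauge K x ≤ 1 ↔ x ∈ K := by
  rw [gauge_le_one_iff_mem_closure hc (mem_interior_iff_mem_nhds.1 h0), hK.isClosed.closure_eq]

theorem gauge_eq_one_iff (hc : Convex ℝ K) (h0 : (0 : Eu n) ∈ interior K) {x : Eu n} :
    gauge K x = 1 ↔ x ∈ frontier K :=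
  gauge_eq_one_iff_mem_frontier hc (mem_interior_iff_mem_nhds.1 h0)

theorem inner_le_gauge_mul_suppFn (hc : Convex ℝ K) (hK : IsCompact K)
    (h0 : (0 : Eu n) ∈ interior K) (x u : Eu n) : ⟪x, u⟫ ≤ gauge K x * suppFn K u := by
  rcases eq_or_ne x 0 with rfl | hx
  · simp
  · have hg := gauge_pos_of_ne_zero hc hK h0 hx
    have h1 : (gauge K x)⁻¹ • x ∈ K := by
      rw [← gauge_le_one_iff hc hK h0, gauge_smul_pos (inv_pos.2 hg), inv_mul_cancel₀ hg.ne']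
    have h2 := inner_le_suppFn hK h1 u
    rwa [real_inner_smul_left, inv_mul_le_iff₀ hg] at h2

theorem inner_gradient (f : Eu n → ℝ) (x v : Eu n) : ⟪gradient f x, v⟫ = fderiv ℝ f x v := by
  simp [gradient]

theorem norm_gradient (f : Eu n → ℝ) (x : Eu n) : ‖gradient f x‖ = ‖fderiv ℝ f x‖ := by
  simp [gradient]

theorem gradient_gauge_smul {c : ℝ} (hc : 0 < c) (x : Eu n) :
    gradient (gauge K) (c • x) = gradient (gauge K) x := by
  have h1 : fderiv ℝ (fun y => gauge K (c • y)) x = c • fderiv ℝ (gauge K) (c • x) :=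
    fderiv_comp_smul c
  have h2 : fderiv ℝ (fun y => gauge K (c • y)) x = c • fderiv ℝ (gauge K) x := by
    have : (fun y => gauge K (c • y)) = c • gauge K := by
      ext y; simp [gauge_smul_pos hc]
    rw [this, fderiv_const_smul_field]; rfl
  have h3 : fderiv ℝ (gauge K) (c • x) = fderiv ℝ (gauge K) x :=
    smul_right_injective _ hc.ne' (h1.symm.trans h2)
  simp only [gradient, h3]

theorem differentiableAt_gauge_smul {c : ℝ} (hc : 0 < c) {x : Eu n}
    (h : DifferentiableAt ℝ (gauge K) x) : DifferentiableAt ℝ (gauge K) (c • x) := by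
  have h1 : gauge K = fun y => c * gauge K (c⁻¹ • y) := by
    ext y; rw [gauge_smul_pos (inv_pos.2 hc), mul_inv_cancel_left₀ hc.ne']
  rw [h1]
  have h2 : DifferentiableAt ℝ (gauge K) (c⁻¹ • c • x) := by rwa [inv_smul_smul₀ hc.ne']
  have h3 : DifferentiableAt ℝ (fun y : Eu n => gauge K (c⁻¹ • y)) (c • x) :=
    DifferentiableAt.comp (g := gauge K) (c • x) h2 (differentiableAt_id.const_smul c⁻¹)
  exact h3.const_mul c

theorem inner_gradient_gauge_self {x : Eu n} (hx : DifferentiableAt ℝ (gauge K) x) :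
    ⟪gradient (gauge K) x, x⟫ = gauge K x := by
  rw [inner_gradient]
  have h1 : HasDerivAt (fun t : ℝ => gauge K (x + t • x)) (fderiv ℝ (gauge K) x x) 0 :=
    hx.hasFDerivAt.hasLineDerivAt x
  have h2 : HasDerivAt (fun t : ℝ => (1 + t) * gauge K x) (gauge K x) 0 := by
    simpa using ((hasDerivAt_id (0 : ℝ)).const_add 1).mul_const (gauge K x)
  refine h1.unique (h2.congr_of_eventuallyEq ?_)
  filter_upwards [lt_mem_nhds (show (-1 : ℝ) < 0 by norm_num)] with t ht
  have h3 : x + t • x = (1 + t) • x := by rw [add_smul, one_smul]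
  rw [h3, gauge_smul_pos (by linarith)]

theorem inner_gradient_gauge_le (hc : Convex ℝ K) (h0 : (0 : Eu n) ∈ interior K) {x : Eu n}
    (hx : DifferentiableAt ℝ (gauge K) x) (y : Eu n) : ⟪gradient (gauge K) x, y⟫ ≤ gauge K y := by
  rw [inner_gradient]
  have h1 : HasDerivAt (fun t : ℝ => gauge K (x + t • y)) (fderiv ℝ (gauge K) x y) 0 :=
    hx.hasFDerivAt.hasLineDerivAt y
  have h2 := h1.tendsto_slope_zero_right
  refine le_of_tendsto h2 ?_
  filter_upwards [self_mem_nhdsWithin] with t ht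
  have ht' : (0 : ℝ) < t := ht
  simp only [zero_add, zero_smul, add_zero, smul_eq_mul]
  rw [inv_mul_le_iff₀ ht']
  have habs : Absorbent ℝ K := absorbent_nhds_zero (mem_interior_iff_mem_nhds.1 h0)
  have h3 := gauge_add_le hc habs x (t • y)
  rw [gauge_smul_pos ht'] at h3
  linarith

theorem gradient_gauge_ne_zero (hc : Convex ℝ K) (hK : IsCompact K)
    (h0 : (0 : Eu n) ∈ interior K) {x : Eu n} (hx0 : x ≠ 0)
    (hx : DifferentiableAt ℝ (gauge K) x) : gradient (gauge K) x ≠ 0 := by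
  intro h
  have := inner_gradient_gauge_self hx
  rw [h, inner_zero_left] at this
  exact (gauge_pos_of_ne_zero hc hK h0 hx0).ne this

theorem norm_gradient_gauge_le {L : ℝ≥0} (hL : LipschitzWith L (gauge K)) (x : Eu n) :
    ‖gradient (gauge K) x‖ ≤ L := by
  rw [norm_gradient]
  exact norm_fderiv_le_of_lipschitz ℝ hL

theorem measurable_gradient (f : Eu n → ℝ) : Measurable (gradient f) :=
  (InnerProductSpace.toDual ℝ (Eu n)).symm.continuous.measurable.comp (measurable_fderiv ℝ f)

/-- The outer unit normal of a convex body as a degree-zero homogeneous function. -/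
def unitNormal (K : Set (Eu n)) (x : Eu n) : Eu n :=
  ‖gradient (gauge K) x‖⁻¹ • gradient (gauge K) x

theorem measurable_unitNormal : Measurable (unitNormal K) := by
  have := measurable_gradient (gauge K)
  unfold unitNormal
  fun_prop

theorem unitNormal_smul {c : ℝ} (hc : 0 < c) (x : Eu n) :
    unitNormal K (c • x) = unitNormal K x := by
  rw [unitNormal, gradient_gauge_smul hc, unitNormal]

theorem unitNormal_mem_sphere (hc : Convex ℝ K) (hK : IsCompact K)
    (h0 : (0 : Eu n) ∈ interior K) {x : Eu n} (hx0 : x ≠ 0)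
    (hx : DifferentiableAt ℝ (gauge K) x) : unitNormal K x ∈ sphere (0 : Eu n) 1 :=
  inv_norm_smul_mem_sphere (gradient_gauge_ne_zero hc hK h0 hx0 hx)

theorem suppFn_unitNormal (hc : Convex ℝ K) (hK : IsCompact K)
    (h0 : (0 : Eu n) ∈ interior K) {x : Eu n} (hx0 : x ≠ 0)
    (hx : DifferentiableAt ℝ (gauge K) x) :
    suppFn K (unitNormal K x) = ‖gradient (gauge K) x‖⁻¹ := by
  have hne : K.Nonempty := ⟨0, interior_subset h0⟩
  rw [unitNormal, suppFn_smul hK hne (by positivity)]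
  suffices suppFn K (gradient (gauge K) x) = 1 by rw [this, mul_one]
  apply le_antisymm
  · refine suppFn_le hne fun y hy => ?_
    rw [real_inner_comm]
    exact (inner_gradient_gauge_le hc h0 hx y).trans ((gauge_le_one_iff hc hK h0).2 hy)
  · have h1 := inner_le_gauge_mul_suppFn hc hK h0 x (gradient (gauge K) x)
    rw [real_inner_comm, inner_gradient_gauge_self hx] at h1
    exact (le_mul_iff_one_le_right (gauge_pos_of_ne_zero hc hK h0 hx0)).1 h1

theorem eq_unitNormal_of_inner_eq (hc : Convex ℝ K) (hK : IsCompact K)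
    (h0 : (0 : Eu n) ∈ interior K) {x u : Eu n}
    (hx : DifferentiableAt ℝ (gauge K) x) (hu : u ∈ sphere (0 : Eu n) 1)
    (h : ⟪x, u⟫ = gauge K x * suppFn K u) : u = unitNormal K x := by
  have hs : 0 < suppFn K u := suppFn_pos_of_zero_mem_interior hK h0 hu
  have hmin : IsLocalMin (fun y => gauge K y * suppFn K u - ⟪u, y⟫) x := by
    refine Filter.Eventually.of_forall fun y => ?_
    have h1 := inner_le_gauge_mul_suppFn hc hK h0 y u
    simp only
    rw [real_inner_comm, h, sub_self, real_inner_comm]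
    linarith
  have hd : HasFDerivAt (fun y => gauge K y * suppFn K u - ⟪u, y⟫)
      (suppFn K u • fderiv ℝ (gauge K) x - innerSL ℝ u) x :=
    (hx.hasFDerivAt.mul_const _).sub (innerSL ℝ u).hasFDerivAt
  have h2 := hmin.hasFDerivAt_eq_zero hd
  have h3 : u = suppFn K u • gradient (gauge K) x := by
    refine ext_inner_right ℝ fun v => ?_
    have h4 := congrArg (fun l => l v) h2
    simp only [sub_apply, smul_apply, innerSL_apply_apply,
      zero_apply, smul_eq_mul] at h4
    rw [real_inner_smul_left, inner_gradient]
    linarith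
  have h5 : suppFn K u * ‖gradient (gauge K) x‖ = 1 := by
    have : ‖u‖ = 1 := by simpa using hu
    rw [h3, norm_smul, Real.norm_of_nonneg hs.le] at this
    exact this
  rw [unitNormal, ← eq_inv_of_mul_eq_one_left h5]
  exact h3

theorem gaussMap_eq_unitNormal (hc : Convex ℝ K) (hK : IsCompact K)
    (h0 : (0 : Eu n) ∈ interior K) {x : Eu n} (hxf : x ∈ frontier K)
    (hx : DifferentiableAt ℝ (gauge K) x) : gaussMap K x = unitNormal K x := by
  have hne : K.Nonempty := ⟨0, interior_subset h0⟩
  have hN : gauge K x = 1 := (gauge_eq_one_iff hc h0).2 hxf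
  have hx0 : x ≠ 0 := by rintro rfl; simp at hN
  have hex : ∃ u, IsOuterNormal K x u := by
    refine ⟨unitNormal K x, by simpa using unitNormal_mem_sphere hc hK h0 hx0 hx, fun y hy => ?_⟩
    rw [unitNormal, inner_smul_right, inner_smul_right]
    refine mul_le_mul_of_nonneg_left ?_ (by positivity)
    rw [real_inner_comm, real_inner_comm _ x, inner_gradient_gauge_self hx, hN]
    exact (inner_gradient_gauge_le hc h0 hx y).trans ((gauge_le_one_iff hc hK h0).2 hy)
  rw [gaussMap, dif_pos hex]
  obtain ⟨h1, h2⟩ := hex.choose_spec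
  refine eq_unitNormal_of_inner_eq hc hK h0 hx (by simpa using h1) ?_
  rw [hN, one_mul]
  exact le_antisymm (inner_le_suppFn hK ((gauge_le_one_iff hc hK h0).1 hN.le) _)
    (suppFn_le hne h2)

end GaugeFacts

section ConeMeasureFormula

open scoped Pointwise

variable {n : ℕ} {K : Set (Eu n)}

/-- Radial projection to the boundary of a convex body. -/
def radialProj (K : Set (Eu n)) (x : Eu n) : Eu n := (gauge K x)⁻¹ • x

/-- The radial projection to the boundary of the measure with density `‖∇ gauge‖` on the body. -/
def coneMeasure (K : Set (Eu n)) : Measure (Eu n) :=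
  Measure.map (radialProj K)
    ((volume.restrict {x | gauge K x < 1}).withDensity fun x => ‖gradient (gauge K) x‖ₑ)

/-- The part of the body lying over a subset of its boundary. -/
def radialCone (K A : Set (Eu n)) : Set (Eu n) := {x | gauge K x < 1 ∧ radialProj K x ∈ A}

theorem measurable_radialProj (hc : Convex ℝ K) (h0 : (0 : Eu n) ∈ interior K) :
    Measurable (radialProj K) := by
  have := (continuous_gauge_of_convex hc h0).measurable
  unfold radialProj
  fun_prop

theorem measurableSet_gauge_lt_one (hc : Convex ℝ K) (h0 : (0 : Eu n) ∈ interior K) :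
    MeasurableSet {x | gauge K x < 1} :=
  measurableSet_lt (continuous_gauge_of_convex hc h0).measurable measurable_const

theorem measurableSet_radialCone (hc : Convex ℝ K) (h0 : (0 : Eu n) ∈ interior K)
    {A : Set (Eu n)} (hA : MeasurableSet A) : MeasurableSet (radialCone K A) :=
  (measurableSet_gauge_lt_one hc h0).inter (measurable_radialProj hc h0 hA)

theorem coneMeasure_apply (hc : Convex ℝ K) (h0 : (0 : Eu n) ∈ interior K) {A : Set (Eu n)}
    (hA : MeasurableSet A) :
    coneMeasure K A = ∫⁻ x in radialCone K A, ‖gradient (gauge K) x‖ₑ := by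
  have hm := measurable_radialProj hc h0
  rw [coneMeasure, Measure.map_apply hm hA, withDensity_apply _ (hm hA),
    Measure.restrict_restrict (hm hA), inter_comm]
  rfl

theorem radialProj_smul {c : ℝ} (hc : 0 < c) (x : Eu n) :
    radialProj K (c • x) = radialProj K x := by
  rw [radialProj, gauge_smul_pos hc, smul_smul, mul_inv, mul_comm c⁻¹, mul_assoc,
    inv_mul_cancel₀ hc.ne', mul_one, radialProj]

theorem radialProj_of_mem_frontier (hc : Convex ℝ K) (h0 : (0 : Eu n) ∈ interior K) {x : Eu n}
    (hx : x ∈ frontier K) : radialProj K x = x := by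
  rw [radialProj, (gauge_eq_one_iff hc h0).2 hx, inv_one, one_smul]

theorem ne_zero_of_mem_frontier (hc : Convex ℝ K) (h0 : (0 : Eu n) ∈ interior K) {x : Eu n}
    (hx : x ∈ frontier K) : x ≠ 0 := by
  rintro rfl
  simpa using (gauge_eq_one_iff hc h0).2 hx

theorem gauge_smul_radialProj {x : Eu n} (hx : gauge K x ≠ 0) :
    gauge K x • radialProj K x = x := by
  rw [radialProj, smul_smul, mul_inv_cancel₀ hx, one_smul]

theorem hausdorffMeasure_comparison_of_nearly_flat (hc : Convex ℝ K) (hK : IsCompact K)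
    (h0 : (0 : Eu n) ∈ interior K) (hn : 0 < n) {C : ℝ≥0∞}
    (hC : ∀ a : Eu n, a ≠ 0 → ∀ B : Set (Eu n), MeasurableSet B → B ⊆ {z | ⟪a, z⟫ = 1} →
      μH[(n : ℝ) - 1] B = C * (ENNReal.ofReal ‖a‖ * volume (flatCone a B)))
    {A : Set (Eu n)} (hA : MeasurableSet A) (hAK : A ⊆ frontier K) {a : Eu n} (ha : a ≠ 0)
    {κ : ℝ} (hκ : 1 ≤ κ)
    (h1 : ∀ x ∈ A, ∀ y ∈ A, dist (⟪a, x⟫⁻¹ • x) (⟪a, y⟫⁻¹ • y) ≤ κ * dist x y)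
    (h2 : ∀ x ∈ A, ∀ y ∈ A, dist x y ≤ κ * dist (⟪a, x⟫⁻¹ • x) (⟪a, y⟫⁻¹ • y))
    (h3 : ∀ x ∈ A, κ⁻¹ ≤ ⟪a, x⟫ ∧ ⟪a, x⟫ ≤ κ)
    (h4 : ∀ x ∈ A, ‖gradient (gauge K) x‖ ≤ κ * ‖a‖ ∧ ‖a‖ ≤ κ * ‖gradient (gauge K) x‖) :
    μH[(n : ℝ) - 1] A ≤ ENNReal.ofReal κ ^ (2 * n + 1) * (C * coneMeasure K A) ∧
      C * coneMeasure K A ≤ ENNReal.ofReal κ ^ (2 * n + 1) * μH[(n : ℝ) - 1] A := by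
  have hκ0 : 0 < κ := zero_lt_one.trans_le hκ
  have hn1 : (0 : ℝ) ≤ (n : ℝ) - 1 := by
    have : (1 : ℝ) ≤ n := by exact_mod_cast hn
    linarith
  set k := ENNReal.ofReal κ with hk
  have hk1 : 1 ≤ k := by rw [hk, ← ENNReal.ofReal_one]; exact ENNReal.ofReal_le_ofReal hκ
  have hkpow : ((Real.toNNReal κ : ℝ≥0) : ℝ≥0∞) ^ ((n : ℝ) - 1) ≤ k ^ n := by
    rw [← ENNReal.rpow_natCast]
    exact ENNReal.rpow_le_rpow_of_exponent_le hk1 (by linarith)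
  have hpos : ∀ x ∈ A, 0 < ⟪a, x⟫ := fun x hx => (inv_pos.2 hκ0).trans_le (h3 x hx).1
  have hrp : ∀ x ∈ A, radialProj K (⟪a, x⟫⁻¹ • x) = x := fun x hx => by
    rw [radialProj_smul (inv_pos.2 (hpos x hx)), radialProj_of_mem_frontier hc h0 (hAK hx)]
  set B : Set (Eu n) := {z | ⟪a, z⟫ = 1 ∧ radialProj K z ∈ A} with hB
  have hin : Measurable fun z : Eu n => ⟪a, z⟫ := by fun_prop
  have hBm : MeasurableSet B :=
    (measurableSet_eq_fun hin measurable_const).inter (measurable_radialProj hc h0 hA)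
  have hBB : ∀ z ∈ B, z = ⟪a, radialProj K z⟫⁻¹ • radialProj K z := by
    rintro z ⟨hz1, hz2⟩
    have hz0 : z ≠ 0 := by rintro rfl; simp at hz1
    have hg := gauge_pos_of_ne_zero hc hK h0 hz0
    rw [radialProj, inner_smul_right, hz1, mul_one, inv_inv, smul_smul, mul_inv_cancel₀ hg.ne',
      one_smul]
  have hBA : B = (fun x => ⟪a, x⟫⁻¹ • x) '' A := by
    ext z
    constructor
    · intro hz
      exact ⟨_, hz.2, (hBB z hz).symm⟩
    · rintro ⟨x, hx, rfl⟩
      refine ⟨?_, ?_⟩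
      · rw [inner_smul_right, inv_mul_cancel₀ (hpos x hx).ne']
      · rw [hrp x hx]; exact hx
  have hAB : A = radialProj K '' B := by
    rw [hBA, image_image]
    ext x
    constructor
    · exact fun hx => ⟨x, hx, hrp x hx⟩
    · rintro ⟨y, hy, rfl⟩
      change radialProj K (⟪a, y⟫⁻¹ • y) ∈ A
      rwa [hrp y hy]
  have hbm : μH[(n : ℝ) - 1] B ≤ k ^ n * μH[(n : ℝ) - 1] A := by
    rw [hBA]
    have hl : LipschitzOnWith (Real.toNNReal κ) (fun x => ⟪a, x⟫⁻¹ • x) A :=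
      LipschitzOnWith.of_dist_le_mul fun x hx y hy => by
        rw [Real.coe_toNNReal _ hκ0.le]; exact h1 x hx y hy
    exact (hl.hausdorffMeasure_image_le hn1).trans (mul_le_mul_left hkpow _)
  have hmb : μH[(n : ℝ) - 1] A ≤ k ^ n * μH[(n : ℝ) - 1] B := by
    conv_lhs => rw [hAB]
    have hl : LipschitzOnWith (Real.toNNReal κ) (radialProj K) B :=
      LipschitzOnWith.of_dist_le_mul fun x hx y hy => by
        rw [Real.coe_toNNReal _ hκ0.le]
        conv_rhs => rw [hBB x hx, hBB y hy]
        exact h2 _ hx.2 _ hy.2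
    exact (hl.hausdorffMeasure_image_le hn1).trans (mul_le_mul_left hkpow _)
  have hb := hC a ha B hBm fun z hz => hz.1
  have hsc : ∀ S : Set (Eu n), volume (κ • S) = k ^ n * volume S := fun S => by
    rw [Measure.addHaar_smul, finrank_euclideanSpace_fin, abs_of_nonneg (by positivity),
      ENNReal.ofReal_pow hκ0.le]
  have hwv : volume (radialCone K A) ≤ k ^ n * volume (flatCone a B) := by
    rw [← hsc]
    refine measure_mono ?_
    rintro x ⟨hx1, hx2⟩
    have hx0 : x ≠ 0 := by
      rintro rfl
      have := hpos _ hx2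
      simp [radialProj] at this
    have hg := gauge_pos_of_ne_zero hc hK h0 hx0
    have hax : ⟪a, x⟫ = gauge K x * ⟪a, radialProj K x⟫ := by
      rw [← inner_smul_right, gauge_smul_radialProj hg.ne']
    have hax0 : 0 < ⟪a, x⟫ := by rw [hax]; exact mul_pos hg (hpos _ hx2)
    rw [mem_smul_set_iff_inv_smul_mem₀ hκ0.ne']
    refine ⟨?_, ?_, ?_, ?_⟩
    · rw [inner_smul_right]; positivity
    · rw [inner_smul_right, inv_mul_lt_iff₀ hκ0, mul_one, hax]
      calc gauge K x * ⟪a, radialProj K x⟫ < 1 * ⟪a, radialProj K x⟫ :=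
            mul_lt_mul_of_pos_right hx1 (hpos _ hx2)
        _ ≤ κ := by rw [one_mul]; exact (h3 _ hx2).2
    · rw [inner_smul_right, inner_smul_right]
      exact inv_mul_cancel₀ (by positivity)
    · rw [inner_smul_right, radialProj_smul (by positivity), radialProj_smul (by positivity)]
      exact hx2
  have hvw : volume (flatCone a B) ≤ k ^ n * volume (radialCone K A) := by
    rw [← hsc]
    refine measure_mono ?_
    rintro x ⟨hx1, hx2, hx3, hx4⟩
    rw [radialProj_smul (inv_pos.2 hx1)] at hx4
    have hx0 : x ≠ 0 := by rintro rfl; simp at hx1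
    have hg := gauge_pos_of_ne_zero hc hK h0 hx0
    have hax : ⟪a, x⟫ = gauge K x * ⟪a, radialProj K x⟫ := by
      rw [← inner_smul_right, gauge_smul_radialProj hg.ne']
    rw [mem_smul_set_iff_inv_smul_mem₀ hκ0.ne']
    refine ⟨?_, ?_⟩
    · rw [gauge_smul_pos (inv_pos.2 hκ0), mul_comm]
      calc gauge K x * κ⁻¹ ≤ gauge K x * ⟪a, radialProj K x⟫ :=
            mul_le_mul_of_nonneg_left (h3 _ hx4).1 hg.le
        _ < 1 := by rwa [← hax]
    · rw [radialProj_smul (inv_pos.2 hκ0)]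
      exact hx4
  have hgrad : ∀ x ∈ radialCone K A, gradient (gauge K) x = gradient (gauge K) (radialProj K x) := by
    rintro x ⟨-, hx2⟩
    have hx0 : x ≠ 0 := by
      rintro rfl
      have := hpos _ hx2
      simp [radialProj] at this
    rw [radialProj, gradient_gauge_smul (inv_pos.2 (gauge_pos_of_ne_zero hc hK h0 hx0))]
  have hRm := measurableSet_radialCone hc h0 hA
  have hm2 : coneMeasure K A ≤ k * (ENNReal.ofReal ‖a‖ * volume (radialCone K A)) := by
    rw [coneMeasure_apply hc h0 hA, ← mul_assoc, ← setLIntegral_const]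
    refine setLIntegral_mono' hRm fun x hx => ?_
    rw [hgrad x hx, ← ofReal_norm, ← ENNReal.ofReal_mul hκ0.le]
    exact ENNReal.ofReal_le_ofReal (h4 _ hx.2).1
  have hm2' : ENNReal.ofReal ‖a‖ * volume (radialCone K A) ≤ k * coneMeasure K A := by
    rw [coneMeasure_apply hc h0 hA, ← setLIntegral_const,
      ← lintegral_const_mul' _ _ ENNReal.ofReal_ne_top]
    refine setLIntegral_mono' hRm fun x hx => ?_
    rw [hgrad x hx, ← ofReal_norm, ← ENNReal.ofReal_mul hκ0.le]
    exact ENNReal.ofReal_le_ofReal (h4 _ hx.2).2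
  constructor
  · calc μH[(n : ℝ) - 1] A ≤ k ^ n * (C * (ENNReal.ofReal ‖a‖ * volume (flatCone a B))) := by
          rw [← hb]; exact hmb
      _ ≤ k ^ n * (C * (ENNReal.ofReal ‖a‖ * (k ^ n * volume (radialCone K A)))) := by gcongr
      _ = k ^ n * (C * (k ^ n * (ENNReal.ofReal ‖a‖ * volume (radialCone K A)))) := by ring
      _ ≤ k ^ n * (C * (k ^ n * (k * coneMeasure K A))) := by gcongr
      _ = k ^ (2 * n + 1) * (C * coneMeasure K A) := by ring
  · calc C * coneMeasure K A ≤ C * (k * (ENNReal.ofReal ‖a‖ * volume (radialCone K A))) := by gcongr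
      _ ≤ C * (k * (ENNReal.ofReal ‖a‖ * (k ^ n * volume (flatCone a B)))) := by gcongr
      _ = k ^ (n + 1) * (C * (ENNReal.ofReal ‖a‖ * volume (flatCone a B))) := by ring
      _ ≤ k ^ (n + 1) * (k ^ n * μH[(n : ℝ) - 1] A) := by rw [← hb]; gcongr
      _ = k ^ (2 * n + 1) * μH[(n : ℝ) - 1] A := by ring

theorem exists_lipschitzOnWith_radialProj (hc : Convex ℝ K) (hK : IsCompact K)
    (h0 : (0 : Eu n) ∈ interior K) {c : ℝ} (hcpos : 0 < c) :
    ∃ M : ℝ≥0, LipschitzOnWith M (radialProj K) {x | c ≤ ‖x‖} := by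
  obtain ⟨r, R, hr, hR, h1, -, hL⟩ := exists_gauge_bounds hc hK h0
  set L : ℝ := ((Real.toNNReal r⁻¹ : ℝ≥0) : ℝ) with hLdef
  have hL0 : 0 ≤ L := NNReal.coe_nonneg _
  refine ⟨Real.toNNReal (R / c * (1 + L * R)), LipschitzOnWith.of_dist_le_mul ?_⟩
  intro z hz w hw
  have hg : ∀ x : Eu n, c ≤ ‖x‖ → c / R ≤ gauge K x := fun x hx => by
    rw [div_le_iff₀ hR, mul_comm]
    exact hx.trans (h1 x)
  have hzg : 0 < gauge K z := (div_pos hcpos hR).trans_le (hg z hz)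
  have hwg : 0 < gauge K w := (div_pos hcpos hR).trans_le (hg w hw)
  have hzi : (gauge K z)⁻¹ ≤ R / c := by
    rw [← inv_div]; exact inv_anti₀ (by positivity) (hg z hz)
  rw [Real.coe_toNNReal _ (by positivity), dist_eq_norm, dist_eq_norm]
  have hrw : ‖radialProj K w‖ ≤ R := by
    rw [radialProj, norm_smul, norm_inv, Real.norm_of_nonneg hwg.le, inv_mul_le_iff₀ hwg, mul_comm]
    exact h1 w
  have key : radialProj K z - radialProj K w = (gauge K z)⁻¹ •
      ((z - w) + (gauge K w - gauge K z) • radialProj K w) := by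
    have hw' := gauge_smul_radialProj hwg.ne'
    have : (z - w) + (gauge K w - gauge K z) • radialProj K w = z - gauge K z • radialProj K w := by
      rw [sub_smul, hw']; abel
    rw [this, smul_sub, smul_smul, inv_mul_cancel₀ hzg.ne', one_smul]
    rfl
  rw [key, norm_smul, norm_inv, Real.norm_of_nonneg hzg.le, mul_assoc]
  refine mul_le_mul hzi ?_ (norm_nonneg _) (by positivity)
  refine (norm_add_le _ _).trans ?_
  rw [norm_smul, add_mul, one_mul]
  refine add_le_add le_rfl ?_
  have hLd := hL.dist_le_mul w z
  rw [dist_eq_norm, dist_eq_norm, norm_sub_rev w z] at hLd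
  calc ‖gauge K w - gauge K z‖ * ‖radialProj K w‖ ≤ (L * ‖z - w‖) * R :=
        mul_le_mul hLd hrw (norm_nonneg _) (by positivity)
    _ = L * R * ‖z - w‖ := by ring

theorem hausdorffMeasure_eq_zero_of_radialCone (hc : Convex ℝ K) (hK : IsCompact K)
    (h0 : (0 : Eu n) ∈ interior K) (hn : 0 < n) {C : ℝ≥0∞}
    (hC : ∀ a : Eu n, a ≠ 0 → ∀ B : Set (Eu n), MeasurableSet B → B ⊆ {z | ⟪a, z⟫ = 1} →
      μH[(n : ℝ) - 1] B = C * (ENNReal.ofReal ‖a‖ * volume (flatCone a B)))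
    {Z : Set (Eu n)} (hZ : MeasurableSet Z) (hZK : Z ⊆ frontier K)
    (hZ0 : volume (radialCone K Z) = 0) : μH[(n : ℝ) - 1] Z = 0 := by
  have hn1 : (0 : ℝ) ≤ (n : ℝ) - 1 := by
    have : (1 : ℝ) ≤ n := by exact_mod_cast hn
    linarith
  have half : ∀ a : Eu n, a ≠ 0 → μH[(n : ℝ) - 1] {z ∈ Z | 0 < ⟪a, z⟫} = 0 := by
    intro a ha
    set B : Set (Eu n) := {z | ⟪a, z⟫ = 1 ∧ radialProj K z ∈ Z} with hB
    have hin : Measurable fun z : Eu n => ⟪a, z⟫ := by fun_prop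
    have hBm : MeasurableSet B :=
      (measurableSet_eq_fun hin measurable_const).inter (measurable_radialProj hc h0 hZ)
    have hb := hC a ha B hBm fun z hz => hz.1
    have hflat : volume (flatCone a B) = 0 := by
      refine measure_mono_null (t := ⋃ m : ℕ, ((m : ℝ) + 1) • radialCone K Z) ?_ ?_
      · rintro x ⟨hx1, -, -, hx4⟩
        rw [radialProj_smul (inv_pos.2 hx1)] at hx4
        obtain ⟨m, hm⟩ := exists_nat_gt (gauge K x)
        have hm0 : (0 : ℝ) < m + 1 := by positivity
        refine mem_iUnion.2 ⟨m, ?_⟩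
        rw [mem_smul_set_iff_inv_smul_mem₀ hm0.ne']
        refine ⟨?_, ?_⟩
        · rw [gauge_smul_pos (inv_pos.2 hm0), inv_mul_lt_iff₀ hm0]
          linarith
        · rwa [radialProj_smul (inv_pos.2 hm0)]
      · refine measure_iUnion_null fun m => ?_
        rw [Measure.addHaar_smul, hZ0, mul_zero]
    rw [hflat, mul_zero, mul_zero] at hb
    have ha' : 0 < ‖a‖ := norm_pos_iff.2 ha
    obtain ⟨M, hM⟩ := exists_lipschitzOnWith_radialProj hc hK h0 (inv_pos.2 ha')
    have hM' : LipschitzOnWith M (radialProj K) B := hM.mono fun z hz => by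
      have h1 : ⟪a, z⟫ ≤ ‖a‖ * ‖z‖ := real_inner_le_norm _ _
      rw [hz.1] at h1
      change ‖a‖⁻¹ ≤ ‖z‖
      rwa [inv_le_iff_one_le_mul₀' ha']
    have h2 := hM'.hausdorffMeasure_image_le hn1
    rw [hb, mul_zero, nonpos_iff_eq_zero] at h2
    refine measure_mono_null ?_ h2
    rintro z ⟨hz, hz0⟩
    have hr : radialProj K (⟪a, z⟫⁻¹ • z) = z := by
      rw [radialProj_smul (inv_pos.2 hz0), radialProj_of_mem_frontier hc h0 (hZK hz)]
    refine ⟨⟪a, z⟫⁻¹ • z, ⟨?_, ?_⟩, hr⟩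
    · rw [inner_smul_right, inv_mul_cancel₀ hz0.ne']
    · rw [hr]; exact hz
  refine measure_mono_null (t := ⋃ i : Fin n, ({z ∈ Z | 0 < ⟪EuclideanSpace.single i (1 : ℝ), z⟫} ∪
    {z ∈ Z | 0 < ⟪-EuclideanSpace.single i (1 : ℝ), z⟫})) ?_ ?_
  · intro z hz
    have hz0 := ne_zero_of_mem_frontier hc h0 (hZK hz)
    obtain ⟨i, hi⟩ : ∃ i, z i ≠ 0 := by
      by_contra! h
      exact hz0 (by ext i; simp [h i])
    refine mem_iUnion.2 ⟨i, ?_⟩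
    rcases lt_or_gt_of_ne hi with h | h
    · right
      refine ⟨hz, ?_⟩
      simpa [EuclideanSpace.inner_single_left] using h
    · left
      refine ⟨hz, ?_⟩
      simpa [EuclideanSpace.inner_single_left] using h
  · refine measure_iUnion_null fun i => measure_union_null (half _ ?_) (half _ ?_)
    · simp
    · simp

end ConeMeasureFormula

section ConeMeasureEquality

open scoped Topology

variable {n : ℕ} {K : Set (Eu n)}

theorem central_projection_bilipschitz {a x y : Eu n} {R δ ε : ℝ} (hR : 0 < R) (hδ : 0 < δ)
    (hδ4 : δ ≤ 1 / 4) (hε : 2 * ε * R = δ) (hy : ‖y‖ ≤ R)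
    (hax : |⟪a, x⟫ - 1| ≤ δ) (hay : |⟪a, y⟫ - 1| ≤ δ) (hxy : |⟪a, x⟫ - ⟪a, y⟫| ≤ ε * ‖x - y‖) :
    ‖⟪a, x⟫⁻¹ • x - ⟪a, y⟫⁻¹ • y‖ ≤ ((1 - 2 * δ) ^ 2)⁻¹ * ‖x - y‖ ∧
      ‖x - y‖ ≤ ((1 - 2 * δ) ^ 2)⁻¹ * ‖⟪a, x⟫⁻¹ • x - ⟪a, y⟫⁻¹ • y‖ := by
  rw [abs_le] at hax hay
  set s := ⟪a, x⟫ with hs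
  set t := ⟪a, y⟫ with ht
  have hs0 : 0 < s := by linarith
  have ht0 : 0 < t := by linarith
  have hε0 : 0 ≤ ε := by
    by_contra! h
    have := mul_neg_of_neg_of_pos h hR
    linarith
  set d := ‖x - y‖ with hd
  have hd0 : 0 ≤ d := norm_nonneg _
  have e1 : s • (s⁻¹ • x - t⁻¹ • y) = (x - y) + (t⁻¹ * (t - s)) • y := by
    rw [smul_sub, smul_smul, smul_smul, mul_inv_cancel₀ hs0.ne', one_smul, mul_sub,
      inv_mul_cancel₀ ht0.ne', sub_smul, one_smul, mul_comm]
    abel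
  set q := ‖s⁻¹ • x - t⁻¹ • y‖ with hq
  have hq0 : 0 ≤ q := norm_nonneg _
  have e2 : s * q = ‖(x - y) + (t⁻¹ * (t - s)) • y‖ := by
    rw [← e1, norm_smul, Real.norm_of_nonneg hs0.le]
  have e3 : ‖(t⁻¹ * (t - s)) • y‖ ≤ t⁻¹ * (δ / 2 * d) := by
    rw [norm_smul, norm_mul, norm_inv, Real.norm_of_nonneg ht0.le, mul_assoc]
    refine mul_le_mul_of_nonneg_left ?_ (inv_nonneg.2 ht0.le)
    rw [Real.norm_eq_abs, abs_sub_comm]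
    calc |s - t| * ‖y‖ ≤ ε * d * R := mul_le_mul hxy hy (norm_nonneg _) (by positivity)
      _ = δ / 2 * d := by rw [← hε]; ring
  have e4 : t⁻¹ * (δ / 2 * d) ≤ (1 - δ)⁻¹ * (δ / 2 * d) :=
    mul_le_mul_of_nonneg_right (inv_anti₀ (by linarith) (by linarith)) (by positivity)
  have e5 : (1 - δ)⁻¹ * (δ / 2 * d) ≤ δ * d := by
    rw [inv_mul_le_iff₀ (by linarith)]
    nlinarith [mul_nonneg hδ.le hd0]
  have u1 : s * q ≤ (1 + δ) * d := by
    rw [e2]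
    refine (norm_add_le _ _).trans ?_
    linarith
  have u2 : (1 - δ) * d ≤ s * q := by
    rw [e2]
    have := norm_sub_le ((x - y) + (t⁻¹ * (t - s)) • y) ((t⁻¹ * (t - s)) • y)
    rw [add_sub_cancel_right] at this
    linarith
  have hpos : 0 < (1 - 2 * δ) ^ 2 := by
    have : 0 < 1 - 2 * δ := by linarith
    positivity
  constructor
  · rw [le_inv_mul_iff₀ hpos]
    have : (1 - δ) * q ≤ (1 + δ) * d := le_trans (by nlinarith) u1
    have h1 : (1 - 2 * δ) ^ 2 * (1 + δ) ≤ 1 - δ := by nlinarith [mul_pos hδ hδ]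
    nlinarith
  · rw [le_inv_mul_iff₀ hpos]
    have : (1 - δ) * d ≤ (1 + δ) * q := le_trans u2 (by nlinarith)
    have h1 : (1 - 2 * δ) ^ 2 * (1 + δ) ≤ 1 - δ := by nlinarith [mul_pos hδ hδ]
    nlinarith

theorem measure_le_mul_of_countable_cover {α ι : Type*} [MeasurableSpace α] [Countable ι]
    {m₁ m₂ : Measure α} {c : ℝ≥0∞} {P : ι → Set α} (hP : ∀ i, MeasurableSet (P i))
    (h : ∀ i, ∀ A, MeasurableSet A → A ⊆ P i → m₁ A ≤ c * m₂ A) {A : Set α}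
    (hA : MeasurableSet A) (hAP : A ⊆ ⋃ i, P i) : m₁ A ≤ c * m₂ A := by
  have key : ∀ Q : ℕ → Set α, (∀ i, MeasurableSet (Q i)) →
      (∀ i, ∀ A, MeasurableSet A → A ⊆ Q i → m₁ A ≤ c * m₂ A) → A ⊆ ⋃ i, Q i →
      m₁ A ≤ c * m₂ A := by
    intro Q hQ hQm hAQ
    have hAd : A = ⋃ i, A ∩ disjointed Q i := by
      rw [← inter_iUnion, iUnion_disjointed, inter_eq_left.2 hAQ]
    have hm : ∀ i, MeasurableSet (A ∩ disjointed Q i) := fun i =>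
      hA.inter (MeasurableSet.disjointed hQ i)
    have hdisj : Pairwise (Function.onFun Disjoint fun i => A ∩ disjointed Q i) := fun i j hij =>
      (disjoint_disjointed Q hij).mono inter_subset_right inter_subset_right
    rw [hAd, measure_iUnion hdisj hm, measure_iUnion hdisj hm, ← ENNReal.tsum_mul_left]
    exact ENNReal.tsum_le_tsum fun i =>
      hQm i _ (hm i) (inter_subset_right.trans (disjointed_subset Q i))
  rcases isEmpty_or_nonempty ι with hι | hι
  · have : A = ∅ := by simpa using hAP
    simp [this]
  · obtain ⟨e, he⟩ := exists_surjective_nat ι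
    refine key (P ∘ e) (fun i => hP _) (fun i => h _) ?_
    exact hAP.trans_eq (he.iUnion_comp P).symm

theorem hausdorffMeasure_comparison_of_differentiable (hc : Convex ℝ K) (hK : IsCompact K)
    (h0 : (0 : Eu n) ∈ interior K) (hn : 0 < n) {C : ℝ≥0∞}
    (hC : ∀ a : Eu n, a ≠ 0 → ∀ B : Set (Eu n), MeasurableSet B → B ⊆ {z | ⟪a, z⟫ = 1} →
      μH[(n : ℝ) - 1] B = C * (ENNReal.ofReal ‖a‖ * volume (flatCone a B)))
    {A : Set (Eu n)} (hA : MeasurableSet A) (hAK : A ⊆ frontier K)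
    (hAd : ∀ x ∈ A, DifferentiableAt ℝ (gauge K) x) {δ : ℝ} (hδ : 0 < δ) (hδ4 : δ ≤ 1 / 4) :
    μH[(n : ℝ) - 1] A ≤
        ENNReal.ofReal ((1 - 2 * δ) ^ 2)⁻¹ ^ (2 * n + 1) * (C * coneMeasure K A) ∧
      C * coneMeasure K A ≤
        ENNReal.ofReal ((1 - 2 * δ) ^ 2)⁻¹ ^ (2 * n + 1) * μH[(n : ℝ) - 1] A := by
  obtain ⟨r, R, hr, hR, hb, -, -⟩ := exists_gauge_bounds hc hK h0
  set ε : ℝ := δ / (2 * R) with hε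
  have hε0 : 0 < ε := by positivity
  have hεR : 2 * ε * R = δ := by rw [hε]; field_simp
  set κ : ℝ := ((1 - 2 * δ) ^ 2)⁻¹ with hκ
  have hpos : 0 < (1 - 2 * δ) ^ 2 := by
    have : 0 < 1 - 2 * δ := by linarith
    positivity
  have hκ1 : 1 ≤ κ := (one_le_inv₀ hpos).2 (by nlinarith)
  have hκδ : 1 + δ ≤ κ := by
    rw [hκ, le_inv_comm₀ (by linarith) hpos, ← one_div, le_div_iff₀ (by linarith)]
    nlinarith [mul_pos hδ hδ]
  have hκδ' : κ⁻¹ ≤ 1 - δ := by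
    rw [hκ, inv_inv]; nlinarith
  set D : Set (Eu n) := {x | x ∈ frontier K ∧ DifferentiableAt ℝ (gauge K) x} with hD
  have hDm : MeasurableSet D :=
    isClosed_frontier.measurableSet.inter (measurableSet_of_differentiableAt ℝ (gauge K))
  have hgm := measurable_gradient (gauge K)
  set E : ℕ → Set (Eu n) := fun k =>
    {x | x ∈ D ∧ dist (gradient (gauge K) x) (TopologicalSpace.denseSeq (Eu n) k) < ε} with hE
  have hEm : ∀ k, MeasurableSet (E k) := fun k =>
    hDm.inter (measurableSet_lt (hgm.dist measurable_const) measurable_const)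
  have hpart : ∀ k, ∃ (t : ℕ → Set (Eu n)) (L : ℕ → Eu n →L[ℝ] ℝ), (∀ i, MeasurableSet (t i)) ∧
      (E k ⊆ ⋃ i, t i) ∧
      (∀ i, ApproximatesLinearOn (gauge K) (L i) (E k ∩ t i) (Real.toNNReal ε)) ∧
      ((E k).Nonempty → ∀ i, ∃ y ∈ E k, L i = fderiv ℝ (gauge K) y) := fun k => by
    obtain ⟨t, L, -, h1, h2, h3, h4⟩ := exists_partition_approximatesLinearOn_of_hasFDerivWithinAt
      (gauge K) (E k) (fderiv ℝ (gauge K)) (fun x hx => hx.1.2.hasFDerivAt.hasFDerivWithinAt)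
      (fun _ => Real.toNNReal ε) (fun _ => (Real.toNNReal_pos.2 hε0).ne')
    exact ⟨t, L, h1, h2, h3, h4⟩
  choose t L htm htE htL hLy using hpart
  set P : ℕ × ℕ → Set (Eu n) := fun j => E j.1 ∩ t j.1 j.2 with hP
  have hPm : ∀ j, MeasurableSet (P j) := fun j => (hEm _).inter (htm _ _)
  have hcov : A ⊆ ⋃ j, P j := by
    intro x hx
    obtain ⟨k, hk⟩ := (TopologicalSpace.denseRange_denseSeq (Eu n)).exists_dist_lt
      (gradient (gauge K) x) hε0
    have hxk : x ∈ E k := ⟨⟨hAK hx, hAd x hx⟩, hk⟩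
    obtain ⟨i, hi⟩ := mem_iUnion.1 (htE k hxk)
    exact mem_iUnion.2 ⟨(k, i), hxk, hi⟩
  have hpiece : ∀ j, ∀ A, MeasurableSet A → A ⊆ P j →
      μH[(n : ℝ) - 1] A ≤ ENNReal.ofReal κ ^ (2 * n + 1) * (C * coneMeasure K A) ∧
      C * coneMeasure K A ≤ ENNReal.ofReal κ ^ (2 * n + 1) * μH[(n : ℝ) - 1] A := by
    rintro ⟨k, i⟩ A hA hAP
    rcases A.eq_empty_or_nonempty with rfl | ⟨x₀, hx₀⟩
    · simp
    obtain ⟨y, hy, hLi⟩ := hLy k ⟨x₀, (hAP hx₀).1⟩ i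
    set a := gradient (gauge K) y with ha
    have hAD : ∀ x ∈ A, x ∈ D := fun x hx => (hAP hx).1.1
    have hnormR : ∀ x ∈ D, ‖x‖ ≤ R := fun x hx => by
      have := hb x
      rwa [(gauge_eq_one_iff hc h0).2 hx.1, mul_one] at this
    have hself : ∀ x ∈ D, ⟪gradient (gauge K) x, x⟫ = 1 := fun x hx => by
      rw [inner_gradient_gauge_self hx.2, (gauge_eq_one_iff hc h0).2 hx.1]
    have hgrR : ∀ x ∈ D, 1 ≤ ‖gradient (gauge K) x‖ * R := fun x hx => by
      rw [← hself x hx]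
      exact (real_inner_le_norm _ _).trans
        (mul_le_mul_of_nonneg_left (hnormR x hx) (norm_nonneg _))
    have hdist : ∀ x ∈ A, ‖gradient (gauge K) x - a‖ ≤ 2 * ε := fun x hx => by
      rw [← dist_eq_norm]
      have h1 := (hAP hx).1.2
      have h2 := hy.2
      have h3 := dist_triangle_right (gradient (gauge K) x) a
        (TopologicalSpace.denseSeq (Eu n) k)
      linarith
    have hax : ∀ x ∈ A, |⟪a, x⟫ - 1| ≤ δ := fun x hx => by
      rw [← hself x (hAD x hx), ← inner_sub_left, ← hεR]
      refine (abs_real_inner_le_norm _ _).trans ?_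
      rw [norm_sub_rev]
      exact mul_le_mul (hdist x hx) (hnormR x (hAD x hx)) (norm_nonneg _) (by positivity)
    have haxy : ∀ x ∈ A, ∀ y ∈ A, |⟪a, x⟫ - ⟪a, y⟫| ≤ ε * ‖x - y‖ := fun x hx z hz => by
      have h1 := htL k i x (hAP hx) z (hAP hz)
      rw [(gauge_eq_one_iff hc h0).2 (hAD x hx).1, (gauge_eq_one_iff hc h0).2 (hAD z hz).1,
        sub_self, zero_sub, norm_neg, Real.coe_toNNReal _ hε0.le, hLi, ← inner_gradient,
        inner_sub_right] at h1
      exact h1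
    have hbl := fun x hx z hz => central_projection_bilipschitz hR hδ hδ4 hεR (hnormR z (hAD z hz))
      (hax x hx) (hax z hz) (haxy x hx z hz)
    have hae : 2 * ε ≤ δ * ‖a‖ := by
      have h1 := hgrR y hy.1
      calc 2 * ε = 2 * ε * 1 := by ring
        _ ≤ 2 * ε * (‖a‖ * R) := mul_le_mul_of_nonneg_left h1 (by positivity)
        _ = δ * ‖a‖ := by rw [← hεR]; ring
    have hae' : ∀ x ∈ A, 2 * ε ≤ δ * ‖gradient (gauge K) x‖ := fun x hx => by
      have h1 := hgrR x (hAD x hx)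
      calc 2 * ε = 2 * ε * 1 := by ring
        _ ≤ 2 * ε * (‖gradient (gauge K) x‖ * R) := mul_le_mul_of_nonneg_left h1 (by positivity)
        _ = δ * ‖gradient (gauge K) x‖ := by rw [← hεR]; ring
    refine hausdorffMeasure_comparison_of_nearly_flat hc hK h0 hn hC hA
      (fun x hx => (hAD x hx).1) (a := a)
      (gradient_gauge_ne_zero hc hK h0 (ne_zero_of_mem_frontier hc h0 hy.1.1) hy.1.2) hκ1
      (fun x hx z hz => by rw [dist_eq_norm, dist_eq_norm]; exact (hbl x hx z hz).1)
      (fun x hx z hz => by rw [dist_eq_norm, dist_eq_norm]; exact (hbl x hx z hz).2)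
      (fun x hx => ?_) (fun x hx => ⟨?_, ?_⟩)
    · have := abs_le.1 (hax x hx)
      constructor <;> linarith
    · have h1 := norm_sub_norm_le (gradient (gauge K) x) a
      have h2 := hdist x hx
      have h3 := mul_le_mul_of_nonneg_right hκδ (norm_nonneg a)
      linarith
    · have h1 := norm_sub_norm_le a (gradient (gauge K) x)
      rw [norm_sub_rev] at h1
      have h2 := hdist x hx
      have h3 := mul_le_mul_of_nonneg_right hκδ (norm_nonneg (gradient (gauge K) x))
      have h4 := hae' x hx
      linarith
  constructor
  · have := measure_le_mul_of_countable_cover (m₁ := μH[(n : ℝ) - 1]) (m₂ := C • coneMeasure K)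
      (c := ENNReal.ofReal κ ^ (2 * n + 1)) hPm
      (fun j A hA hAP => (hpiece j A hA hAP).1) hA hcov
    exact this
  · have := measure_le_mul_of_countable_cover (m₂ := μH[(n : ℝ) - 1]) (m₁ := C • coneMeasure K)
      (c := ENNReal.ofReal κ ^ (2 * n + 1)) hPm
      (fun j A hA hAP => (hpiece j A hA hAP).2) hA hcov
    exact this

theorem hausdorffMeasure_eq_of_differentiable (hc : Convex ℝ K) (hK : IsCompact K)
    (h0 : (0 : Eu n) ∈ interior K) (hn : 0 < n) {C : ℝ≥0∞}
    (hC : ∀ a : Eu n, a ≠ 0 → ∀ B : Set (Eu n), MeasurableSet B → B ⊆ {z | ⟪a, z⟫ = 1} →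
      μH[(n : ℝ) - 1] B = C * (ENNReal.ofReal ‖a‖ * volume (flatCone a B)))
    {A : Set (Eu n)} (hA : MeasurableSet A) (hAK : A ⊆ frontier K)
    (hAd : ∀ x ∈ A, DifferentiableAt ℝ (gauge K) x) :
    μH[(n : ℝ) - 1] A = C * coneMeasure K A := by
  have hlim : Tendsto (fun δ : ℝ => ENNReal.ofReal ((1 - 2 * δ) ^ 2)⁻¹ ^ (2 * n + 1))
      (𝓝[>] 0) (nhds 1) := by
    have h1 : ContinuousAt (fun δ : ℝ => ((1 - 2 * δ) ^ 2)⁻¹) 0 :=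
      ContinuousAt.inv₀ (by fun_prop) (by norm_num)
    have h2 : Tendsto (fun δ : ℝ => ENNReal.ofReal ((1 - 2 * δ) ^ 2)⁻¹) (nhds 0) (nhds 1) := by
      have := ENNReal.tendsto_ofReal h1.tendsto
      simpa using this
    have h3 := ((ENNReal.continuous_pow (2 * n + 1)).tendsto 1).comp h2
    simp only [one_pow] at h3
    exact h3.mono_left nhdsWithin_le_nhds
  have hev : ∀ᶠ δ : ℝ in 𝓝[>] 0, 0 < δ ∧ δ ≤ 1 / 4 :=
    (eventually_mem_nhdsWithin.and
      (nhdsWithin_le_nhds (Iic_mem_nhds (show (0 : ℝ) < 1 / 4 by norm_num))))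
  have hgen : ∀ x y : ℝ≥0∞, (∀ δ : ℝ, 0 < δ → δ ≤ 1 / 4 →
      x ≤ ENNReal.ofReal ((1 - 2 * δ) ^ 2)⁻¹ ^ (2 * n + 1) * y) → x ≤ y := by
    intro x y h
    have h1 := ENNReal.Tendsto.mul_const (b := y) hlim (Or.inl one_ne_zero)
    rw [one_mul] at h1
    exact ge_of_tendsto h1 (hev.mono fun δ hδ => h δ hδ.1 hδ.2)
  apply le_antisymm
  · exact hgen _ _ fun δ h1 h2 =>
      (hausdorffMeasure_comparison_of_differentiable hc hK h0 hn hC hA hAK hAd h1 h2).1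
  · exact hgen _ _ fun δ h1 h2 =>
      (hausdorffMeasure_comparison_of_differentiable hc hK h0 hn hC hA hAK hAd h1 h2).2

theorem ae_differentiableAt_gauge (hc : Convex ℝ K) (hK : IsCompact K)
    (h0 : (0 : Eu n) ∈ interior K) : ∀ᵐ x : Eu n, DifferentiableAt ℝ (gauge K) x := by
  obtain ⟨r, R, -, -, -, -, hL⟩ := exists_gauge_bounds hc hK h0
  exact hL.ae_differentiableAt

theorem differentiableAt_radialProj_iff (hc : Convex ℝ K) (hK : IsCompact K)
    (h0 : (0 : Eu n) ∈ interior K) {x : Eu n} (hx : x ≠ 0) :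
    DifferentiableAt ℝ (gauge K) (radialProj K x) ↔ DifferentiableAt ℝ (gauge K) x := by
  have hg := gauge_pos_of_ne_zero hc hK h0 hx
  constructor
  · intro h
    have := differentiableAt_gauge_smul hg h
    rwa [gauge_smul_radialProj hg.ne'] at this
  · exact differentiableAt_gauge_smul (inv_pos.2 hg)

theorem radialProj_mem_frontier (hc : Convex ℝ K) (hK : IsCompact K)
    (h0 : (0 : Eu n) ∈ interior K) {x : Eu n} (hx : x ≠ 0) : radialProj K x ∈ frontier K := by
  have hg := gauge_pos_of_ne_zero hc hK h0 hx
  rw [← gauge_eq_one_iff hc h0, radialProj, gauge_smul_pos (inv_pos.2 hg), inv_mul_cancel₀ hg.ne']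

theorem volume_radialCone_nondifferentiable (hc : Convex ℝ K) (hK : IsCompact K)
    (h0 : (0 : Eu n) ∈ interior K) {Z : Set (Eu n)} (hZK : Z ⊆ frontier K)
    (hZ : ∀ x ∈ Z, ¬ DifferentiableAt ℝ (gauge K) x) : volume (radialCone K Z) = 0 := by
  refine measure_mono_null (fun x hx => ?_)
    (ae_iff.1 (ae_differentiableAt_gauge hc hK h0))
  have hx0 : x ≠ 0 := by
    rintro rfl
    refine ne_zero_of_mem_frontier hc h0 (hZK hx.2) ?_
    simp [radialProj]
  exact fun h => hZ _ hx.2 ((differentiableAt_radialProj_iff hc hK h0 hx0).2 h)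

theorem hausdorffMeasure_nondifferentiable (hc : Convex ℝ K) (hK : IsCompact K)
    (h0 : (0 : Eu n) ∈ interior K) (hn : 0 < n) :
    μH[(n : ℝ) - 1] {x | x ∈ frontier K ∧ ¬ DifferentiableAt ℝ (gauge K) x} = 0 := by
  obtain ⟨C, -, -, hC⟩ := exists_hausdorffMeasure_eq_flatCone hn
  refine hausdorffMeasure_eq_zero_of_radialCone hc hK h0 hn hC
    (isClosed_frontier.measurableSet.inter (measurableSet_of_differentiableAt ℝ (gauge K)).compl)
    (fun x hx => hx.1) ?_
  exact volume_radialCone_nondifferentiable hc hK h0 (fun x hx => hx.1) fun x hx => hx.2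

/-- Hausdorff measure on the boundary of a convex body is proportional to its cone measure. -/
theorem exists_hausdorffMeasure_restrict_frontier_eq (hn : 0 < n) :
    ∃ C : ℝ≥0∞, C ≠ 0 ∧ C ≠ ∞ ∧ ∀ K : Set (Eu n), Convex ℝ K → IsCompact K →
      (0 : Eu n) ∈ interior K → (μH[(n : ℝ) - 1]).restrict (frontier K) = C • coneMeasure K := by
  obtain ⟨C, hC0, hCt, hC⟩ := exists_hausdorffMeasure_eq_flatCone hn
  refine ⟨C, hC0, hCt, fun K hc hK h0 => ?_⟩
  ext A hA
  rw [Measure.restrict_apply hA, Measure.smul_apply, smul_eq_mul]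
  have hDm := measurableSet_of_differentiableAt ℝ (gauge K)
  set D := {x | DifferentiableAt ℝ (gauge K) x} with hD
  have hFm : MeasurableSet (frontier K) := isClosed_frontier.measurableSet
  have h1 : μH[(n : ℝ) - 1] (A ∩ frontier K) = μH[(n : ℝ) - 1] (A ∩ frontier K ∩ D) := by
    refine (measure_inter_conull' ?_).symm
    refine measure_mono_null ?_ (hausdorffMeasure_nondifferentiable hc hK h0 hn)
    exact fun x hx => ⟨hx.1.2, hx.2⟩
  rw [h1, hausdorffMeasure_eq_of_differentiable hc hK h0 hn hC ((hA.inter hFm).inter hDm)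
    (fun x hx => hx.1.2) (fun x hx => hx.2)]
  congr 1
  rw [coneMeasure_apply hc h0 ((hA.inter hFm).inter hDm), coneMeasure_apply hc h0 hA]
  refine setLIntegral_congr (Filter.eventuallyEq_set.2 ?_)
  have hne : ∀ᵐ x : Eu n, x ≠ 0 := by
    have : Nontrivial (Eu n) := by
      have : Nonempty (Fin n) := ⟨⟨0, hn⟩⟩
      infer_instance
    exact Measure.ae_ne volume 0
  filter_upwards [hne, ae_differentiableAt_gauge hc hK h0] with x hx hxd
  constructor
  · exact fun h => ⟨h.1, h.2.1.1⟩
  · exact fun h => ⟨h.1, ⟨h.2, radialProj_mem_frontier hc hK h0 hx⟩,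
      (differentiableAt_radialProj_iff hc hK h0 hx).2 hxd⟩

end ConeMeasureEquality

section SphericalMeasure

variable {n : ℕ} {K : Set (Eu n)}

/-- The normalized (by `n`) rotation invariant measure on the unit sphere. -/
def sphMeasure (n : ℕ) : Measure (Eu n) :=
  Measure.map (fun x : Eu n => ‖x‖⁻¹ • x) (volume.restrict (ball 0 1))

theorem measurable_inv_norm_smul : Measurable fun x : Eu n => ‖x‖⁻¹ • x := by fun_prop

instance : IsFiniteMeasure (sphMeasure n) := by
  have : IsFiniteMeasure (volume.restrict (ball (0 : Eu n) 1)) :=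
    isFiniteMeasure_restrict.2 measure_ball_lt_top.ne
  exact Measure.isFiniteMeasure_map _ _

theorem nontrivial_eu (hn : 0 < n) : Nontrivial (Eu n) := by
  have : Nonempty (Fin n) := ⟨⟨0, hn⟩⟩
  infer_instance

theorem ae_ne_zero_volume (hn : 0 < n) : ∀ᵐ x : Eu n, x ≠ 0 := by
  have := nontrivial_eu hn
  exact Measure.ae_ne volume 0

theorem sphMeasure_compl_sphere (hn : 0 < n) : sphMeasure n (sphere 0 1)ᶜ = 0 := by
  rw [sphMeasure, Measure.map_apply measurable_inv_norm_smul isClosed_sphere.measurableSet.compl]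
  refine measure_mono_null ?_ (ae_iff.1 (ae_restrict_of_ae (ae_ne_zero_volume hn)))
  intro x hx h
  exact hx (inv_norm_smul_mem_sphere h)

theorem lintegral_sublevel_eq_lintegral_toSphere (hn : 0 < n) {N : Eu n → ℝ} (hN : Measurable N)
    (hN0 : ∀ x, x ≠ 0 → 0 < N x) (hNs : ∀ c : ℝ, 0 < c → ∀ x, N (c • x) = c * N x)
    {Q : Eu n → ℝ≥0∞} (hQ : Measurable Q) (hQs : ∀ c : ℝ, 0 < c → ∀ x, Q (c • x) = Q x) :
    ∫⁻ x in {x | N x < 1}, Q x = ∫⁻ u : sphere (0 : Eu n) 1,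
      Q u * ENNReal.ofReal ((N u)⁻¹ ^ n / n) ∂(volume : Measure (Eu n)).toSphere := by
  have hmeas : MeasurableSet {x : Eu n | N x < 1} := measurableSet_lt hN measurable_const
  have h0 : MeasurableSet ({0}ᶜ : Set (Eu n)) := (measurableSet_singleton _).compl
  set F : Eu n → ℝ≥0∞ := {x | N x < 1}.indicator Q with hF
  have hFm : Measurable F := hQ.indicator hmeas
  rw [← lintegral_indicator hmeas]
  have e1 : ∫⁻ x, F x = ∫⁻ x : ({0}ᶜ : Set (Eu n)), F x ∂(volume.comap Subtype.val) := by
    rw [lintegral_subtype_comap h0, setLIntegral_congr (t := univ), setLIntegral_univ]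
    refine Filter.eventuallyEq_set.2 ?_
    filter_upwards [ae_ne_zero_volume hn] with x hx
    simp [hx]
  have hmp := (volume : Measure (Eu n)).measurePreserving_homeomorphUnitSphereProd
  set e := homeomorphUnitSphereProd (Eu n) with he
  have hG : Measurable fun z : sphere (0 : Eu n) 1 × Ioi (0 : ℝ) => F ((z.2 : ℝ) • (z.1 : Eu n)) :=
    hFm.comp (by fun_prop)
  have e2 : ∫⁻ x : ({0}ᶜ : Set (Eu n)), F x ∂(volume.comap Subtype.val) =
      ∫⁻ z : sphere (0 : Eu n) 1 × Ioi (0 : ℝ), F ((z.2 : ℝ) • (z.1 : Eu n))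
        ∂((volume : Measure (Eu n)).toSphere.prod
          (Measure.volumeIoiPow (Module.finrank ℝ (Eu n) - 1))) := by
    rw [← hmp.lintegral_comp hG]
    refine lintegral_congr fun x => ?_
    congr 1
    have := congrArg Subtype.val (e.symm_apply_apply x)
    rw [he, homeomorphUnitSphereProd_symm_apply_coe] at this
    exact this.symm
  have e0 : ∫⁻ x, {x | N x < 1}.indicator Q x = ∫⁻ x, F x := rfl
  rw [e0, e1, e2, lintegral_prod _ hG.aemeasurable]
  refine lintegral_congr fun u => ?_
  have hu0 : (u : Eu n) ≠ 0 := ne_zero_of_mem_unit_sphere u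
  have hNu := hN0 _ hu0
  have hpt : ∀ r : Ioi (0 : ℝ), F ((r : ℝ) • (u : Eu n)) =
      (Iio (⟨(N u)⁻¹, inv_pos.2 hNu⟩ : Ioi (0 : ℝ))).indicator (fun _ => Q u) r := fun r => by
    have hr : (0 : ℝ) < r := r.2
    simp only [hF, indicator, mem_ofPred_eq, hNs _ hr, hQs _ hr, mem_Iio]
    have : ((r : ℝ) * N u < 1) ↔ r < (⟨(N u)⁻¹, inv_pos.2 hNu⟩ : Ioi (0 : ℝ)) := by
      rw [← Subtype.coe_lt_coe]
      change _ ↔ (r : ℝ) < (N u)⁻¹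
      rw [← one_div, lt_div_iff₀ hNu]
    simp only [this]
  simp only [hpt]
  rw [lintegral_indicator measurableSet_Iio, setLIntegral_const, Measure.volumeIoiPow_apply_Iio,
    finrank_euclideanSpace_fin, Nat.sub_add_cancel hn, Nat.cast_sub hn, Nat.cast_one,
    sub_add_cancel]

theorem map_restrict_sublevel_eq_withDensity (hn : 0 < n) {N : Eu n → ℝ} (hN : Measurable N)
    (hN0 : ∀ x, x ≠ 0 → 0 < N x) (hNs : ∀ c : ℝ, 0 < c → ∀ x, N (c • x) = c * N x) :
    Measure.map (fun x : Eu n => ‖x‖⁻¹ • x) (volume.restrict {x | N x < 1}) =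
      (sphMeasure n).withDensity fun u => ENNReal.ofReal ((N u)⁻¹ ^ n) := by
  have hm := measurable_inv_norm_smul (n := n)
  ext A hA
  have hQm : Measurable fun x : Eu n => A.indicator (1 : Eu n → ℝ≥0∞) (‖x‖⁻¹ • x) :=
    (measurable_one.indicator hA).comp hm
  have hinv : ∀ c : ℝ, 0 < c → ∀ x : Eu n, ‖c • x‖⁻¹ • c • x = ‖x‖⁻¹ • x := fun c hc x => by
    rw [norm_smul, Real.norm_of_nonneg hc.le, smul_smul, mul_inv, mul_comm c⁻¹, mul_assoc,
      inv_mul_cancel₀ hc.ne', mul_one]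
  have h1 := lintegral_sublevel_eq_lintegral_toSphere hn hN hN0 hNs hQm
    fun c hc x => by simp only [hinv c hc x]
  have h2 := lintegral_sublevel_eq_lintegral_toSphere hn (N := fun x => ‖x‖) measurable_norm
    (fun x hx => norm_pos_iff.2 hx)
    (fun c hc x => by rw [norm_smul, Real.norm_of_nonneg hc.le])
    (Q := fun x => A.indicator (1 : Eu n → ℝ≥0∞) (‖x‖⁻¹ • x) *
      ENNReal.ofReal ((N (‖x‖⁻¹ • x))⁻¹ ^ n))
    (hQm.mul (ENNReal.measurable_ofReal.comp (((hN.comp hm).inv).pow_const n)))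
    (fun c hc x => by simp only [hinv c hc x])
  have hball : {x : Eu n | ‖x‖ < 1} = ball 0 1 := by ext; simp
  have e1 : Measure.map (fun x : Eu n => ‖x‖⁻¹ • x) (volume.restrict {x | N x < 1}) A =
      ∫⁻ x in {x | N x < 1}, A.indicator (1 : Eu n → ℝ≥0∞) (‖x‖⁻¹ • x) := by
    rw [← lintegral_indicator_one hA, lintegral_map (measurable_one.indicator hA) hm]
  have hd : Measurable fun u : Eu n => ENNReal.ofReal ((N u)⁻¹ ^ n) :=
    ENNReal.measurable_ofReal.comp (hN.inv.pow_const n)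
  have e2 : ((sphMeasure n).withDensity fun u => ENNReal.ofReal ((N u)⁻¹ ^ n)) A =
      ∫⁻ x in ball (0 : Eu n) 1, A.indicator (1 : Eu n → ℝ≥0∞) (‖x‖⁻¹ • x) *
        ENNReal.ofReal ((N (‖x‖⁻¹ • x))⁻¹ ^ n) := by
    rw [withDensity_apply _ hA, ← lintegral_indicator hA, sphMeasure,
      lintegral_map (hd.indicator hA) hm]
    refine lintegral_congr fun x => ?_
    by_cases hx : ‖x‖⁻¹ • x ∈ A <;> simp [hx]
  rw [e1, h1, e2, ← hball, h2]
  refine lintegral_congr fun u => ?_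
  have hu : ‖(u : Eu n)‖ = 1 := by simp
  have hNu := hN0 _ (ne_zero_of_mem_unit_sphere u)
  rw [hu, inv_one, one_smul, one_pow, mul_assoc, ← ENNReal.ofReal_mul (by positivity), mul_one_div]

theorem volume_sublevel_eq_lintegral (hn : 0 < n) {N : Eu n → ℝ} (hN : Measurable N)
    (hN0 : ∀ x, x ≠ 0 → 0 < N x) (hNs : ∀ c : ℝ, 0 < c → ∀ x, N (c • x) = c * N x) :
    volume {x | N x < 1} = ∫⁻ u, ENNReal.ofReal ((N u)⁻¹ ^ n) ∂(sphMeasure n) := by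
  have h := congrArg (fun m : Measure (Eu n) => m univ)
    (map_restrict_sublevel_eq_withDensity hn hN hN0 hNs)
  simp only [Measure.map_apply measurable_inv_norm_smul MeasurableSet.univ, preimage_univ,
    Measure.restrict_apply_univ, withDensity_apply _ MeasurableSet.univ, Measure.restrict_univ] at h
  exact h

/-- The surface area measure of a convex body, up to a constant depending on `n`. -/
def surfMeasure (K : Set (Eu n)) : Measure (Eu n) :=
  Measure.map (unitNormal K) (coneMeasure K)

theorem surfMeasure_eq_map (hc : Convex ℝ K) (h0 : (0 : Eu n) ∈ interior K)
    (hK : IsCompact K) (hn : 0 < n) :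
    surfMeasure K = Measure.map (unitNormal K)
      ((volume.restrict {x | gauge K x < 1}).withDensity fun x => ‖gradient (gauge K) x‖ₑ) := by
  rw [surfMeasure, coneMeasure,
    Measure.map_map measurable_unitNormal (measurable_radialProj hc h0)]
  refine Measure.map_congr ?_
  refine (withDensity_absolutelyContinuous _ _).ae_le ?_
  filter_upwards [ae_restrict_of_ae (ae_ne_zero_volume hn)] with x hx
  rw [Function.comp_apply, radialProj,
    unitNormal_smul (inv_pos.2 (gauge_pos_of_ne_zero hc hK h0 hx))]

theorem isFiniteMeasure_surfMeasure (hc : Convex ℝ K) (h0 : (0 : Eu n) ∈ interior K)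
    (hK : IsCompact K) (hn : 0 < n) : IsFiniteMeasure (surfMeasure K) := by
  rw [surfMeasure_eq_map hc h0 hK hn]
  obtain ⟨r, R, -, -, -, -, hL⟩ := exists_gauge_bounds hc hK h0
  have : IsFiniteMeasure ((volume.restrict {x | gauge K x < 1}).withDensity
      fun x => ‖gradient (gauge K) x‖ₑ) := by
    refine isFiniteMeasure_withDensity ?_
    refine (lt_of_le_of_lt (lintegral_mono (g := fun _ => ((Real.toNNReal r⁻¹ : ℝ≥0) : ℝ≥0∞))
      fun x => ?_) ?_).ne
    · rw [← ofReal_norm]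
      refine ENNReal.ofReal_le_of_le_toReal ?_
      exact norm_gradient_gauge_le hL x
    · rw [setLIntegral_const]
      refine ENNReal.mul_lt_top ENNReal.coe_lt_top ?_
      refine (measure_mono fun x (hx : gauge K x < 1) => ?_).trans_lt hK.measure_lt_top
      exact (gauge_le_one_iff hc hK h0).1 hx.le
  exact Measure.isFiniteMeasure_map _ _

theorem convex_image_sub (hc : Convex ℝ K) (y : Eu n) : Convex ℝ ((fun z => z - y) '' K) := by
  rintro _ ⟨x, hx, rfl⟩ _ ⟨z, hz, rfl⟩ a b ha hb hab
  refine ⟨a • x + b • z, hc hx hz ha hb hab, ?_⟩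
  have : y = a • y + b • y := by rw [← add_smul, hab, one_smul]
  simp only
  conv_lhs => rw [this]
  rw [smul_sub, smul_sub]
  abel

theorem isOuterNormal_image_sub (y x u : Eu n) :
    IsOuterNormal ((fun z => z - y) '' K) (x - y) u ↔ IsOuterNormal K x u := by
  simp [IsOuterNormal, inner_sub_left]

theorem gaussMap_image_sub (y x : Eu n) :
    gaussMap ((fun z => z - y) '' K) (x - y) = gaussMap K x := by
  have h : IsOuterNormal ((fun z => z - y) '' K) (x - y) = IsOuterNormal K x :=
    funext fun u => propext (isOuterNormal_image_sub y x u)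
  unfold gaussMap
  rw [h]

theorem lpSurf_eq_lintegral_surfMeasure (hn : 0 < n) {C : ℝ≥0∞}
    (hC : ∀ K : Set (Eu n), Convex ℝ K → IsCompact K →
      (0 : Eu n) ∈ interior K → (μH[(n : ℝ) - 1]).restrict (frontier K) = C • coneMeasure K)
    (hc : Convex ℝ K) (hK : IsCompact K) {y : Eu n} (hy : y ∈ interior K) (p : ℝ)
    {ω : Set (Eu n)} (hω : MeasurableSet ω) :
    lpSurf p K ω = C * ∫⁻ u in ω, ENNReal.ofReal (suppFn K u ^ (1 - p))
      ∂(surfMeasure ((fun z => z - y) '' K)) := by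
  set T : Eu n ≃ₜ Eu n := Homeomorph.subRight y with hT
  set K' : Set (Eu n) := (fun z => z - y) '' K with hK'
  have hKT : K' = T '' K := rfl
  have hKc : IsCompact K' := hK.image (by fun_prop)
  have hcc : Convex ℝ K' := convex_image_sub hc y
  have h0 : (0 : Eu n) ∈ interior K' := by
    rw [hKT, ← T.image_interior]
    exact ⟨y, hy, by simp [hT]⟩
  have hFr : frontier K' = T '' frontier K := by rw [hKT, T.image_frontier]
  have hne : K.Nonempty := ⟨y, interior_subset hy⟩
  have hmp : MeasurePreserving (fun z : Eu n => z - y) (μH[(n : ℝ) - 1]) (μH[(n : ℝ) - 1]) :=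
    ⟨by fun_prop, (IsometryEquiv.subRight y).map_hausdorffMeasure _⟩
  have hemb : MeasurableEmbedding fun z : Eu n => z - y := T.measurableEmbedding
  have step1 : lpSurf p K ω = ∫⁻ x in {x ∈ frontier K' | gaussMap K' x ∈ ω},
      ENNReal.ofReal (⟪x + y, gaussMap K' x⟫ ^ (1 - p)) ∂(μH[(n:ℝ) - 1]) := by
    rw [← hmp.setLIntegral_comp_preimage_emb hemb, lpSurf]
    have : {x ∈ frontier K | gaussMap K x ∈ ω} =
        (fun z => z - y) ⁻¹' {x ∈ frontier K' | gaussMap K' x ∈ ω} := by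
      ext x
      simp only [mem_ofPred_eq, mem_preimage, hK', gaussMap_image_sub]
      refine and_congr_left fun _ => ?_
      have h2 : (x - y ∈ frontier K') ↔ T x ∈ T '' frontier K := by rw [← hFr]; rfl
      rw [← hK', h2, T.injective.mem_set_image]
    rw [this]
    refine lintegral_congr fun x => ?_
    simp only [hK', gaussMap_image_sub, sub_add_cancel]
  have hae : ∀ᵐ x ∂((μH[(n : ℝ) - 1]).restrict (frontier K')),
      gaussMap K' x = unitNormal K' x ∧ ⟪x + y, unitNormal K' x⟫ = suppFn K (unitNormal K' x) := by
    rw [ae_restrict_iff' isClosed_frontier.measurableSet, ae_iff]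
    refine measure_mono_null ?_ (hausdorffMeasure_nondifferentiable hcc hKc h0 hn)
    intro x hx
    simp only [mem_ofPred_eq, Classical.not_imp] at hx
    refine ⟨hx.1, fun hd => hx.2 ⟨gaussMap_eq_unitNormal hcc hKc h0 hx.1 hd, ?_⟩⟩
    have hx0 := ne_zero_of_mem_frontier hcc h0 hx.1
    have h1 : suppFn K' (unitNormal K' x) = ⟪x, unitNormal K' x⟫ := by
      rw [suppFn_unitNormal hcc hKc h0 hx0 hd]
      conv_rhs => rw [unitNormal]
      rw [inner_smul_right, real_inner_comm, inner_gradient_gauge_self hd,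
        (gauge_eq_one_iff hcc h0).2 hx.1, mul_one]
    rw [inner_add_left, ← h1, hK', suppFn_image_sub hK hne, sub_add_cancel]
  have hnm : Measurable (unitNormal K') := measurable_unitNormal
  have hhm : Measurable fun u => ENNReal.ofReal (suppFn K u ^ (1 - p)) :=
    ENNReal.measurable_ofReal.comp
      ((continuous_suppFn hK hne).measurable.pow_const (1 - p))
  have step2 : ∫⁻ x in {x ∈ frontier K' | gaussMap K' x ∈ ω},
      ENNReal.ofReal (⟪x + y, gaussMap K' x⟫ ^ (1 - p)) ∂(μH[(n:ℝ) - 1]) =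
      ∫⁻ x in unitNormal K' ⁻¹' ω, ENNReal.ofReal (suppFn K (unitNormal K' x) ^ (1 - p))
        ∂((μH[(n : ℝ) - 1]).restrict (frontier K')) := by
    rw [Measure.restrict_restrict (hnm hω)]
    have hset : ({x ∈ frontier K' | gaussMap K' x ∈ ω} : Set (Eu n)) =ᵐ[μH[(n : ℝ) - 1]]
        (unitNormal K' ⁻¹' ω ∩ frontier K' : Set (Eu n)) := by
      rw [ae_restrict_iff' isClosed_frontier.measurableSet] at hae
      refine Filter.eventuallyEq_set.2 ?_
      filter_upwards [hae] with x hx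
      constructor
      · rintro ⟨h1, h2⟩
        exact ⟨by rw [mem_preimage, ← (hx h1).1]; exact h2, h1⟩
      · rintro ⟨h1, h2⟩
        exact ⟨h2, by rw [(hx h2).1]; exact h1⟩
    rw [setLIntegral_congr hset]
    refine lintegral_congr_ae ?_
    refine ae_mono (Measure.restrict_mono inter_subset_right le_rfl) ?_
    filter_upwards [hae] with x hx
    rw [hx.1, hx.2]
  rw [step1, step2, hC K' hcc hKc h0, Measure.restrict_smul, lintegral_smul_measure, smul_eq_mul,
    surfMeasure, setLIntegral_map hω hhm hnm]

end SphericalMeasure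

section VolumeDerivative

open scoped Topology

variable {n : ℕ} {K : Set (Eu n)}

theorem zero_mem_interior_wulff {f : Eu n → ℝ} {m : ℝ} (hm : 0 < m)
    (hf : ∀ u ∈ sphere (0 : Eu n) 1, m ≤ f u) : (0 : Eu n) ∈ interior (wulff f) := by
  rw [mem_interior_iff_mem_nhds]
  refine Filter.mem_of_superset (ball_mem_nhds 0 hm) fun x hx u hu => ?_
  have h1 : ‖u‖ = 1 := by simpa using hu
  have h2 : ‖x‖ < m := by simpa using hx
  have h3 := real_inner_le_norm x u
  rw [h1, mul_one] at h3
  exact (h3.trans h2.le).trans (hf u hu)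

theorem inv_gauge_wulff_mul_inner_le {f : Eu n → ℝ} (hfc : Continuous f) {m : ℝ} (hm : 0 < m)
    (hf : ∀ u ∈ sphere (0 : Eu n) 1, m ≤ f u) {x : Eu n} (hx : x ≠ 0) {u : Eu n}
    (hu : u ∈ sphere (0 : Eu n) 1) : (gauge (wulff f) x)⁻¹ * ⟪x, u⟫ ≤ f u := by
  have h0 := zero_mem_interior_wulff hm hf
  have hg := gauge_pos_of_ne_zero (convex_wulff f) (isCompact_wulff hfc) h0 hx
  have h1 : (gauge (wulff f) x)⁻¹ • x ∈ wulff f := by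
    rw [← gauge_le_one_iff (convex_wulff f) (isCompact_wulff hfc) h0,
      gauge_smul_pos (inv_pos.2 hg), inv_mul_cancel₀ hg.ne']
  have h2 := h1 u hu
  rwa [real_inner_smul_left] at h2

theorem exists_inv_gauge_wulff_mul_inner_eq {f : Eu n → ℝ} (hfc : Continuous f) {m : ℝ}
    (hm : 0 < m) (hf : ∀ u ∈ sphere (0 : Eu n) 1, m ≤ f u) {x : Eu n} (hx : x ≠ 0) :
    ∃ u ∈ sphere (0 : Eu n) 1, (gauge (wulff f) x)⁻¹ * ⟪x, u⟫ = f u := by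
  have h0 := zero_mem_interior_wulff hm hf
  have hg := gauge_pos_of_ne_zero (convex_wulff f) (isCompact_wulff hfc) h0 hx
  by_contra! hne
  set y := (gauge (wulff f) x)⁻¹ • x with hy
  have hcont : Continuous fun u : Eu n => f u - ⟪y, u⟫ := by fun_prop
  obtain ⟨v, hv, hmin⟩ := (isCompact_sphere (0 : Eu n) 1).exists_isMinOn
    ⟨_, inv_norm_smul_mem_sphere hx⟩ hcont.continuousOn
  have hpos : 0 < f v - ⟪y, v⟫ := by
    rw [hy, real_inner_smul_left]
    exact sub_pos.2 (lt_of_le_of_ne (inv_gauge_wulff_mul_inner_le hfc hm hf hx hv) (hne v hv))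
  have hint : y ∈ interior (wulff f) := by
    rw [mem_interior_iff_mem_nhds]
    refine Filter.mem_of_superset (ball_mem_nhds y hpos) fun z hz u hu => ?_
    have h1 : ‖u‖ = 1 := by simpa using hu
    have h2 : ‖z - y‖ < f v - ⟪y, v⟫ := by simpa [dist_eq_norm] using hz
    have h3 := real_inner_le_norm (z - y) u
    rw [h1, mul_one, inner_sub_left] at h3
    have h4 : f v - ⟪y, v⟫ ≤ f u - ⟪y, u⟫ := hmin hu
    linarith
  rw [← gauge_lt_one_iff (convex_wulff f) h0, hy, gauge_smul_pos (inv_pos.2 hg),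
    inv_mul_cancel₀ hg.ne'] at hint
  exact lt_irrefl _ hint

/-- A family of radii which are extremal for the linear perturbations `h + t g`. -/
structure IsRadialFamily (h g : Eu n → ℝ) (t₀ m M G : ℝ) (x : Eu n) (ρ : ℝ → ℝ) : Prop where
  pos : ∀ t, |t| ≤ t₀ → 0 < ρ t
  le : ∀ t, |t| ≤ t₀ → ∀ u ∈ sphere (0 : Eu n) 1, ρ t * ⟪x, u⟫ ≤ h u + t * g u
  exists_eq : ∀ t, |t| ≤ t₀ → ∃ u ∈ sphere (0 : Eu n) 1, ρ t * ⟪x, u⟫ = h u + t * g u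
  lower : ∀ t, |t| ≤ t₀ → ∀ u ∈ sphere (0 : Eu n) 1, m ≤ h u + t * g u
  upper : ∀ t, |t| ≤ t₀ → ∀ u ∈ sphere (0 : Eu n) 1, h u + t * g u ≤ M
  bound : ∀ u ∈ sphere (0 : Eu n) 1, |g u| ≤ G

namespace IsRadialFamily

variable {h g : Eu n → ℝ} {t₀ m M G : ℝ} {x : Eu n} {ρ : ℝ → ℝ}

theorem le_upper (H : IsRadialFamily h g t₀ m M G x ρ) (hx : x ∈ sphere (0 : Eu n) 1) {t : ℝ}
    (ht : |t| ≤ t₀) : ρ t ≤ M := by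
  have h1 := (H.le t ht x hx).trans (H.upper t ht x hx)
  have h2 : ‖x‖ = 1 := by simpa using hx
  rwa [real_inner_self_eq_norm_sq, h2, one_pow, mul_one] at h1

theorem sub_le (H : IsRadialFamily h g t₀ m M G x ρ) (hm : 0 < m)
    (hx : x ∈ sphere (0 : Eu n) 1) {s t : ℝ}
    (hs : |s| ≤ t₀) (ht : |t| ≤ t₀) : ρ t - ρ s ≤ G * M / m * |t - s| := by
  obtain ⟨u, hu, hus⟩ := H.exists_eq s hs
  have h1 := H.le t ht u hu
  have h2 : m ≤ ρ s * ⟪x, u⟫ := hus ▸ H.lower s hs u hu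
  have hρ := H.pos s hs
  have hi : 0 < ⟪x, u⟫ := by
    by_contra! hcon
    have := mul_nonpos_of_nonneg_of_nonpos hρ.le hcon
    linarith
  have h3 : m ≤ M * ⟪x, u⟫ :=
    h2.trans (mul_le_mul_of_nonneg_right (H.le_upper hx hs) hi.le)
  have hM : 0 < M := hρ.trans_le (H.le_upper hx hs)
  have h4 : (ρ t - ρ s) * ⟪x, u⟫ ≤ |t - s| * G := by
    have h5 : (t - s) * g u ≤ |t - s| * G := by
      refine (le_abs_self _).trans ?_
      rw [abs_mul]
      exact mul_le_mul_of_nonneg_left (H.bound u hu) (abs_nonneg _)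
    nlinarith
  rcases le_or_gt (ρ t - ρ s) 0 with hneg | hpos
  · have hG : 0 ≤ G := (abs_nonneg _).trans (H.bound u hu)
    exact hneg.trans (by positivity)
  · have h6 : (ρ t - ρ s) * m ≤ M * (|t - s| * G) := by
      calc (ρ t - ρ s) * m ≤ (ρ t - ρ s) * (M * ⟪x, u⟫) := mul_le_mul_of_nonneg_left h3 hpos.le
        _ = M * ((ρ t - ρ s) * ⟪x, u⟫) := by ring
        _ ≤ M * (|t - s| * G) := mul_le_mul_of_nonneg_left h4 hM.le
    calc ρ t - ρ s ≤ M * (|t - s| * G) / m := (le_div_iff₀ hm).2 h6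
      _ = G * M / m * |t - s| := by ring

theorem abs_sub_le (H : IsRadialFamily h g t₀ m M G x ρ) (hm : 0 < m)
    (hx : x ∈ sphere (0 : Eu n) 1) {s t : ℝ}
    (hs : |s| ≤ t₀) (ht : |t| ≤ t₀) : |ρ t - ρ s| ≤ G * M / m * |t - s| := by
  rw [abs_le]
  have h1 := H.sub_le hm hx hs ht
  have h2 := H.sub_le hm hx ht hs
  rw [abs_sub_comm] at h2
  constructor <;> linarith

theorem hasDerivAt (H : IsRadialFamily h g t₀ m M G x ρ) (hm : 0 < m) (ht₀ : 0 < t₀)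
    (hx : x ∈ sphere (0 : Eu n) 1) (hh : Continuous h) (hg : Continuous g) {v : Eu n}
    (hv : v ∈ sphere (0 : Eu n) 1) (hv0 : ρ 0 * ⟪x, v⟫ = h v)
    (huniq : ∀ u ∈ sphere (0 : Eu n) 1, ρ 0 * ⟪x, u⟫ = h u → u = v) :
    HasDerivAt ρ (g v / ⟪x, v⟫) 0 := by
  have hnear : ∀ᶠ t : ℝ in 𝓝 0, |t| ≤ t₀ := by
    have := closedBall_mem_nhds (0 : ℝ) ht₀
    filter_upwards [this] with t ht
    simpa using ht
  have h00 : |(0 : ℝ)| ≤ t₀ := by simpa using ht₀.le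
  have hρc : Tendsto ρ (𝓝 0) (𝓝 (ρ 0)) := by
    rw [tendsto_iff_dist_tendsto_zero]
    have h1 : Tendsto (fun t : ℝ => G * M / m * |t - 0|) (𝓝 0) (𝓝 0) := by
      have : Continuous fun t : ℝ => G * M / m * |t - 0| := by fun_prop
      simpa using this.tendsto 0
    refine squeeze_zero' (Filter.Eventually.of_forall fun _ => dist_nonneg) ?_ h1
    filter_upwards [hnear] with t ht
    exact H.abs_sub_le hm hx h00 ht
  have hex : ∀ t : ℝ, ∃ u ∈ sphere (0 : Eu n) 1, |t| ≤ t₀ → ρ t * ⟪x, u⟫ = h u + t * g u := by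
    intro t
    by_cases ht : |t| ≤ t₀
    · obtain ⟨u, hu, hut⟩ := H.exists_eq t ht
      exact ⟨u, hu, fun _ => hut⟩
    · exact ⟨v, hv, fun h => absurd h ht⟩
  choose w hw hwt using hex
  have hwv : Tendsto w (𝓝 0) (𝓝 v) := by
    refine (isCompact_sphere (0 : Eu n) 1).tendsto_nhds_of_unique_mapClusterPt
      (Filter.Eventually.of_forall hw) fun u hu hcl => huniq u hu ?_
    obtain ⟨U, hU, hUw⟩ := mapClusterPt_iff_ultrafilter.1 hcl
    have l1 : Tendsto (fun t => ρ t * ⟪x, w t⟫) U (𝓝 (ρ 0 * ⟪x, u⟫)) :=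
      (hρc.mono_left hU).mul (tendsto_const_nhds.inner hUw)
    have l2 : Tendsto (fun t => h (w t) + t * g (w t)) U (𝓝 (h u + 0 * g u)) :=
      ((hh.tendsto u).comp hUw).add ((tendsto_id.mono_left hU).mul ((hg.tendsto u).comp hUw))
    rw [zero_mul, add_zero] at l2
    refine tendsto_nhds_unique_of_eventuallyEq l1 l2 ?_
    filter_upwards [hU hnear] with t ht
    exact hwt t ht
  have hpos_of : ∀ t, |t| ≤ t₀ → ∀ u ∈ sphere (0 : Eu n) 1, ρ t * ⟪x, u⟫ = h u + t * g u →
      0 < ⟪x, u⟫ := by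
    intro t ht u hu he
    have h1 := H.lower t ht u hu
    rw [← he] at h1
    by_contra! hcon
    have := mul_nonpos_of_nonneg_of_nonpos (H.pos t ht).le hcon
    linarith
  have hxv : 0 < ⟪x, v⟫ := hpos_of 0 h00 v hv (by rw [hv0, zero_mul, add_zero])
  rw [hasDerivAt_iff_tendsto_slope]
  have hq : Tendsto (fun t => g (w t) / ⟪x, w t⟫) (𝓝 0) (𝓝 (g v / ⟪x, v⟫)) :=
    ((hg.tendsto v).comp hwv).div (tendsto_const_nhds.inner hwv) hxv.ne'
  rw [tendsto_iff_dist_tendsto_zero]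
  have hq' := (tendsto_iff_dist_tendsto_zero.1 hq).mono_left (nhdsWithin_le_nhds (s := {0}ᶜ))
  refine squeeze_zero' (Filter.Eventually.of_forall fun _ => dist_nonneg) ?_ hq'
  filter_upwards [nhdsWithin_le_nhds hnear, self_mem_nhdsWithin] with t ht ht0
  have ht0' : t ≠ 0 := ht0
  have hi := hpos_of t ht (w t) (hw t) (hwt t ht)
  have a1 : t * g (w t) ≤ (ρ t - ρ 0) * ⟪x, w t⟫ := by
    have := H.le 0 h00 (w t) (hw t)
    have := hwt t ht
    nlinarith
  have a2 : (ρ t - ρ 0) * ⟪x, v⟫ ≤ t * g v := by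
    have := H.le t ht v hv
    nlinarith
  have b1 : t * (g (w t) / ⟪x, w t⟫) ≤ ρ t - ρ 0 := by
    rw [← mul_div_assoc, div_le_iff₀ hi]; exact a1
  have b2 : ρ t - ρ 0 ≤ t * (g v / ⟪x, v⟫) := by
    rw [← mul_div_assoc, le_div_iff₀ hxv]; exact a2
  rw [slope_def_field, sub_zero, Real.dist_eq, Real.dist_eq]
  rcases lt_or_gt_of_ne ht0' with hneg | hpos
  · have c1 : (ρ t - ρ 0) / t ≤ g (w t) / ⟪x, w t⟫ := by
      rw [div_le_iff_of_neg hneg, mul_comm]; exact b1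
    have c2 : g v / ⟪x, v⟫ ≤ (ρ t - ρ 0) / t := by
      rw [le_div_iff_of_neg hneg, mul_comm]; exact b2
    rw [abs_of_nonneg (by linarith), abs_of_nonneg (by linarith)]
    linarith
  · have c1 : g (w t) / ⟪x, w t⟫ ≤ (ρ t - ρ 0) / t := by
      rw [le_div_iff₀ hpos, mul_comm]; exact b1
    have c2 : (ρ t - ρ 0) / t ≤ g v / ⟪x, v⟫ := by
      rw [div_le_iff₀ hpos, mul_comm]; exact b2
    rw [abs_of_nonpos (by linarith), abs_of_nonpos (by linarith)]
    linarith

end IsRadialFamily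

theorem ae_sphMeasure_differentiableAt_gauge (hn : 0 < n) (hc : Convex ℝ K) (hK : IsCompact K)
    (h0 : (0 : Eu n) ∈ interior K) : ∀ᵐ x ∂(sphMeasure n), DifferentiableAt ℝ (gauge K) x := by
  rw [sphMeasure, ae_map_iff measurable_inv_norm_smul.aemeasurable
    (measurableSet_of_differentiableAt ℝ (gauge K))]
  filter_upwards [ae_restrict_of_ae (ae_ne_zero_volume hn),
    ae_restrict_of_ae (ae_differentiableAt_gauge hc hK h0)] with x hx hd
  exact differentiableAt_gauge_smul (inv_pos.2 (norm_pos_iff.2 hx)) hd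

theorem ae_sphMeasure_mem_sphere (hn : 0 < n) : ∀ᵐ x ∂(sphMeasure n), x ∈ sphere (0 : Eu n) 1 :=
  ae_iff.2 (sphMeasure_compl_sphere hn)

theorem volume_real_wulff (hn : 0 < n) {f : Eu n → ℝ} (hfc : Continuous f) {m : ℝ} (hm : 0 < m)
    (hf : ∀ u ∈ sphere (0 : Eu n) 1, m ≤ f u) :
    volume.real (wulff f) = ∫ u, (gauge (wulff f) u)⁻¹ ^ n ∂(sphMeasure n) := by
  have h0 := zero_mem_interior_wulff hm hf
  have hc := convex_wulff f
  have hK := isCompact_wulff hfc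
  have hgm := (continuous_gauge_of_convex hc h0).measurable
  have h1 : volume (wulff f) = volume {x | gauge (wulff f) x < 1} := by
    have : {x | gauge (wulff f) x < 1} = interior (wulff f) := by
      ext x; exact gauge_lt_one_iff hc h0
    rw [this]
    exact (measure_congr (interior_ae_eq_of_null_frontier (hc.addHaar_frontier volume))).symm
  rw [Measure.real, h1, volume_sublevel_eq_lintegral hn hgm
    (fun x hx => gauge_pos_of_ne_zero hc hK h0 hx) (fun c hc x => gauge_smul_pos hc x),
    integral_eq_lintegral_of_nonneg_ae
      (Filter.Eventually.of_forall fun u => pow_nonneg (inv_nonneg.2 (gauge_nonneg u)) n)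
      (hgm.inv.pow_const n).aestronglyMeasurable]

theorem integral_surfMeasure (hn : 0 < n) (hc : Convex ℝ K) (hK : IsCompact K)
    (h0 : (0 : Eu n) ∈ interior K) {g : Eu n → ℝ} (hg : Measurable g) :
    ∫ u, g u ∂(surfMeasure K) = ∫ u, (gauge K u)⁻¹ ^ n *
      (‖gradient (gauge K) u‖ * g (unitNormal K u)) ∂(sphMeasure n) := by
  have hgm := (continuous_gauge_of_convex hc h0).measurable
  have hnm := measurable_gradient (gauge K)
  have hαm : Measurable (unitNormal K) := measurable_unitNormal
  have hdm : Measurable fun u : Eu n => ENNReal.ofReal ((gauge K u)⁻¹ ^ n) :=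
    ENNReal.measurable_ofReal.comp (hgm.inv.pow_const n)
  rw [surfMeasure_eq_map hc h0 hK hn,
    integral_map measurable_unitNormal.aemeasurable hg.aestronglyMeasurable,
    integral_withDensity_eq_integral_toReal_smul hnm.enorm
      (Filter.Eventually.of_forall fun x => enorm_lt_top)]
  set Q : Eu n → ℝ := fun x => ‖gradient (gauge K) x‖ * g (unitNormal K x) with hQ
  have hQm : Measurable Q := hnm.norm.mul (hg.comp hαm)
  have e1 : ∫ x in {x | gauge K x < 1}, ‖gradient (gauge K) x‖ₑ.toReal • g (unitNormal K x) =
      ∫ x in {x | gauge K x < 1}, Q (‖x‖⁻¹ • x) := by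
    refine integral_congr_ae ?_
    filter_upwards [ae_restrict_of_ae (ae_ne_zero_volume hn)] with x hx
    have hp := inv_pos.2 (norm_pos_iff.2 hx)
    simp only [hQ]
    rw [gradient_gauge_smul hp, unitNormal_smul hp, toReal_enorm, smul_eq_mul]
  rw [e1, ← integral_map (φ := fun x : Eu n => ‖x‖⁻¹ • x) (f := Q)
    measurable_inv_norm_smul.aemeasurable hQm.aestronglyMeasurable,
    map_restrict_sublevel_eq_withDensity hn hgm (fun x hx => gauge_pos_of_ne_zero hc hK h0 hx)
      (fun c hc x => gauge_smul_pos hc x),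
    integral_withDensity_eq_integral_toReal_smul hdm
      (Filter.Eventually.of_forall fun x => ENNReal.ofReal_lt_top)]
  refine integral_congr_ae (Filter.Eventually.of_forall fun u => ?_)
  simp only [smul_eq_mul]
  rw [ENNReal.toReal_ofReal (pow_nonneg (inv_nonneg.2 (gauge_nonneg u)) n)]

theorem hasDerivAt_volume_wulff (hn : 0 < n) (hc : Convex ℝ K) (hK : IsCompact K)
    (h0 : (0 : Eu n) ∈ interior K) {g : Eu n → ℝ} (hg : Continuous g) :
    HasDerivAt (fun t : ℝ => volume.real (wulff fun u => suppFn K u + t * g u))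
      (n * ∫ u, g u ∂(surfMeasure K)) 0 := by
  have hne : K.Nonempty := ⟨0, interior_subset h0⟩
  have hh := continuous_suppFn hK hne
  obtain ⟨r, hr, -, hrK⟩ := exists_suppFn_ge_of_mem_interior hK h0
  obtain ⟨G', hG'⟩ := ((isCompact_sphere (0 : Eu n) 1).image hg.abs).bddAbove
  obtain ⟨M', hM'⟩ := ((isCompact_sphere (0 : Eu n) 1).image hh).bddAbove
  set G := max G' 1 with hGdef
  have hG1 : 0 < G := zero_lt_one.trans_le (le_max_right _ _)
  have hGb : ∀ u ∈ sphere (0 : Eu n) 1, |g u| ≤ G := fun u hu =>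
    (hG' ⟨u, hu, rfl⟩).trans (le_max_left _ _)
  set t₀ := r / (2 * G) with ht₀
  have ht₀pos : 0 < t₀ := by positivity
  have htg : ∀ t : ℝ, |t| ≤ t₀ → ∀ u ∈ sphere (0 : Eu n) 1, |t * g u| ≤ r / 2 := by
    intro t ht u hu
    rw [abs_mul]
    calc |t| * |g u| ≤ t₀ * G := mul_le_mul ht (hGb u hu) (abs_nonneg _) ht₀pos.le
      _ = r / 2 := by rw [ht₀]; field_simp
  set M := M' + r / 2 with hMdef
  have hlow : ∀ t : ℝ, |t| ≤ t₀ → ∀ u ∈ sphere (0 : Eu n) 1, r / 2 ≤ suppFn K u + t * g u := by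
    intro t ht u hu
    have h1 := hrK u hu
    rw [inner_zero_left, zero_add] at h1
    have h2 := neg_le_of_abs_le (htg t ht u hu)
    linarith
  have hup : ∀ t : ℝ, |t| ≤ t₀ → ∀ u ∈ sphere (0 : Eu n) 1, suppFn K u + t * g u ≤ M := by
    intro t ht u hu
    have h1 : suppFn K u ≤ M' := hM' ⟨u, hu, rfl⟩
    have h2 := le_of_abs_le (htg t ht u hu)
    linarith
  have hfc : ∀ t : ℝ, Continuous fun u => suppFn K u + t * g u := fun t => by fun_prop
  set ρ : ℝ → Eu n → ℝ := fun t x => (gauge (wulff fun u => suppFn K u + t * g u) x)⁻¹ with hρ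
  have hr2 : 0 < r / 2 := by positivity
  have hfam : ∀ x ∈ sphere (0 : Eu n) 1,
      IsRadialFamily (suppFn K) g t₀ (r / 2) M G x (fun t => ρ t x) := by
    intro x hx
    have hx0 : x ≠ 0 := ne_zero_of_mem_unit_sphere ⟨x, hx⟩
    refine ⟨fun t ht => inv_pos.2 ?_, fun t ht u hu => ?_, fun t ht => ?_, hlow, hup, hGb⟩
    · exact gauge_pos_of_ne_zero (convex_wulff _) (isCompact_wulff (hfc t))
        (zero_mem_interior_wulff hr2 (hlow t ht)) hx0
    · exact inv_gauge_wulff_mul_inner_le (hfc t) hr2 (hlow t ht) hx0 hu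
    · exact exists_inv_gauge_wulff_mul_inner_eq (hfc t) hr2 (hlow t ht) hx0
  have hρ0 : ∀ x, ρ 0 x = (gauge K x)⁻¹ := fun x => by
    simp only [hρ, zero_mul, add_zero]
    rw [show (fun u => suppFn K u) = suppFn K from rfl, wulff_suppFn hc hK hne]
  have hgm := (continuous_gauge_of_convex hc h0).measurable
  have hnm := measurable_gradient (gauge K)
  have hαm : Measurable (unitNormal K) := measurable_unitNormal
  set F' : Eu n → ℝ := fun x => n * ((gauge K x)⁻¹ ^ n *
    (‖gradient (gauge K) x‖ * g (unitNormal K x))) with hF'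
  have hF'm : Measurable F' :=
    measurable_const.mul ((hgm.inv.pow_const n).mul (hnm.norm.mul (hg.measurable.comp hαm)))
  have hs : {t : ℝ | |t| ≤ t₀} ∈ 𝓝 (0 : ℝ) := by
    filter_upwards [closedBall_mem_nhds (0 : ℝ) ht₀pos] with t ht
    simpa using ht
  have h00 : |(0 : ℝ)| ≤ t₀ := by simpa using ht₀pos.le
  have hρm : ∀ t, |t| ≤ t₀ → Measurable fun x => ρ t x ^ n := fun t ht =>
    ((continuous_gauge_of_convex (convex_wulff _)
      (zero_mem_interior_wulff hr2 (hlow t ht))).measurable.inv.pow_const n)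
  set B : ℝ := G * M / (r / 2) * n * |M| ^ (n - 1) with hB
  have hmain := hasDerivAt_integral_of_dominated_loc_of_lip (μ := sphMeasure n) (𝕜 := ℝ)
    (F := fun t x => ρ t x ^ n) (F' := F') (x₀ := (0 : ℝ)) (bound := fun _ => B) hs
    (Filter.mem_of_superset hs fun t ht => (hρm t ht).aestronglyMeasurable) ?_
    hF'm.aestronglyMeasurable ?_ (integrable_const _) ?_
  · have hd := hmain.2
    have e1 : ∫ u, F' u ∂(sphMeasure n) = n * ∫ u, g u ∂(surfMeasure K) := by
      rw [integral_surfMeasure hn hc hK h0 hg.measurable, ← integral_const_mul]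
    rw [e1] at hd
    refine hd.congr_of_eventuallyEq ?_
    filter_upwards [hs] with t ht
    exact volume_real_wulff hn (hfc t) hr2 (hlow t ht)
  · refine Integrable.of_bound (hρm 0 h00).aestronglyMeasurable (M ^ n) ?_
    filter_upwards [ae_sphMeasure_mem_sphere hn] with x hx
    have hpos := (hfam x hx).pos 0 h00
    rw [norm_pow, Real.norm_of_nonneg hpos.le]
    exact pow_le_pow_left₀ hpos.le ((hfam x hx).le_upper hx h00) n
  · filter_upwards [ae_sphMeasure_mem_sphere hn] with x hx
    refine LipschitzOnWith.of_dist_le_mul fun t ht s hs => ?_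
    have hM0 : 0 < M := ((hfam x hx).pos 0 h00).trans_le ((hfam x hx).le_upper hx h00)
    rw [Real.dist_eq, Real.dist_eq, Real.coe_nnabs, abs_of_nonneg (a := B) (by positivity)]
    have p1 := (hfam x hx).abs_sub_le hr2 hx hs ht
    have p2 := abs_pow_sub_pow_le (ρ t x) (ρ s x) n
    have p3 : max |ρ t x| |ρ s x| ≤ |M| := by
      rw [abs_of_pos ((hfam x hx).pos t ht), abs_of_pos ((hfam x hx).pos s hs), abs_of_pos hM0]
      exact max_le ((hfam x hx).le_upper hx ht) ((hfam x hx).le_upper hx hs)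
    calc |ρ t x ^ n - ρ s x ^ n| ≤ |ρ t x - ρ s x| * n * max |ρ t x| |ρ s x| ^ (n - 1) := p2
      _ ≤ (G * M / (r / 2) * |t - s|) * n * |M| ^ (n - 1) := by
          gcongr
      _ = B * |t - s| := by rw [hB]; ring
  · filter_upwards [ae_sphMeasure_mem_sphere hn, ae_sphMeasure_differentiableAt_gauge hn hc hK h0]
      with x hx hd
    have hx0 : x ≠ 0 := ne_zero_of_mem_unit_sphere ⟨x, hx⟩
    have hgp := gauge_pos_of_ne_zero hc hK h0 hx0
    have hgr : 0 < ‖gradient (gauge K) x‖ :=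
      norm_pos_iff.2 (gradient_gauge_ne_zero hc hK h0 hx0 hd)
    have hin : ⟪x, unitNormal K x⟫ = gauge K x * ‖gradient (gauge K) x‖⁻¹ := by
      rw [unitNormal, inner_smul_right, real_inner_comm, inner_gradient_gauge_self hd, mul_comm]
    have hder := (hfam x hx).hasDerivAt hr2 ht₀pos hx hh hg
      (unitNormal_mem_sphere hc hK h0 hx0 hd)
      (by
        rw [hρ0, hin, suppFn_unitNormal hc hK h0 hx0 hd, inv_mul_cancel_left₀ hgp.ne'])
      (fun u hu he => eq_unitNormal_of_inner_eq hc hK h0 hd hu (by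
        rw [← he, hρ0, mul_inv_cancel_left₀ hgp.ne']))
    have hpow := hder.pow n
    refine hpow.congr_deriv ?_
    have hn1 : (gauge K x)⁻¹ ^ n = (gauge K x)⁻¹ ^ (n - 1) * (gauge K x)⁻¹ := by
      rw [← pow_succ, Nat.sub_add_cancel hn]
    simp only [hF']
    rw [hρ0, hin, hn1]
    field_simp

end VolumeDerivative

section SphereFormula

variable {n : ℕ}

theorem coneMeasure_closedBall (hn : 0 < n) :
    coneMeasure (closedBall (0 : Eu n) 1) = sphMeasure n := by
  have := nontrivial_eu hn
  have hg : gauge (closedBall (0 : Eu n) 1) = fun x => ‖x‖ := by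
    funext x
    rw [gauge_closedBall zero_le_one, div_one]
  have hr : radialProj (closedBall (0 : Eu n) 1) = fun x => ‖x‖⁻¹ • x := by
    funext x
    rw [radialProj, hg]
  have hs : {x : Eu n | ‖x‖ < 1} = ball 0 1 := by
    ext x
    simp
  rw [coneMeasure, hr, hg, sphMeasure, hs]
  congr 1
  conv_rhs => rw [← withDensity_one (μ := volume.restrict (ball (0 : Eu n) 1))]
  refine withDensity_congr_ae ?_
  filter_upwards [ae_restrict_of_ae (ae_ne_zero_volume hn)] with x hx
  have hd : DifferentiableAt ℝ (fun x : Eu n => ‖x‖) x := (contDiffAt_norm ℝ hx).differentiableAt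
    one_ne_zero
  rw [← ofReal_norm, norm_gradient, norm_fderiv_norm hd, ENNReal.ofReal_one, Pi.one_apply]

theorem withDensity_hausdorffMeasure_sphere_bounds (hn : 0 < n) {C : ℝ≥0∞} (hC0 : C ≠ 0)
    (hCt : C ≠ ∞)
    (hC : ∀ K : Set (Eu n), Convex ℝ K → IsCompact K →
      (0 : Eu n) ∈ interior K → (μH[(n : ℝ) - 1]).restrict (frontier K) = C • coneMeasure K)
    {f : Eu n → ℝ}
    (hf : ∃ τ₁ τ₂ : ℝ, 0 < τ₁ ∧ ∀ u ∈ sphere (0 : Eu n) 1, τ₁ ≤ f u ∧ f u ≤ τ₂) :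
    ∃ c₁ c₂ : ℝ≥0, 0 < c₁ ∧
      c₁ • sphMeasure n ≤ ((μH[(n:ℝ) - 1]).restrict (sphere (0 : Eu n) 1)).withDensity
        (fun x => ENNReal.ofReal (f x)) ∧
      ((μH[(n:ℝ) - 1]).restrict (sphere (0 : Eu n) 1)).withDensity
        (fun x => ENNReal.ofReal (f x)) ≤ c₂ • sphMeasure n := by
  obtain ⟨τ₁, τ₂, h1, h2⟩ := hf
  have hS : (μH[(n : ℝ) - 1]).restrict (sphere (0 : Eu n) 1) = C • sphMeasure n := by
    rw [← coneMeasure_closedBall hn, ← hC _ (convex_closedBall _ _) (isCompact_closedBall _ _) ?_,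
      frontier_closedBall _ one_ne_zero]
    rw [interior_closedBall _ one_ne_zero]
    exact mem_ball_self one_pos
  have hae : ∀ᵐ u ∂((μH[(n:ℝ) - 1]).restrict (sphere (0 : Eu n) 1)), u ∈ sphere (0 : Eu n) 1 :=
    ae_restrict_mem isClosed_sphere.measurableSet
  lift C to ℝ≥0 using hCt
  have hconst : ∀ τ : ℝ, ((μH[(n:ℝ) - 1]).restrict (sphere (0 : Eu n) 1)).withDensity
      (fun _ => ENNReal.ofReal τ) = (τ.toNNReal * C) • sphMeasure n := by
    intro τ
    rw [withDensity_const, hS, mul_smul]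
    rfl
  refine ⟨τ₁.toNNReal * C, τ₂.toNNReal * C, ?_, ?_, ?_⟩
  · refine mul_pos (Real.toNNReal_pos.2 h1) (pos_iff_ne_zero.2 fun h => hC0 ?_)
    rw [h, ENNReal.coe_zero]
  · rw [← hconst]
    refine withDensity_mono ?_
    filter_upwards [hae] with u hu
    exact ENNReal.ofReal_le_ofReal (h2 u hu).1
  · rw [← hconst]
    refine withDensity_mono ?_
    filter_upwards [hae] with u hu
    exact ENNReal.ofReal_le_ofReal (h2 u hu).2

end SphereFormula

section PowerPrimitive

/-- The primitive of `t ↦ t ^ (p - 1)` on `(0, ∞)` vanishing at `1`. -/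
def powPrim (p t : ℝ) : ℝ := ∫ s in (0:ℝ)..Real.log t, Real.exp (p * s)

theorem intervalIntegrable_exp_mul (p a b : ℝ) :
    IntervalIntegrable (fun s => Real.exp (p * s)) volume a b :=
  (by fun_prop : Continuous fun s : ℝ => Real.exp (p * s)).intervalIntegrable a b

theorem powPrim_of_ne_zero {p t : ℝ} (hp : p ≠ 0) (ht : 0 < t) :
    powPrim p t = (t ^ p - 1) / p := by
  rw [powPrim, intervalIntegral.integral_comp_mul_left (fun s => Real.exp s) hp, integral_exp,
    mul_zero, Real.exp_zero, Real.rpow_def_of_pos ht, mul_comm p, smul_eq_mul, inv_mul_eq_div]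

theorem powPrim_mono_exponent {p q : ℝ} (hpq : p ≤ q) (t : ℝ) : powPrim p t ≤ powPrim q t := by
  rcases le_total 0 (Real.log t) with h | h
  · refine intervalIntegral.integral_mono_on h (intervalIntegrable_exp_mul _ _ _)
      (intervalIntegrable_exp_mul _ _ _) fun s hs => Real.exp_le_exp.2 ?_
    exact mul_le_mul_of_nonneg_right hpq hs.1
  · rw [powPrim, powPrim, intervalIntegral.integral_symm, intervalIntegral.integral_symm _ 0]
    refine neg_le_neg (intervalIntegral.integral_mono_on h (intervalIntegrable_exp_mul _ _ _)
      (intervalIntegrable_exp_mul _ _ _) fun s hs => Real.exp_le_exp.2 ?_)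
    exact mul_le_mul_of_nonpos_right hpq hs.2

theorem powPrim_le_sub_one {p t : ℝ} (hp : p ≤ 1) (ht : 0 < t) : powPrim p t ≤ t - 1 := by
  have := powPrim_mono_exponent hp t
  rwa [powPrim_of_ne_zero one_ne_zero ht, Real.rpow_one, div_one] at this

theorem powPrim_mono {p s t : ℝ} (hs : 0 < s) (hst : s ≤ t) : powPrim p s ≤ powPrim p t := by
  have h := intervalIntegral.integral_add_adjacent_intervals
    (intervalIntegrable_exp_mul p 0 (Real.log s))
    (intervalIntegrable_exp_mul p (Real.log s) (Real.log t))
  have h2 : 0 ≤ ∫ r in (Real.log s)..(Real.log t), Real.exp (p * r) :=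
    intervalIntegral.integral_nonneg (Real.log_le_log hs hst) fun r _ => (Real.exp_pos _).le
  rw [powPrim, powPrim, ← h]
  linarith

theorem powPrim_eq_add {p s t : ℝ} (hs : 0 < s) (ht : 0 < t) :
    powPrim p t = powPrim p s + s ^ p * powPrim p (t / s) := by
  have h := intervalIntegral.integral_add_adjacent_intervals
    (intervalIntegrable_exp_mul p 0 (Real.log s))
    (intervalIntegrable_exp_mul p (Real.log s) (Real.log t))
  rw [powPrim, powPrim, powPrim, ← h, ← intervalIntegral.integral_const_mul]
  congr 1
  have h2 := intervalIntegral.integral_comp_add_right (a := 0) (b := Real.log (t / s))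
    (fun r => Real.exp (p * r)) (Real.log s)
  rw [zero_add, Real.log_div ht.ne' hs.ne', sub_add_cancel] at h2
  rw [← h2, Real.log_div ht.ne' hs.ne']
  refine intervalIntegral.integral_congr fun r _ => ?_
  change Real.exp (p * (r + Real.log s)) = s ^ p * Real.exp (p * r)
  rw [Real.rpow_def_of_pos hs, ← Real.exp_add]
  ring_nf

theorem powPrim_le_tangent {p s t : ℝ} (hp : p ≤ 1) (hs : 0 < s) (ht : 0 < t) :
    powPrim p t ≤ powPrim p s + s ^ (p - 1) * (t - s) := by
  rw [powPrim_eq_add hs ht]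
  have h1 := powPrim_le_sub_one hp (div_pos ht hs)
  have h2 : s ^ (p - 1) * (t - s) = s ^ p * (t / s - 1) := by
    rw [Real.rpow_sub_one hs.ne']
    field_simp
  rw [h2]
  gcongr

theorem measurable_powPrim (p : ℝ) : Measurable (powPrim p) :=
  (intervalIntegral.continuous_primitive (fun a b => intervalIntegrable_exp_mul p a b) 0).measurable
    |>.comp Real.measurable_log

end PowerPrimitive

section ComparableMeasure

variable {n : ℕ}

/-- The measure is bounded above and below by multiples of the cone measure on the sphere. -/
structure IsComparable (μ : Measure (Eu n)) (c₁ c₂ : ℝ≥0) : Prop where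
  pos : 0 < c₁
  lower : c₁ • sphMeasure n ≤ μ
  upper : μ ≤ c₂ • sphMeasure n

variable {μ : Measure (Eu n)} {c₁ c₂ : ℝ≥0}

theorem IsComparable.isFiniteMeasure (hμ : IsComparable μ c₁ c₂) : IsFiniteMeasure μ :=
  isFiniteMeasure_of_le _ hμ.upper

theorem IsComparable.null (hμ : IsComparable μ c₁ c₂) {s : Set (Eu n)}
    (hs : sphMeasure n s = 0) : μ s = 0 := by
  refine le_antisymm ((hμ.upper s).trans ?_) bot_le
  rw [Measure.smul_apply, hs, smul_zero]

theorem IsComparable.ae_mem_sphere (hμ : IsComparable μ c₁ c₂) (hn : 0 < n) :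
    ∀ᵐ u ∂μ, u ∈ sphere (0 : Eu n) 1 :=
  hμ.null (sphMeasure_compl_sphere hn)

theorem sphMeasure_apply {s : Set (Eu n)} (hs : MeasurableSet s) :
    sphMeasure n s = volume ({x : Eu n | ‖x‖⁻¹ • x ∈ s} ∩ ball 0 1) := by
  rw [sphMeasure, Measure.map_apply measurable_inv_norm_smul hs,
    Measure.restrict_apply (measurable_inv_norm_smul hs)]
  rfl

theorem sphMeasure_hyperplane {v : Eu n} (hv : v ≠ 0) : sphMeasure n {u | ⟪v, u⟫ = 0} = 0 := by
  rw [sphMeasure_apply (measurableSet_eq_fun (by fun_prop) measurable_const)]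
  refine measure_mono_null ?_ (Measure.addHaar_submodule volume (LinearMap.ker (innerₛₗ ℝ v)) ?_)
  · rintro x ⟨hx, -⟩
    simp only [mem_ofPred_eq, inner_smul_right, mul_eq_zero, inv_eq_zero, norm_eq_zero] at hx
    rcases hx with rfl | hx
    · exact Submodule.zero_mem _
    · simpa using hx
  · intro h
    have : v ∈ LinearMap.ker (innerₛₗ ℝ v) := h ▸ Submodule.mem_top
    simp only [LinearMap.mem_ker, innerₛₗ_apply_apply, inner_self_eq_zero] at this
    exact hv this

theorem sphMeasure_univ_pos : 0 < sphMeasure n univ := by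
  rw [sphMeasure_apply MeasurableSet.univ]
  simpa using measure_ball_pos volume (0 : Eu n) one_pos

theorem IsComparable.ne_zero (hμ : IsComparable μ c₁ c₂) : μ ≠ 0 := by
  rintro rfl
  have h := hμ.lower univ
  rw [Measure.smul_apply, Measure.coe_zero, Pi.zero_apply, nonpos_iff_eq_zero, ENNReal.smul_def,
    smul_eq_mul, mul_eq_zero] at h
  rcases h with h | h
  · exact hμ.pos.ne' (by exact_mod_cast h)
  · exact sphMeasure_univ_pos.ne' h

theorem IsComparable.eq_of_ae_inner_eq (hμ : IsComparable μ c₁ c₂) {x y : Eu n}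
    (h : ∀ᵐ u ∂μ, ⟪x, u⟫ = ⟪y, u⟫) : x = y := by
  by_contra hxy
  refine hμ.ne_zero (ae_eq_bot.1 (Filter.eventually_false_iff_eq_bot.1 ?_))
  have h2 : ∀ᵐ u ∂μ, ¬ ⟪x - y, u⟫ = 0 := by
    rw [ae_iff]
    simpa using hμ.null (sphMeasure_hyperplane (sub_ne_zero.2 hxy))
  filter_upwards [h, h2] with u h1 h2
  exact h2 (by rw [inner_sub_left, h1, sub_self])

end ComparableMeasure

section OptimalPoint

variable {n : ℕ} {K : Set (Eu n)} {p : ℝ} {μ : Measure (Eu n)} {c₁ c₂ : ℝ≥0}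

/-- The support function of `K` with respect to the origin `ξ`. -/
def slack (K : Set (Eu n)) (ξ u : Eu n) : ℝ := suppFn K u - ⟪ξ, u⟫

theorem slack_zero (K : Set (Eu n)) (u : Eu n) : slack K 0 u = suppFn K u := by
  rw [slack, inner_zero_left, sub_zero]

theorem slack_nonneg (hK : IsCompact K) {ξ : Eu n} (hξ : ξ ∈ K) (u : Eu n) : 0 ≤ slack K ξ u :=
  sub_nonneg.2 (inner_le_suppFn hK hξ u)

theorem continuous_slack (hK : IsCompact K) (hne : K.Nonempty) (ξ : Eu n) :
    Continuous (slack K ξ) :=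
  (continuous_suppFn hK hne).sub (by fun_prop)

theorem slack_lineMap (K : Set (Eu n)) (x y u : Eu n) (s : ℝ) :
    slack K (x + s • (y - x)) u = slack K x u + s * (slack K y u - slack K x u) := by
  simp only [slack, inner_add_left, inner_smul_left, inner_sub_left, RCLike.conj_to_real]
  ring

theorem slack_sub (K : Set (Eu n)) (x y u : Eu n) :
    slack K y u - slack K x u = ⟪x - y, u⟫ := by
  simp only [slack, inner_sub_left]
  ring

theorem exists_slack_le (hK : IsCompact K) :
    ∃ D : ℝ, 0 < D ∧ ∀ ξ ∈ K, ∀ u ∈ sphere (0 : Eu n) 1, slack K ξ u ≤ D := by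
  obtain ⟨R, hR⟩ := hK.isBounded.exists_norm_le
  refine ⟨2 * |R| + 1, by positivity, fun ξ hξ u hu => ?_⟩
  have hu1 : ‖u‖ = 1 := by simpa using hu
  have h1 : suppFn K u ≤ |R| := suppFn_le ⟨ξ, hξ⟩ fun x hx =>
    (real_inner_le_norm x u).trans (by rw [hu1, mul_one]; exact (hR x hx).trans (le_abs_self R))
  have h2 : -⟪ξ, u⟫ ≤ |R| := by
    rw [← inner_neg_left]
    exact (real_inner_le_norm _ u).trans
      (by rw [hu1, mul_one, norm_neg]; exact (hR ξ hξ).trans (le_abs_self R))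
  rw [slack]
  linarith

theorem exists_le_slack (hK : IsCompact K) {ξ : Eu n} (hξ : ξ ∈ interior K) :
    ∃ r : ℝ, 0 < r ∧ ∀ u ∈ sphere (0 : Eu n) 1, r ≤ slack K ξ u := by
  obtain ⟨r, hr, -, h⟩ := exists_suppFn_ge_of_mem_interior hK hξ
  exact ⟨r, hr, fun u hu => by rw [slack]; linarith [h u hu]⟩

theorem add_smul_sub_mem_interior (hc : Convex ℝ K) {x y : Eu n} (hx : x ∈ K)
    (hy : y ∈ interior K) {s : ℝ} (hs : 0 < s) (hs1 : s ≤ 1) :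
    x + s • (y - x) ∈ interior K := by
  have := hc.add_smul_sub_mem_interior hx hy ⟨hs, hs1⟩
  exact this

/-- The integral of the potential of `K` seen from `ξ`. -/
def energyAt (p : ℝ) (μ : Measure (Eu n)) (K : Set (Eu n)) (ξ : Eu n) : ℝ :=
  ∫ u, powPrim p (slack K ξ u) ∂μ

/-- The supremum of the potentials over interior points. -/
def maxEnergy (p : ℝ) (μ : Measure (Eu n)) (K : Set (Eu n)) : ℝ :=
  sSup (energyAt p μ K '' interior K)

theorem integrable_of_ae_sphere [IsFiniteMeasure μ]
    (hS : ∀ᵐ u ∂μ, u ∈ sphere (0 : Eu n) 1) {f : Eu n → ℝ} (hf : Measurable f) (C : ℝ)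
    (hC : ∀ u ∈ sphere (0 : Eu n) 1, |f u| ≤ C) : Integrable f μ :=
  Integrable.of_bound hf.aestronglyMeasurable C (hS.mono fun u hu => hC u hu)

theorem integrable_powPrim_slack [IsFiniteMeasure μ]
    (hS : ∀ᵐ u ∂μ, u ∈ sphere (0 : Eu n) 1) (hK : IsCompact K) {ξ : Eu n}
    (hξ : ξ ∈ interior K) : Integrable (fun u => powPrim p (slack K ξ u)) μ := by
  obtain ⟨r, hr, hrK⟩ := exists_le_slack hK hξ
  obtain ⟨D, hD, hDK⟩ := exists_slack_le hK
  have hne : K.Nonempty := ⟨ξ, interior_subset hξ⟩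
  refine integrable_of_ae_sphere hS
    ((measurable_powPrim p).comp (continuous_slack hK hne ξ).measurable)
    (max |powPrim p r| |powPrim p D|) fun u hu => ?_
  exact abs_le_max_abs_abs (powPrim_mono hr (hrK u hu))
    (powPrim_mono (hr.trans_le (hrK u hu)) (hDK ξ (interior_subset hξ) u hu))

theorem bddAbove_energyAt [IsFiniteMeasure μ] (hS : ∀ᵐ u ∂μ, u ∈ sphere (0 : Eu n) 1)
    (hK : IsCompact K) : BddAbove (energyAt p μ K '' interior K) := by
  obtain ⟨D, hD, hDK⟩ := exists_slack_le hK
  refine ⟨∫ _, powPrim p D ∂μ, ?_⟩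
  rintro _ ⟨ξ, hξ, rfl⟩
  obtain ⟨r, hr, hrK⟩ := exists_le_slack hK hξ
  refine integral_mono_ae (integrable_powPrim_slack hS hK hξ) (integrable_const _) ?_
  filter_upwards [hS] with u hu
  exact powPrim_mono (hr.trans_le (hrK u hu)) (hDK ξ (interior_subset hξ) u hu)

theorem energyAt_le_maxEnergy [IsFiniteMeasure μ] (hS : ∀ᵐ u ∂μ, u ∈ sphere (0 : Eu n) 1)
    (hK : IsCompact K) {ξ : Eu n} (hξ : ξ ∈ interior K) :
    energyAt p μ K ξ ≤ maxEnergy p μ K :=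
  le_csSup (bddAbove_energyAt hS hK) ⟨ξ, hξ, rfl⟩

theorem neg_le_rpow_mul_sub (hp : p ≤ 1) {a b r D s : ℝ} (ha : a ≤ D) (hr : 0 < r) (hb : r ≤ b)
    (ha0 : 0 ≤ a) (hs : 0 ≤ s) (hs1 : s ≤ 1) :
    -(r ^ (p - 1) * D) ≤ (a + s * (b - a)) ^ (p - 1) * (b - a) := by
  have hD : 0 ≤ D := ha0.trans ha
  have hz : 0 ≤ a + s * (b - a) := by nlinarith
  rcases le_total a b with h | h
  · exact (neg_nonpos.2 (by positivity)).trans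
      (mul_nonneg (Real.rpow_nonneg hz _) (sub_nonneg.2 h))
  · have hzr : r ≤ a + s * (b - a) := by nlinarith
    have h1 : (a + s * (b - a)) ^ (p - 1) ≤ r ^ (p - 1) :=
      Real.rpow_le_rpow_of_nonpos hr hzr (by linarith)
    have h2 : (a + s * (b - a)) ^ (p - 1) * (a - b) ≤ r ^ (p - 1) * D := by
      have := Real.rpow_nonneg hz (p - 1)
      refine mul_le_mul h1 (by linarith) (sub_nonneg.2 h) (by positivity)
    linarith [mul_sub ((a + s * (b - a)) ^ (p - 1)) a b,
      mul_sub ((a + s * (b - a)) ^ (p - 1)) b a]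

/-- First order optimality of the point `ξ` of `K` for the potential. -/
structure IsOpt (p : ℝ) (μ : Measure (Eu n)) (K : Set (Eu n)) (ξ : Eu n) : Prop where
  mem : ξ ∈ K
  pos : ∀ᵐ u ∂μ, 0 < slack K ξ u
  integrable : Integrable (fun u => slack K ξ u ^ (p - 1)) μ
  nonneg : ∀ y ∈ K, 0 ≤ ⟪y - ξ, ∫ u, slack K ξ u ^ (p - 1) • u ∂μ⟫

theorem integrable_smul_self (hS : ∀ᵐ u ∂μ, u ∈ sphere (0 : Eu n) 1) {w : Eu n → ℝ}
    (hw : Integrable w μ) : Integrable (fun u => w u • u) μ := by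
  refine hw.smul_bdd (f := fun u : Eu n => u) 1 continuous_id.aestronglyMeasurable ?_
  filter_upwards [hS] with u hu
  simpa using (mem_sphere_zero_iff_norm.1 hu).le

theorem inner_integral_smul_self (hS : ∀ᵐ u ∂μ, u ∈ sphere (0 : Eu n) 1) {w : Eu n → ℝ}
    (hw : Integrable w μ) (x : Eu n) :
    ⟪x, ∫ u, w u • u ∂μ⟫ = ∫ u, w u * ⟪x, u⟫ ∂μ := by
  rw [← integral_inner (integrable_smul_self hS hw)]
  simp only [inner_smul_right]

theorem integrable_mul_inner (hS : ∀ᵐ u ∂μ, u ∈ sphere (0 : Eu n) 1) {w : Eu n → ℝ}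
    (hw : Integrable w μ) (x : Eu n) : Integrable (fun u => w u * ⟪x, u⟫) μ := by
  have := (integrable_smul_self hS hw).const_inner (𝕜 := ℝ) x
  simpa only [inner_smul_right] using this

theorem integrable_mul_continuous [IsFiniteMeasure μ]
    (hS : ∀ᵐ u ∂μ, u ∈ sphere (0 : Eu n) 1) {w f : Eu n → ℝ}
    (hw : Integrable w μ) (hf : Continuous f) : Integrable (fun u => w u * f u) μ := by
  obtain ⟨C, hC⟩ := ((isCompact_sphere (0 : Eu n) 1).image hf.abs).bddAbove
  refine hw.mul_bdd (c := C) hf.aestronglyMeasurable ?_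
  filter_upwards [hS] with u hu
  exact hC ⟨u, hu, rfl⟩

theorem IsOpt.eq_of_isOpt (hμ : IsComparable μ c₁ c₂) (hn : 0 < n) (hp : p < 1) {ξ η : Eu n}
    (h1 : IsOpt p μ K ξ) (h2 : IsOpt p μ K η) : ξ = η := by
  have hS := hμ.ae_mem_sphere hn
  have e1 := h1.nonneg η h2.mem
  have e2 := h2.nonneg ξ h1.mem
  rw [inner_integral_smul_self hS h1.integrable] at e1
  rw [inner_integral_smul_self hS h2.integrable] at e2
  have i1 := integrable_mul_inner hS h1.integrable (η - ξ)
  have i2 := integrable_mul_inner hS h2.integrable (ξ - η)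
  set f : Eu n → ℝ := fun u => -(slack K ξ u ^ (p - 1) * ⟪η - ξ, u⟫ +
    slack K η u ^ (p - 1) * ⟪ξ - η, u⟫) with hf
  have hfi : Integrable f μ := (i1.add i2).neg
  have key : ∀ u, f u = -(slack K ξ u ^ (p - 1) - slack K η u ^ (p - 1)) *
      (slack K ξ u - slack K η u) := by
    intro u
    have a1 := slack_sub K η ξ u
    have a2 : ⟪ξ - η, u⟫ = -⟪η - ξ, u⟫ := by rw [← inner_neg_left, neg_sub]
    simp only [hf]
    rw [a2, ← a1]
    ring
  have hf0 : 0 ≤ᵐ[μ] f := by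
    filter_upwards [h1.pos, h2.pos] with u p1 p2
    rw [key, Pi.zero_apply]
    rcases le_total (slack K ξ u) (slack K η u) with h | h
    · have := Real.rpow_le_rpow_of_nonpos p1 h (by linarith : p - 1 ≤ 0)
      nlinarith
    · have := Real.rpow_le_rpow_of_nonpos p2 h (by linarith : p - 1 ≤ 0)
      nlinarith
  have hle : ∫ u, f u ∂μ ≤ 0 := by
    rw [hf, integral_neg, integral_add i1 i2]
    linarith
  have hz := (integral_eq_zero_iff_of_nonneg_ae hf0 hfi).1 (le_antisymm hle (integral_nonneg_of_ae hf0))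
  refine hμ.eq_of_ae_inner_eq ?_
  filter_upwards [hz, h1.pos, h2.pos] with u hu p1 p2
  rw [key, Pi.zero_apply, mul_eq_zero, neg_eq_zero, sub_eq_zero, sub_eq_zero] at hu
  have : slack K ξ u = slack K η u := by
    rcases hu with hu | hu
    · exact (Real.rpow_left_inj p1.le p2.le (by linarith : p - 1 ≠ 0)).1 hu
    · exact hu
  simp only [slack] at this
  linarith

end OptimalPoint

section OptimalPointExistence

open scoped Topology

variable {n : ℕ} {K : Set (Eu n)} {p : ℝ} {μ : Measure (Eu n)} {c₁ c₂ : ℝ≥0}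

theorem exists_seq_maximizing (hK : IsCompact K) (hi : (interior K).Nonempty) :
    ∃ (x : ℕ → Eu n) (ξ : Eu n), ξ ∈ K ∧ Tendsto x atTop (𝓝 ξ) ∧ (∀ j, x j ∈ interior K) ∧
      ∀ j : ℕ, maxEnergy p μ K - energyAt p μ K (x j) ≤ (1 / ((j : ℝ) + 2)) ^ 2 := by
  have h1 : ∀ j : ℕ, ∃ x ∈ interior K,
      maxEnergy p μ K - energyAt p μ K x ≤ (1 / ((j : ℝ) + 2)) ^ 2 := by
    intro j
    have hlt : maxEnergy p μ K - (1 / ((j : ℝ) + 2)) ^ 2 < maxEnergy p μ K :=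
      sub_lt_self _ (by positivity)
    obtain ⟨_, ⟨x, hx, rfl⟩, hxl⟩ := exists_lt_of_lt_csSup (hi.image _) hlt
    exact ⟨x, hx, by linarith⟩
  choose x hx hxe using h1
  obtain ⟨ξ, hξ, k, hk, hlim⟩ := hK.tendsto_subseq fun j => interior_subset (hx j)
  refine ⟨x ∘ k, ξ, hξ, hlim, fun j => hx _, fun j => (hxe _).trans ?_⟩
  have : (j : ℝ) ≤ k j := by exact_mod_cast hk.id_le j
  gcongr

theorem tendsto_slack {x : ℕ → Eu n} {ξ : Eu n} (h : Tendsto x atTop (𝓝 ξ)) (u : Eu n) :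
    Tendsto (fun j => slack K (x j) u) atTop (𝓝 (slack K ξ u)) :=
  tendsto_const_nhds.sub (h.inner tendsto_const_nhds)

/-- The two conclusions drawn from a maximizing sequence by Fatou's lemma. -/
theorem fatou_of_maximizing [IsFiniteMeasure μ] (hS : ∀ᵐ u ∂μ, u ∈ sphere (0 : Eu n) 1)
    (hp : p < 1) (hc : Convex ℝ K) (hK : IsCompact K) {x : ℕ → Eu n} {ξ : Eu n} (hξ : ξ ∈ K)
    (hlim : Tendsto x atTop (𝓝 ξ)) (hx : ∀ j, x j ∈ interior K)
    (hxe : ∀ j : ℕ, maxEnergy p μ K - energyAt p μ K (x j) ≤ (1 / ((j : ℝ) + 2)) ^ 2)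
    {y : Eu n} (hy : y ∈ interior K) :
    (∀ᵐ u ∂μ, 0 < slack K ξ u) ∧
      Integrable (fun u => slack K ξ u ^ (p - 1) * (slack K y u - slack K ξ u)) μ ∧
      ∫ u, slack K ξ u ^ (p - 1) * (slack K y u - slack K ξ u) ∂μ ≤ 0 := by
  have hne : K.Nonempty := ⟨ξ, hξ⟩
  obtain ⟨r, hr, hrK⟩ := exists_le_slack hK hy
  obtain ⟨D, hD, hDK⟩ := exists_slack_le hK
  have hm : ∀ ζ, Measurable (slack K ζ) := fun ζ => (continuous_slack hK hne ζ).measurable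
  set s : ℕ → ℝ := fun j => 1 / ((j : ℝ) + 2) with hs
  have hs0 : ∀ j, 0 < s j := fun j => by simp only [hs]; positivity
  have hs1 : ∀ j, s j ≤ 1 := fun j => by
    simp only [hs]
    rw [div_le_one (by positivity)]
    linarith [(Nat.cast_nonneg j : (0 : ℝ) ≤ j)]
  have hslim : Tendsto s atTop (𝓝 0) := by
    have h := (tendsto_one_div_add_atTop_nhds_zero_nat (𝕜 := ℝ)).comp (tendsto_add_atTop_nat 1)
    refine h.congr fun j => ?_
    simp only [hs, Function.comp_apply]
    push_cast
    ring
  set M : ℝ := r ^ (p - 1) * D with hM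
  have hM0 : 0 ≤ M := by positivity
  set z : ℕ → Eu n → ℝ := fun j u => slack K (x j) u + s j * (slack K y u - slack K (x j) u) with hz
  set e : ℕ → Eu n → ℝ := fun j u => z j u ^ (p - 1) * (slack K y u - slack K (x j) u) with he
  have hzm : ∀ j, Measurable (z j) := fun j => (hm _).add (((hm _).sub (hm _)).const_mul _)
  have hem : ∀ j, Measurable (e j) := fun j => ((hzm j).pow_const _).mul ((hm _).sub (hm _))
  have hxK : ∀ j, x j ∈ K := fun j => interior_subset (hx j)
  have hyK : y ∈ K := interior_subset hy
  have heM : ∀ j, ∀ u ∈ sphere (0 : Eu n) 1, -M ≤ e j u := fun j u hu =>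
    neg_le_rpow_mul_sub hp.le (hDK _ (hxK j) u hu) hr (hrK u hu) (slack_nonneg hK (hxK j) u)
      (hs0 j).le (hs1 j)
  have hzlow : ∀ j, ∀ u ∈ sphere (0 : Eu n) 1, s j * r ≤ z j u := fun j u hu => by
    have h1 := slack_nonneg hK (hxK j) u
    have h2 := hrK u hu
    have h3 := hs0 j
    have h4 := hs1 j
    simp only [hz]
    nlinarith
  have hei : ∀ j, Integrable (e j) μ := by
    intro j
    refine integrable_of_ae_sphere hS (hem j) ((s j * r) ^ (p - 1) * D) fun u hu => ?_
    have h0 : 0 < s j * r := mul_pos (hs0 j) hr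
    have h1 := hzlow j u hu
    rw [abs_mul, abs_of_nonneg (Real.rpow_nonneg (h0.le.trans h1) _)]
    refine mul_le_mul (Real.rpow_le_rpow_of_nonpos h0 h1 (by linarith)) ?_ (abs_nonneg _)
      (by positivity)
    have a1 := slack_nonneg hK (hxK j) u
    have a2 := slack_nonneg hK hyK u
    have a3 := hDK _ (hxK j) u hu
    have a4 := hDK _ hyK u hu
    rw [abs_le]
    constructor <;> linarith
  have heint : ∀ j, ∫ u, e j u ∂μ ≤ s j := by
    intro j
    have hzi : x j + s j • (y - x j) ∈ interior K :=
      add_smul_sub_mem_interior hc (hxK j) hy (hs0 j) (hs1 j)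
    have h1 : energyAt p μ K (x j) ≤
        energyAt p μ K (x j + s j • (y - x j)) - s j * ∫ u, e j u ∂μ := by
      rw [← integral_const_mul, energyAt, energyAt,
        ← integral_sub (integrable_powPrim_slack hS hK hzi) ((hei j).const_mul _)]
      refine integral_mono_ae (integrable_powPrim_slack hS hK (hx j))
        ((integrable_powPrim_slack hS hK hzi).sub ((hei j).const_mul _)) ?_
      filter_upwards [hS] with u hu
      obtain ⟨ρ, hρ, hρK⟩ := exists_le_slack hK (hx j)
      have h0 : 0 < z j u := (mul_pos (hs0 j) hr).trans_le (hzlow j u hu)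
      have h2 := powPrim_le_tangent hp.le h0 (hρ.trans_le (hρK u hu))
      change powPrim p (slack K (x j) u) ≤ powPrim p (slack K (x j + s j • (y - x j)) u) - s j * e j u
      rw [slack_lineMap]
      refine h2.trans (le_of_eq ?_)
      simp only [he, hz]
      ring
    have h2 := energyAt_le_maxEnergy (p := p) hS hK hzi
    have h3 := hxe j
    have h4 : s j * ∫ u, e j u ∂μ ≤ s j * s j := by
      rw [← sq]
      simp only [hs] at h1 ⊢
      linarith
    exact le_of_mul_le_mul_left h4 (hs0 j)
  set E : ℕ → Eu n → ℝ≥0∞ := fun j u => ENNReal.ofReal (e j u + M) with hE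
  have hEint : ∀ j, ∫⁻ u, E j u ∂μ ≤ ENNReal.ofReal (s j + M * μ.real univ) := by
    intro j
    have hi : Integrable (fun u => e j u + M) μ := (hei j).add (integrable_const M)
    change ∫⁻ u, ENNReal.ofReal (e j u + M) ∂μ ≤ _
    rw [← ofReal_integral_eq_lintegral_ofReal hi
      (by filter_upwards [hS] with u hu; exact neg_le_iff_add_nonneg.1 (heM j u hu)),
      integral_add (hei j) (integrable_const M), integral_const, smul_eq_mul]
    refine ENNReal.ofReal_le_ofReal ?_
    linarith [heint j]
  have hfat : ∫⁻ u, liminf (fun j => E j u) atTop ∂μ ≤ ENNReal.ofReal (M * μ.real univ) := by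
    refine (lintegral_liminf_le fun j => ENNReal.measurable_ofReal.comp
      ((hem j).add measurable_const)).trans ?_
    refine (liminf_le_liminf (Filter.Eventually.of_forall hEint)).trans (le_of_eq ?_)
    have : Tendsto (fun j => ENNReal.ofReal (s j + M * μ.real univ)) atTop
        (𝓝 (ENNReal.ofReal (0 + M * μ.real univ))) :=
      (ENNReal.continuous_ofReal.tendsto _).comp (hslim.add tendsto_const_nhds)
    rw [this.liminf_eq, zero_add]
  have hzlim : ∀ u, Tendsto (fun j => z j u) atTop (𝓝 (slack K ξ u)) := by
    intro u
    have h1 := tendsto_slack (K := K) hlim u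
    have h2 := h1.add (hslim.mul ((tendsto_const_nhds (x := slack K y u)).sub h1))
    rwa [zero_mul, add_zero] at h2
  have hblim : ∀ u, Tendsto (fun j => slack K y u - slack K (x j) u) atTop
      (𝓝 (slack K y u - slack K ξ u)) := fun u => tendsto_const_nhds.sub (tendsto_slack hlim u)
  have hlimpos : ∀ u, 0 < slack K ξ u → liminf (fun j => E j u) atTop =
      ENNReal.ofReal (slack K ξ u ^ (p - 1) * (slack K y u - slack K ξ u) + M) := by
    intro u hu
    refine Tendsto.liminf_eq ((ENNReal.continuous_ofReal.tendsto _).comp ?_)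
    exact (((hzlim u).rpow_const (Or.inl hu.ne')).mul (hblim u)).add tendsto_const_nhds
  have hlimzero : ∀ u ∈ sphere (0 : Eu n) 1, slack K ξ u = 0 →
      liminf (fun j => E j u) atTop = ∞ := by
    intro u hu h0
    refine Tendsto.liminf_eq (ENNReal.tendsto_ofReal_atTop.comp ?_)
    refine tendsto_atTop_add_const_right _ _ ?_
    have hb : 0 < slack K y u - slack K ξ u := by
      rw [h0, sub_zero]
      exact hr.trans_le (hrK u hu)
    refine Tendsto.atTop_mul_pos hb ?_ (hblim u)
    have h1 : Tendsto (fun j => z j u) atTop (𝓝[>] 0) := by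
      rw [tendsto_nhdsWithin_iff]
      refine ⟨h0 ▸ hzlim u, Filter.Eventually.of_forall fun j => ?_⟩
      exact (mul_pos (hs0 j) hr).trans_le (hzlow j u hu)
    exact (tendsto_rpow_neg_nhdsGT_zero (by linarith)).comp h1
  have hpos : ∀ᵐ u ∂μ, 0 < slack K ξ u := by
    have hfin := ae_lt_top (μ := μ) (f := fun u => liminf (fun j => E j u) atTop)
      (Measurable.liminf fun j => ENNReal.measurable_ofReal.comp ((hem j).add measurable_const))
      (hfat.trans_lt ENNReal.ofReal_lt_top).ne
    filter_upwards [hfin, hS] with u h1 hu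
    refine lt_of_le_of_ne (slack_nonneg hK hξ u) fun h0 => ?_
    rw [hlimzero u hu h0.symm] at h1
    exact lt_irrefl _ h1
  set gg : Eu n → ℝ := fun u => slack K ξ u ^ (p - 1) * (slack K y u - slack K ξ u) with hgg
  have hggm : Measurable gg := ((hm _).pow_const _).mul ((hm _).sub (hm _))
  have hggM : ∀ᵐ u ∂μ, 0 ≤ gg u + M := by
    filter_upwards [hS] with u hu
    have := neg_le_rpow_mul_sub hp.le (hDK _ hξ u hu) hr (hrK u hu) (slack_nonneg hK hξ u)
      le_rfl zero_le_one
    rw [zero_mul, add_zero] at this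
    exact neg_le_iff_add_nonneg.1 this
  have hle : ∫⁻ u, ENNReal.ofReal (gg u + M) ∂μ ≤ ENNReal.ofReal (M * μ.real univ) := by
    refine le_trans (le_of_eq (lintegral_congr_ae ?_)) hfat
    filter_upwards [hpos] with u hu
    exact (hlimpos u hu).symm
  have hi1 : Integrable (fun u => gg u + M) μ :=
    ⟨(hggm.add measurable_const).aestronglyMeasurable, by
      rw [hasFiniteIntegral_iff_ofReal hggM]
      exact hle.trans_lt ENNReal.ofReal_lt_top⟩
  have hi2 : Integrable gg μ := by
    refine (hi1.sub (integrable_const M)).congr (Filter.Eventually.of_forall fun u => ?_)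
    change gg u + M - M = gg u
    ring
  refine ⟨hpos, hi2, ?_⟩
  rw [← ofReal_integral_eq_lintegral_ofReal hi1 hggM,
    ENNReal.ofReal_le_ofReal_iff (mul_nonneg hM0 measureReal_nonneg),
    integral_add hi2 (integrable_const M), integral_const, smul_eq_mul] at hle
  linarith

theorem exists_isOpt (hμ : IsComparable μ c₁ c₂) (hn : 0 < n) (hp : p < 1) (hc : Convex ℝ K)
    (hK : IsCompact K) (hi : (interior K).Nonempty) : ∃ ξ, IsOpt p μ K ξ := by
  have := hμ.isFiniteMeasure
  have hS := hμ.ae_mem_sphere hn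
  obtain ⟨x, ξ, hξ, hlim, hx, hxe⟩ := exists_seq_maximizing (p := p) (μ := μ) hK hi
  have hne : K.Nonempty := ⟨ξ, hξ⟩
  have key := fun y (hy : y ∈ interior K) => fatou_of_maximizing hS hp hc hK hξ hlim hx hxe hy
  obtain ⟨y₀, hy₀⟩ := hi
  have hpos := (key y₀ hy₀).1
  have hint : Integrable (fun u => slack K ξ u ^ (p - 1)) μ := by
    obtain ⟨r, hr, hrK⟩ := exists_le_slack hK hy₀
    have h1 := (((key y₀ hy₀).2.1.abs).const_mul (2 / r)).add
      (integrable_const ((r / 2) ^ (p - 1)))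
    refine h1.mono' (((continuous_slack hK hne ξ).measurable.pow_const _).aestronglyMeasurable) ?_
    filter_upwards [hS, hpos] with u hu hpu
    have hw := Real.rpow_nonneg hpu.le (p - 1)
    rw [Real.norm_of_nonneg hw]
    change _ ≤ 2 / r * |slack K ξ u ^ (p - 1) * (slack K y₀ u - slack K ξ u)| + (r / 2) ^ (p - 1)
    rcases le_total (slack K ξ u) (r / 2) with h | h
    · have h2 : r / 2 ≤ slack K y₀ u - slack K ξ u := by linarith [hrK u hu]
      have h3 : slack K ξ u ^ (p - 1) * (r / 2) ≤
          |slack K ξ u ^ (p - 1) * (slack K y₀ u - slack K ξ u)| :=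
        (mul_le_mul_of_nonneg_left h2 hw).trans (le_abs_self _)
      have h4 : slack K ξ u ^ (p - 1) ≤
          2 / r * |slack K ξ u ^ (p - 1) * (slack K y₀ u - slack K ξ u)| := by
        calc slack K ξ u ^ (p - 1) = 2 / r * (slack K ξ u ^ (p - 1) * (r / 2)) := by field_simp
          _ ≤ _ := by gcongr
      have : 0 ≤ (r / 2) ^ (p - 1) := by positivity
      linarith
    · have h2 := Real.rpow_le_rpow_of_nonpos (half_pos hr) h (by linarith : p - 1 ≤ 0)
      have : 0 ≤ 2 / r * |slack K ξ u ^ (p - 1) * (slack K y₀ u - slack K ξ u)| := by positivity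
      linarith
  refine ⟨ξ, hξ, hpos, hint, ?_⟩
  set W := ∫ u, slack K ξ u ^ (p - 1) • u ∂μ with hW
  have hcl : IsClosed {y : Eu n | 0 ≤ ⟪y - ξ, W⟫} := isClosed_le continuous_const (by fun_prop)
  have hsub : interior K ⊆ {y : Eu n | 0 ≤ ⟪y - ξ, W⟫} := by
    intro y hy
    have h := (key y hy).2.2
    change 0 ≤ ⟪y - ξ, W⟫
    rw [hW, inner_integral_smul_self hS hint]
    have : ∀ u, slack K ξ u ^ (p - 1) * ⟪y - ξ, u⟫ =
        -(slack K ξ u ^ (p - 1) * (slack K y u - slack K ξ u)) := by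
      intro u
      rw [slack_sub, ← neg_sub y ξ, inner_neg_left]
      ring
    simp only [this, integral_neg]
    linarith
  intro y hy
  have hy2 : y ∈ closure (interior K) := by
    rw [hc.closure_interior_eq_closure_of_nonempty_interior ⟨y₀, hy₀⟩]
    exact subset_closure hy
  exact hcl.closure_subset_iff.2 hsub hy2

/-- The value at an optimal point is integrable and at most the supremum. -/
theorem IsOpt.integrable_powPrim_and_le (hμ : IsComparable μ c₁ c₂) (hn : 0 < n) (hp : p < 1)
    (hc : Convex ℝ K) (hK : IsCompact K) (hi : (interior K).Nonempty) {ξ : Eu n}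
    (h : IsOpt p μ K ξ) : Integrable (fun u => powPrim p (slack K ξ u)) μ ∧
      energyAt p μ K ξ ≤ maxEnergy p μ K := by
  have := hμ.isFiniteMeasure
  have hS := hμ.ae_mem_sphere hn
  obtain ⟨y, hy⟩ := hi
  have hne : K.Nonempty := ⟨ξ, h.mem⟩
  obtain ⟨r, hr, hrK⟩ := exists_le_slack hK hy
  obtain ⟨D, hD, hDK⟩ := exists_slack_le hK
  have hcont := fun ζ => continuous_slack hK hne ζ
  have hint : Integrable (fun u => powPrim p (slack K ξ u)) μ := by
    have h1 : Integrable (fun u => slack K ξ u ^ (p - 1) * (slack K y u - slack K ξ u)) μ :=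
      integrable_mul_continuous hS h.integrable ((hcont y).sub (hcont ξ))
    have h2 := ((integrable_powPrim_slack (p := p) hS hK hy).sub h1).abs.add
      (integrable_const |powPrim p D|)
    refine h2.mono' (((measurable_powPrim p).comp (hcont ξ).measurable).aestronglyMeasurable) ?_
    filter_upwards [hS, h.pos] with u hu hpu
    have h3 := powPrim_le_tangent hp.le hpu (hr.trans_le (hrK u hu))
    have h4 := powPrim_mono (p := p) hpu (hDK ξ h.mem u hu)
    change |powPrim p (slack K ξ u)| ≤ |powPrim p (slack K y u) -
      slack K ξ u ^ (p - 1) * (slack K y u - slack K ξ u)| + |powPrim p D|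
    rw [abs_le]
    constructor
    · have := neg_abs_le (powPrim p (slack K y u) -
        slack K ξ u ^ (p - 1) * (slack K y u - slack K ξ u))
      linarith [abs_nonneg (powPrim p D)]
    · have := le_abs_self (powPrim p D)
      linarith [abs_nonneg (powPrim p (slack K y u) -
        slack K ξ u ^ (p - 1) * (slack K y u - slack K ξ u))]
  refine ⟨hint, ?_⟩
  have key : ∀ s ∈ Ioo (0 : ℝ) 1, energyAt p μ K ξ ≤
      maxEnergy p μ K + s * (r ^ (p - 1) * D * μ.real univ) := by
    intro s hs
    have hz := add_smul_sub_mem_interior hc h.mem hy hs.1 hs.2.le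
    have h1 := energyAt_le_maxEnergy (p := p) hS hK hz
    have h2 : energyAt p μ K ξ ≤ energyAt p μ K (ξ + s • (y - ξ)) +
        ∫ _, s * (r ^ (p - 1) * D) ∂μ := by
      rw [energyAt, energyAt, ← integral_add (integrable_powPrim_slack hS hK hz)
        (integrable_const _)]
      refine integral_mono_ae hint ((integrable_powPrim_slack hS hK hz).add
        (integrable_const _)) ?_
      filter_upwards [hS, h.pos] with u hu hpu
      have h3 := neg_le_rpow_mul_sub hp.le (hDK _ h.mem u hu) hr (hrK u hu) hpu.le hs.1.le hs.2.le
      have h4 : 0 < slack K ξ u + s * (slack K y u - slack K ξ u) := by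
        nlinarith [hrK u hu, hs.1, hs.2]
      have h5 := powPrim_le_tangent hp.le h4 hpu
      have h6 := mul_le_mul_of_nonneg_left h3 hs.1.le
      change powPrim p (slack K ξ u) ≤ powPrim p (slack K (ξ + s • (y - ξ)) u) +
        s * (r ^ (p - 1) * D)
      rw [slack_lineMap]
      refine h5.trans ?_
      have : slack K ξ u - (slack K ξ u + s * (slack K y u - slack K ξ u)) =
        -(s * (slack K y u - slack K ξ u)) := by ring
      rw [this]
      linarith
    rw [integral_const, smul_eq_mul] at h2
    linarith
  have hlim : Tendsto (fun s : ℝ => maxEnergy p μ K + s * (r ^ (p - 1) * D * μ.real univ))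
      (𝓝[>] 0) (𝓝 (maxEnergy p μ K + 0 * (r ^ (p - 1) * D * μ.real univ))) :=
    (Continuous.tendsto (by fun_prop) 0).mono_left nhdsWithin_le_nhds
  rw [zero_mul, add_zero] at hlim
  refine ge_of_tendsto hlim ?_
  filter_upwards [Ioo_mem_nhdsGT one_pos] with s hs
  exact key s hs

end OptimalPointExistence

section EnergyComparison

open scoped Topology

variable {n : ℕ} {K L : Set (Eu n)} {p : ℝ} {μ : Measure (Eu n)} {c₁ c₂ : ℝ≥0}

theorem slack_image_sub (hK : IsCompact K) (hne : K.Nonempty) (y ξ u : Eu n) :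
    slack ((fun z => z - y) '' K) (ξ - y) u = slack K ξ u := by
  rw [slack, slack, suppFn_image_sub hK hne, inner_sub_left]
  ring

theorem maxEnergy_image_sub (hK : IsCompact K) (hne : K.Nonempty) (y : Eu n) :
    maxEnergy p μ ((fun z => z - y) '' K) = maxEnergy p μ K := by
  have hi : interior ((fun z => z - y) '' K) = (fun z => z - y) '' interior K :=
    ((Homeomorph.subRight y).image_interior K).symm
  rw [maxEnergy, maxEnergy, hi, image_image]
  congr 1
  refine image_congr fun ξ _ => ?_
  simp only [energyAt, slack_image_sub hK hne]

theorem IsOpt.image_sub (hK : IsCompact K) {ξ : Eu n} (h : IsOpt p μ K ξ) :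
    IsOpt p μ ((fun z => z - ξ) '' K) 0 := by
  have hs : ∀ u, slack ((fun z => z - ξ) '' K) 0 u = slack K ξ u := fun u => by
    rw [← slack_image_sub hK ⟨ξ, h.mem⟩ ξ ξ u, sub_self]
  refine ⟨⟨ξ, h.mem, sub_self ξ⟩, ?_, ?_, ?_⟩
  · simpa only [hs] using h.pos
  · simpa only [hs] using h.integrable
  · rintro _ ⟨y, hy, rfl⟩
    simpa only [hs, sub_zero] using h.nonneg y hy

theorem suppFn_map_of_image_eq {A : Eu n ≃ₗᵢ[ℝ] Eu n} (hA : A '' K = K) (u : Eu n) :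
    suppFn K (A u) = suppFn K u := by
  rw [suppFn, suppFn]
  conv_lhs => rw [← hA, image_image]
  simp only [LinearIsometryEquiv.inner_map_map]

theorem IsOpt.map {A : Eu n ≃ₗᵢ[ℝ] Eu n} (hA : A '' K = K) (hAμ : μ.map A = μ) {ξ : Eu n}
    (h : IsOpt p μ K ξ) : IsOpt p μ K (A ξ) := by
  have hmp : MeasurePreserving A μ μ := ⟨A.continuous.measurable, hAμ⟩
  have hemb : MeasurableEmbedding A := A.toHomeomorph.measurableEmbedding
  have hs : ∀ u, slack K (A ξ) (A u) = slack K ξ u := fun u => by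
    rw [slack, slack, suppFn_map_of_image_eq hA, LinearIsometryEquiv.inner_map_map]
  refine ⟨hA ▸ mem_image_of_mem A h.mem, ?_, ?_, ?_⟩
  · have h2 : ∀ᵐ u ∂(μ.map A), 0 < slack K (A ξ) u := by
      rw [hemb.ae_map_iff]
      simpa only [hs] using h.pos
    rwa [hAμ] at h2
  · rw [← hmp.integrable_comp_emb hemb]
    refine h.integrable.congr (Filter.Eventually.of_forall fun u => ?_)
    simp only [Function.comp_apply, hs]
  · intro y hy
    rw [← hA] at hy
    obtain ⟨z, hz, rfl⟩ := hy
    rw [← hmp.integral_comp hemb]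
    simp only [hs, ← map_smul]
    have : ∫ u, A (slack K ξ u ^ (p - 1) • u) ∂μ = A (∫ u, slack K ξ u ^ (p - 1) • u ∂μ) :=
      A.toContinuousLinearEquiv.integral_comp_comm _
    rw [this, ← map_sub, LinearIsometryEquiv.inner_map_map]
    exact h.nonneg z hz

theorem IsOpt.map_eq (hμ : IsComparable μ c₁ c₂) (hn : 0 < n) (hp : p < 1)
    {A : Eu n ≃ₗᵢ[ℝ] Eu n} (hA : A '' K = K) (hAμ : μ.map A = μ) {ξ : Eu n}
    (h : IsOpt p μ K ξ) : A ξ = ξ :=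
  (h.map hA hAμ).eq_of_isOpt hμ hn hp h

theorem IsOpt.integral_inner_nonneg (h : IsOpt p μ K 0) {y : Eu n} (hy : y ∈ K) :
    0 ≤ ⟪y, ∫ u, suppFn K u ^ (p - 1) • u ∂μ⟫ := by
  simpa only [slack_zero, sub_zero] using h.nonneg y hy

/-- The support function vanishes opposite to the mean normal at an optimal origin. -/
theorem IsOpt.norm_mul_suppFn_eq_zero (hK : IsCompact K) (h : IsOpt p μ K 0) {I : Eu n}
    (hI : I = ∫ u, suppFn K u ^ (p - 1) • u ∂μ) : suppFn K (-‖I‖⁻¹ • I) = 0 := by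
  refine le_antisymm (suppFn_le ⟨0, h.mem⟩ fun y hy => ?_) ?_
  · have := h.integral_inner_nonneg hy
    rw [← hI] at this
    rw [inner_smul_right, neg_mul]
    exact neg_nonpos.2 (mul_nonneg (inv_nonneg.2 (norm_nonneg _)) this)
  · have := inner_le_suppFn hK h.mem (-‖I‖⁻¹ • I)
    rwa [inner_zero_left] at this

theorem maxEnergy_le_of_suppFn_le (hμ : IsComparable μ c₁ c₂) (hn : 0 < n) (hp : p < 1)
    (hc : Convex ℝ K) (hK : IsCompact K) (hi : (interior K).Nonempty) (h : IsOpt p μ K 0)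
    (hL : IsCompact L) (hLi : (interior L).Nonempty) {g : Eu n → ℝ} (hg : Continuous g)
    {s t : ℝ} (hLs : ∀ u ∈ sphere (0 : Eu n) 1, suppFn L u ≤ s * (suppFn K u + t * g u))
    {I : Eu n} (hI : I = ∫ u, suppFn K u ^ (p - 1) • u ∂μ) :
    maxEnergy p μ L ≤ maxEnergy p μ K + ((s - 1) * ∫ u, suppFn K u ^ (p - 1) * suppFn K u ∂μ +
      s * t * (∫ u, suppFn K u ^ (p - 1) * g u ∂μ + ‖I‖ * g (-‖I‖⁻¹ • I))) := by
  have := hμ.isFiniteMeasure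
  have hS := hμ.ae_mem_sphere hn
  have hne : K.Nonempty := ⟨0, h.mem⟩
  have hLne : L.Nonempty := hLi.mono interior_subset
  have hw : Integrable (fun u => suppFn K u ^ (p - 1)) μ := by
    simpa only [slack_zero] using h.integrable
  have hpos : ∀ᵐ u ∂μ, 0 < suppFn K u := by simpa only [slack_zero] using h.pos
  obtain ⟨hφi, hφle⟩ := h.integrable_powPrim_and_le hμ hn hp hc hK hi
  simp only [slack_zero] at hφi
  have hφle' : ∫ u, powPrim p (suppFn K u) ∂μ ≤ maxEnergy p μ K := by
    simpa only [energyAt, slack_zero] using hφle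
  refine csSup_le (hLi.image _) ?_
  rintro _ ⟨ξ, hξ, rfl⟩
  have i1 : Integrable (fun u => suppFn K u ^ (p - 1) * suppFn K u) μ :=
    integrable_mul_continuous hS hw (continuous_suppFn hK hne)
  have i2 : Integrable (fun u => suppFn K u ^ (p - 1) * g u) μ :=
    integrable_mul_continuous hS hw hg
  have i3 : Integrable (fun u => suppFn K u ^ (p - 1) * ⟪ξ, u⟫) μ := integrable_mul_inner hS hw ξ
  obtain ⟨ρ, hρ, hρL⟩ := exists_le_slack hL hξ
  have h1 : energyAt p μ L ξ ≤ ∫ u, (powPrim p (suppFn K u) +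
      ((s - 1) * (suppFn K u ^ (p - 1) * suppFn K u) + s * t * (suppFn K u ^ (p - 1) * g u) -
        suppFn K u ^ (p - 1) * ⟪ξ, u⟫)) ∂μ := by
    refine integral_mono_ae (integrable_powPrim_slack hS hL hξ)
      (hφi.add (((i1.const_mul _).add (i2.const_mul _)).sub i3)) ?_
    filter_upwards [hS, hpos] with u hu hpu
    have h2 := powPrim_le_tangent hp.le hpu (hρ.trans_le (hρL u hu))
    have h3 := mul_le_mul_of_nonneg_left (hLs u hu) (Real.rpow_nonneg hpu.le (p - 1))
    change powPrim p (slack L ξ u) ≤ _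
    refine h2.trans ?_
    simp only [slack]
    nlinarith
  have j12 : Integrable (fun u => (s - 1) * (suppFn K u ^ (p - 1) * suppFn K u) +
      s * t * (suppFn K u ^ (p - 1) * g u)) μ := (i1.const_mul _).add (i2.const_mul _)
  have j123 : Integrable (fun u => (s - 1) * (suppFn K u ^ (p - 1) * suppFn K u) +
      s * t * (suppFn K u ^ (p - 1) * g u) - suppFn K u ^ (p - 1) * ⟪ξ, u⟫) μ := j12.sub i3
  rw [integral_add hφi j123, integral_sub j12 i3,
    integral_add (i1.const_mul _) (i2.const_mul _), integral_const_mul, integral_const_mul,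
    ← inner_integral_smul_self hS hw, ← hI] at h1
  have h4 : -⟪ξ, I⟫ ≤ ‖I‖ * (s * t * g (-‖I‖⁻¹ • I)) := by
    rcases eq_or_ne I 0 with h0 | h0
    · simp [h0]
    · have hIn : 0 < ‖I‖ := norm_pos_iff.2 h0
      have hu : -‖I‖⁻¹ • I ∈ sphere (0 : Eu n) 1 := by
        rw [mem_sphere_zero_iff_norm, norm_smul, norm_neg, norm_inv, norm_norm,
          inv_mul_cancel₀ hIn.ne']
      have h5 := (inner_le_suppFn hL (interior_subset hξ) (-‖I‖⁻¹ • I)).trans (hLs _ hu)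
      rw [h.norm_mul_suppFn_eq_zero hK hI, zero_add, inner_smul_right] at h5
      calc -⟪ξ, I⟫ = ‖I‖ * (-‖I‖⁻¹ * ⟪ξ, I⟫) := by field_simp
        _ ≤ ‖I‖ * (s * (t * g (-‖I‖⁻¹ • I))) := by gcongr
        _ = _ := by ring
  linarith

/-- Lower semicontinuity of the energy under uniform convergence of support functions. -/
theorem exists_lt_maxEnergy_of_suppFn_close [IsFiniteMeasure μ]
    (hS : ∀ᵐ u ∂μ, u ∈ sphere (0 : Eu n) 1) (hp : p < 1)
    (hK : IsCompact K) (hi : (interior K).Nonempty) {c : ℝ}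
    (hcF : c < maxEnergy p μ K) :
    ∃ ε > 0, ∀ L : Set (Eu n), Convex ℝ L → IsCompact L → L.Nonempty →
      (∀ u ∈ sphere (0 : Eu n) 1, |suppFn L u - suppFn K u| ≤ ε) → c < maxEnergy p μ L := by
  obtain ⟨_, ⟨ξ, hξ, rfl⟩, hξc⟩ := exists_lt_of_lt_csSup (hi.image _) hcF
  obtain ⟨r, hr, hrK⟩ := exists_le_slack hK hξ
  set M : ℝ := (r / 2) ^ (p - 1) * μ.real univ with hM
  have hM0 : 0 ≤ M := by positivity
  set ε : ℝ := min (r / 2) ((energyAt p μ K ξ - c) / (2 * (M + 1))) with hε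
  have hε0 : 0 < ε := lt_min (half_pos hr) (div_pos (sub_pos.2 hξc) (by positivity))
  refine ⟨ε, hε0, fun L hLc hL hLne hclose => ?_⟩
  have hsl : ∀ u ∈ sphere (0 : Eu n) 1, |slack L ξ u - slack K ξ u| ≤ ε := fun u hu => by
    have : slack L ξ u - slack K ξ u = suppFn L u - suppFn K u := by
      simp only [slack]; ring
    rw [this]
    exact hclose u hu
  have hrL : ∀ u ∈ sphere (0 : Eu n) 1, r / 2 ≤ slack L ξ u := fun u hu => by
    have h1 := (abs_le.1 (hsl u hu)).1
    have h2 : ε ≤ r / 2 := min_le_left _ _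
    linarith [hrK u hu]
  have hξL : ξ ∈ interior L := by
    refine mem_interior_of_inner_lt_suppFn hLc hL hLne fun u hu => ?_
    have := hrL u hu
    rw [slack] at this
    linarith
  refine lt_of_lt_of_le ?_ (energyAt_le_maxEnergy hS hL hξL)
  have h1 : energyAt p μ K ξ ≤ energyAt p μ L ξ + ∫ _, (r / 2) ^ (p - 1) * ε ∂μ := by
    rw [energyAt, energyAt, ← integral_add (integrable_powPrim_slack hS hL hξL)
      (integrable_const _)]
    refine integral_mono_ae (integrable_powPrim_slack hS hK hξ)
      ((integrable_powPrim_slack hS hL hξL).add (integrable_const _)) ?_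
    filter_upwards [hS] with u hu
    have h0 : 0 < slack L ξ u := (half_pos hr).trans_le (hrL u hu)
    have h2 := powPrim_le_tangent hp.le h0 (hr.trans_le (hrK u hu))
    have h3 := Real.rpow_le_rpow_of_nonpos (half_pos hr) (hrL u hu) (by linarith : p - 1 ≤ 0)
    have h4 : slack K ξ u - slack L ξ u ≤ ε := by linarith [(abs_le.1 (hsl u hu)).1]
    have h5 : slack L ξ u ^ (p - 1) * (slack K ξ u - slack L ξ u) ≤ (r / 2) ^ (p - 1) * ε := by
      refine (mul_le_mul_of_nonneg_left h4 (Real.rpow_nonneg h0.le _)).trans ?_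
      gcongr
    change powPrim p (slack K ξ u) ≤ powPrim p (slack L ξ u) + (r / 2) ^ (p - 1) * ε
    linarith
  rw [integral_const, smul_eq_mul] at h1
  have h2 : M * ε ≤ (energyAt p μ K ξ - c) / 2 := by
    have h3 : ε ≤ (energyAt p μ K ξ - c) / (2 * (M + 1)) := min_le_right _ _
    calc M * ε ≤ (M + 1) * ((energyAt p μ K ξ - c) / (2 * (M + 1))) := by gcongr; linarith
      _ = _ := by field_simp
  have h3 : μ.real univ * ((r / 2) ^ (p - 1) * ε) = M * ε := by rw [hM]; ring
  linarith

end EnergyComparison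

section LayerCake

open scoped Topology

/-- Smallness of a negative moment from a power bound for the distribution function near zero
together with a single small value of the distribution function. -/
theorem exists_lintegral_rpow_neg_lt {α : Type*} [MeasurableSpace α] (μ : Measure α)
    [IsFiniteMeasure μ] {q d B ε : ℝ} (hq : 0 < q) (hqd : q < d) (hB : 0 ≤ B) (hε : 0 < ε) :
    ∃ T > 0, ∃ η > 0, ∀ H : α → ℝ, Measurable H → (∀ x, 0 ≤ H x) →
      (∀ s > 0, μ {x | H x ≤ s} ≤ ENNReal.ofReal (B * s ^ d)) →
      μ {x | H x ≤ T} ≤ ENNReal.ofReal η →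
      ∫⁻ x, ENNReal.ofReal (H x ^ (-q)) ∂μ < ENNReal.ofReal ε := by
  set a : ℝ := d / q with ha
  have ha1 : 1 < a := (one_lt_div hq).2 hqd
  set m : ℝ := μ.real univ with hm
  have hm0 : 0 ≤ m := measureReal_nonneg
  set τ : ℝ := ε / (4 * (m + 1)) with hτ
  have hτ0 : 0 < τ := by positivity
  have hτm : m * τ ≤ ε / 4 := by
    calc m * τ ≤ (m + 1) * (ε / (4 * (m + 1))) := by gcongr; linarith
      _ = _ := by field_simp
  obtain ⟨A, hAτ, hA⟩ : ∃ A, τ ≤ A ∧ B * (A ^ (1 - a) / (a - 1)) ≤ ε / 4 := by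
    have h1 : Tendsto (fun A : ℝ => B * (A ^ (-(a - 1)) / (a - 1))) atTop
        (𝓝 (B * (0 / (a - 1)))) :=
      ((tendsto_rpow_neg_atTop (by linarith : 0 < a - 1)).div_const _).const_mul _
    rw [zero_div, mul_zero] at h1
    obtain ⟨A, h2, h3⟩ := ((h1.eventually (gt_mem_nhds (by positivity : 0 < ε / 4))).and
      (eventually_ge_atTop τ)).exists
    refine ⟨A, h3, ?_⟩
    rw [neg_sub] at h2
    exact h2.le
  have hA0 : 0 < A := hτ0.trans_le hAτ
  refine ⟨τ ^ (-q⁻¹), Real.rpow_pos_of_pos hτ0 _, ε / (4 * A), by positivity,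
    fun H hHm hH0 hHB hHT => ?_⟩
  have hfm : Measurable fun x => H x ^ (-q) := hHm.pow_const _
  rw [lintegral_eq_lintegral_meas_le μ (Filter.Eventually.of_forall fun x =>
    Real.rpow_nonneg (hH0 x) _) hfm.aemeasurable]
  have hsub : ∀ t > 0, {x | t ≤ H x ^ (-q)} ⊆ {x | H x ≤ t ^ (-q⁻¹)} := by
    intro t ht x hx
    change t ≤ H x ^ (-q) at hx
    have h1 := Real.rpow_le_rpow_of_nonpos ht hx (by simpa using hq.le : -q⁻¹ ≤ 0)
    rwa [← Real.rpow_mul (hH0 x), neg_mul_neg, mul_inv_cancel₀ hq.ne', Real.rpow_one] at h1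
  have hsplit : Ioi (0 : ℝ) = (Ioc 0 τ ∪ Ioc τ A) ∪ Ioi A := by
    rw [Ioc_union_Ioc_eq_Ioc hτ0.le hAτ, Ioc_union_Ioi_eq_Ioi hA0.le]
  have i1 : ∫⁻ t in Ioc 0 τ, μ {x | t ≤ H x ^ (-q)} ≤ ENNReal.ofReal (ε / 4) := by
    calc ∫⁻ t in Ioc 0 τ, μ {x | t ≤ H x ^ (-q)} ≤ ∫⁻ _ in Ioc 0 τ, μ univ :=
          lintegral_mono fun t => measure_mono (subset_univ _)
      _ = ENNReal.ofReal (m * τ) := by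
          rw [setLIntegral_const, Real.volume_Ioc, sub_zero, ENNReal.ofReal_mul hm0, hm,
            ofReal_measureReal]
      _ ≤ _ := ENNReal.ofReal_le_ofReal hτm
  have i2 : ∫⁻ t in Ioc τ A, μ {x | t ≤ H x ^ (-q)} ≤ ENNReal.ofReal (ε / 4) := by
    calc ∫⁻ t in Ioc τ A, μ {x | t ≤ H x ^ (-q)} ≤
          ∫⁻ _ in Ioc τ A, ENNReal.ofReal (ε / (4 * A)) := by
          refine setLIntegral_mono' measurableSet_Ioc fun t ht => ?_
          refine (measure_mono ((hsub t (hτ0.trans ht.1)).trans fun x hx => ?_)).trans hHT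
          exact le_trans hx (Real.rpow_le_rpow_of_nonpos hτ0 ht.1.le (by simpa using hq.le))
      _ = ENNReal.ofReal (ε / (4 * A) * (A - τ)) := by
          rw [setLIntegral_const, Real.volume_Ioc, ENNReal.ofReal_mul (by positivity)]
      _ ≤ _ := by
          refine ENNReal.ofReal_le_ofReal ?_
          calc ε / (4 * A) * (A - τ) ≤ ε / (4 * A) * A := by gcongr; linarith
            _ = _ := by field_simp
  have i3 : ∫⁻ t in Ioi A, μ {x | t ≤ H x ^ (-q)} ≤ ENNReal.ofReal (ε / 4) := by
    calc ∫⁻ t in Ioi A, μ {x | t ≤ H x ^ (-q)} ≤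
          ∫⁻ t in Ioi A, ENNReal.ofReal (B * t ^ (-a)) := by
          refine setLIntegral_mono' measurableSet_Ioi fun t ht => ?_
          have ht0 : 0 < t := hA0.trans ht
          refine (measure_mono (hsub t ht0)).trans
            ((hHB _ (Real.rpow_pos_of_pos ht0 _)).trans (le_of_eq ?_))
          rw [← Real.rpow_mul ht0.le, ha, div_eq_inv_mul, neg_mul]
      _ = ENNReal.ofReal (∫ t in Ioi A, B * t ^ (-a)) := by
          rw [ofReal_integral_eq_lintegral_ofReal]
          · exact (integrableOn_Ioi_rpow_of_lt (by linarith) hA0).const_mul B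
          · filter_upwards [ae_restrict_mem measurableSet_Ioi] with t ht
            exact mul_nonneg hB (Real.rpow_nonneg (hA0.trans ht).le _)
      _ ≤ _ := by
          refine ENNReal.ofReal_le_ofReal (le_trans (le_of_eq ?_) hA)
          rw [integral_const_mul, integral_Ioi_rpow_of_lt (by linarith) hA0]
          congr 1
          rw [← neg_div_neg_eq, neg_neg]
          congr 1 <;> ring_nf
  calc ∫⁻ t in Ioi 0, μ {x | t ≤ H x ^ (-q)} ≤
        ((∫⁻ t in Ioc 0 τ, μ {x | t ≤ H x ^ (-q)}) +
          ∫⁻ t in Ioc τ A, μ {x | t ≤ H x ^ (-q)}) + ∫⁻ t in Ioi A, μ {x | t ≤ H x ^ (-q)} := by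
        rw [hsplit]
        exact (lintegral_union_le _ _ _).trans (add_le_add (lintegral_union_le _ _ _) le_rfl)
    _ ≤ (ENNReal.ofReal (ε / 4) + ENNReal.ofReal (ε / 4)) + ENNReal.ofReal (ε / 4) :=
        add_le_add (add_le_add i1 i2) i3
    _ = ENNReal.ofReal (ε / 4 + ε / 4 + ε / 4) := by
        rw [ENNReal.ofReal_add (by positivity) (by positivity),
          ENNReal.ofReal_add (by positivity) (by positivity)]
    _ < ENNReal.ofReal ε := (ENNReal.ofReal_lt_ofReal_iff hε).2 (by linarith)

end LayerCake

section Simplex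

open scoped Matrix

variable {n : ℕ}

theorem volume_setOf_mulVec_le {M : Matrix (Fin n) (Fin n) ℝ} (hM : M.det ≠ 0) {t : Fin n → ℝ}
    (ht : ∀ i, 0 ≤ t i) : volume {x : Eu n | ∀ i, |(M *ᵥ ⇑x) i| ≤ t i} =
      ENNReal.ofReal (|M.det|⁻¹ * ∏ i, (2 * t i)) := by
  have h1 : {x : Eu n | ∀ i, |(M *ᵥ ⇑x) i| ≤ t i} =
      (MeasurableEquiv.toLp 2 (Fin n → ℝ)).symm ⁻¹' (Matrix.toLin' M ⁻¹' Icc (-t) t) := by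
    ext x
    simp only [mem_ofPred_eq, mem_preimage, mem_Icc, Pi.le_def, Pi.neg_apply, abs_le,
      Matrix.toLin'_apply, forall_and]
    rfl
  have h2 : LinearMap.det (Matrix.toLin' M) ≠ 0 := by rwa [LinearMap.det_toLin']
  rw [h1, (EuclideanSpace.volume_preserving_symm_measurableEquiv_toLp (Fin n)).measure_preimage_equiv,
    Measure.addHaar_preimage_linearMap _ h2, LinearMap.det_toLin', abs_inv, Real.volume_Icc_pi,
    ENNReal.ofReal_mul (by positivity), ENNReal.ofReal_prod_of_nonneg
      (fun i _ => mul_nonneg zero_le_two (ht i))]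
  congr 1
  refine Finset.prod_congr rfl fun i _ => ?_
  rw [Pi.neg_apply, sub_neg_eq_add, two_mul]

theorem sphMeasure_setOf_mulVec_le {M : Matrix (Fin n) (Fin n) ℝ} (hM : M.det ≠ 0) {t : Fin n → ℝ}
    (ht : ∀ i, 0 ≤ t i) : sphMeasure n {u : Eu n | ∀ i, |(M *ᵥ ⇑u) i| ≤ t i} ≤
      ENNReal.ofReal (|M.det|⁻¹ * ∏ i, (2 * t i)) := by
  have hmeas : MeasurableSet {u : Eu n | ∀ i, |(M *ᵥ ⇑u) i| ≤ t i} := by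
    have : {u : Eu n | ∀ i, |(M *ᵥ ⇑u) i| ≤ t i} = ⋂ i, {u : Eu n | |(M *ᵥ ⇑u) i| ≤ t i} := by
      ext; simp
    rw [this]
    refine MeasurableSet.iInter fun i => measurableSet_le ?_ measurable_const
    simp only [Matrix.mulVec, dotProduct]
    fun_prop
  rw [← volume_setOf_mulVec_le hM ht, sphMeasure_apply hmeas]
  refine measure_mono fun x hx i => ?_
  obtain ⟨h1, h2⟩ := hx
  have h3 := h1 i
  rw [mem_ball_zero_iff] at h2
  rcases eq_or_ne x 0 with rfl | hx0
  · simpa using ht i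
  · have hxn : 0 < ‖x‖ := norm_pos_iff.2 hx0
    have h4 : (⇑(‖x‖⁻¹ • x) : Fin n → ℝ) = ‖x‖⁻¹ • ⇑x := rfl
    rw [h4, Matrix.mulVec_smul, Pi.smul_apply, smul_eq_mul, abs_mul, abs_inv, abs_norm] at h3
    have h5 : |(M *ᵥ ⇑x) i| ≤ ‖x‖ * t i := by
      calc |(M *ᵥ ⇑x) i| = ‖x‖ * (‖x‖⁻¹ * |(M *ᵥ ⇑x) i|) := by field_simp
        _ ≤ _ := by gcongr
    exact h5.trans (mul_le_of_le_one_left (ht i) h2.le)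

theorem norm_le_sum_abs (x : Eu n) : ‖x‖ ≤ ∑ i, |x i| := by
  have h0 : 0 ≤ ∑ i, |x i| := Finset.sum_nonneg fun i _ => abs_nonneg _
  rw [EuclideanSpace.norm_eq]
  refine Real.sqrt_le_iff.2 ⟨h0, ?_⟩
  simp only [Real.norm_eq_abs]
  exact Finset.sum_sq_le_sq_sum_of_nonneg fun i _ => abs_nonneg _

theorem inner_eq_mulVec (m : Fin n → Eu n) (u : Eu n) (i : Fin n) :
    ⟪m i, u⟫ = ((Matrix.of fun i k => m i k) *ᵥ ⇑u) i := by
  rw [PiLp.inner_apply, Matrix.mulVec, dotProduct]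
  refine Finset.sum_congr rfl fun k _ => ?_
  simp only [RCLike.inner_apply, conj_trivial, Matrix.of_apply]
  ring

/-- A simplex of maximal volume inscribed in a convex body. -/
theorem exists_maximal_simplex {K : Set (Eu n)} (hK : IsCompact K) (hi : (interior K).Nonempty) :
    ∃ x₀ ∈ K, ∃ m : Fin n → Eu n, (∀ i, x₀ + m i ∈ K) ∧
      (Matrix.of fun i k => m i k).det ≠ 0 ∧
      ∀ x ∈ K, ∀ i, |((Matrix.of fun i k => m i k)ᵀ⁻¹ *ᵥ ⇑(x - x₀)) i| ≤ 1 := by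
  set D : (Fin n → Eu n) × Eu n → ℝ := fun X => |(Matrix.of fun i k => (X.1 i - X.2) k).det| with hD
  have hDc : Continuous D := by
    refine continuous_abs.comp (Continuous.matrix_det ?_)
    refine continuous_matrix fun i k => ?_
    simp only [Matrix.of_apply]
    fun_prop
  have hcpt : IsCompact ((Set.pi univ fun _ : Fin n => K) ×ˢ K) :=
    (isCompact_univ_pi fun _ => hK).prod hK
  have hne : K.Nonempty := hi.mono interior_subset
  obtain ⟨z, hz⟩ := hne
  obtain ⟨⟨X, x₀⟩, ⟨hX, hx₀⟩, hmax⟩ := hcpt.exists_isMaxOn ⟨(fun _ => z, z), ⟨fun _ _ => hz, hz⟩⟩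
    hDc.continuousOn
  obtain ⟨w, hw⟩ := hi
  obtain ⟨ρ, hρ, hρK⟩ := Metric.isOpen_iff.1 isOpen_interior w hw
  have hpos : 0 < D (X, x₀) := by
    have h1 : D (fun i => w + EuclideanSpace.single i (ρ / 2), w) ≤ D (X, x₀) := by
      refine hmax ⟨fun i _ => interior_subset (hρK ?_), interior_subset hw⟩
      rw [mem_ball, dist_eq_norm, add_sub_cancel_left, PiLp.norm_single,
        Real.norm_of_nonneg (by positivity)]
      linarith
    refine lt_of_lt_of_le ?_ h1
    have h2 : (Matrix.of fun i k => (w + EuclideanSpace.single i (ρ / 2) - w) k) =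
        Matrix.diagonal fun _ : Fin n => ρ / 2 := by
      ext i k
      rw [Matrix.of_apply, add_sub_cancel_left, Matrix.diagonal_apply, PiLp.single_apply]
      simp [eq_comm]
    simp only [hD]
    rw [h2, Matrix.det_diagonal]
    exact abs_pos.2 (Finset.prod_pos fun _ _ => by positivity).ne'
  set m : Fin n → Eu n := fun i => X i - x₀ with hm
  have hdet : (Matrix.of fun i k => m i k).det ≠ 0 := abs_pos.1 hpos
  refine ⟨x₀, hx₀, m, fun i => ?_, hdet, fun x hx i => ?_⟩
  · simp only [hm, add_sub_cancel]
    exact hX i (mem_univ i)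
  · set A := Matrix.of fun i k => m i k with hA
    have hu : IsUnit Aᵀ.det := by
      rw [Matrix.det_transpose]
      exact isUnit_iff_ne_zero.2 hdet
    have h1 := congrFun (Matrix.det_smul_inv_mulVec_eq_cramer Aᵀ (⇑(x - x₀)) hu) i
    rw [Matrix.cramer_transpose_apply, Matrix.det_transpose, Pi.smul_apply, smul_eq_mul] at h1
    have h2 : |(A.updateRow i ⇑(x - x₀)).det| ≤ |A.det| := by
      have h3 : D (Function.update X i x, x₀) ≤ D (X, x₀) := by
        refine hmax ⟨fun j _ => ?_, hx₀⟩
        rcases eq_or_ne j i with rfl | hj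
        · simpa using hx
        · simpa [hj] using hX j (mem_univ j)
      have h4 : A.updateRow i ⇑(x - x₀) =
          Matrix.of fun j k => (Function.update X i x j - x₀) k := by
        ext j k
        rcases eq_or_ne j i with rfl | hj
        · simp
        · simp [hj, hA, hm]
      rw [h4]
      exact h3
    rw [← h1, abs_mul] at h2
    exact le_of_mul_le_mul_left (by rwa [mul_one]) (abs_pos.2 hdet)

end Simplex

section Coercivity

open scoped Matrix

variable {n : ℕ} {μ : Measure (Eu n)} {c₁ c₂ : ℝ≥0}

theorem abs_inner_le_slack_centroid {K : Set (Eu n)} (hK : IsCompact K) {x₀ : Eu n} (hx₀ : x₀ ∈ K)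
    {m : Fin n → Eu n} (hm : ∀ i, x₀ + m i ∈ K) (u : Eu n) (i : Fin n) :
    |⟪m i, u⟫| ≤ (n + 1) * slack K (x₀ + ((n : ℝ) + 1)⁻¹ • ∑ j, m j) u := by
  have hn1 : (0 : ℝ) < n + 1 := by positivity
  set H := slack K (x₀ + ((n : ℝ) + 1)⁻¹ • ∑ j, m j) u with hH
  set S := ∑ j, ⟪m j, u⟫ with hS
  have hHS : H = suppFn K u - ⟪x₀, u⟫ - ((n : ℝ) + 1)⁻¹ * S := by
    rw [hH, slack, inner_add_left, real_inner_smul_left, sum_inner]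
    ring
  have h0 : -(((n : ℝ) + 1)⁻¹ * S) ≤ H := by
    have := inner_le_suppFn hK hx₀ u
    linarith
  have hj : ∀ j, ⟪m j, u⟫ - ((n : ℝ) + 1)⁻¹ * S ≤ H := by
    intro j
    have := inner_le_suppFn hK (hm j) u
    rw [inner_add_left] at this
    linarith
  have hSum : ((n : ℝ) + 1) * (((n : ℝ) + 1)⁻¹ * S) = S := by
    rw [mul_inv_cancel_left₀ hn1.ne']
  have hrest : ∑ j ∈ Finset.univ.erase i, (⟪m j, u⟫ - ((n : ℝ) + 1)⁻¹ * S) ≤ (n - 1) * H := by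
    refine (Finset.sum_le_card_nsmul _ _ H fun j _ => hj j).trans (le_of_eq ?_)
    have hcard : 1 ≤ n := i.pos
    rw [Finset.card_erase_of_mem (Finset.mem_univ i), Finset.card_univ, Fintype.card_fin,
      nsmul_eq_mul, Nat.cast_sub hcard, Nat.cast_one]
  have herase : ∑ j ∈ Finset.univ.erase i, (⟪m j, u⟫ - ((n : ℝ) + 1)⁻¹ * S) =
      S - n * (((n : ℝ) + 1)⁻¹ * S) - (⟪m i, u⟫ - ((n : ℝ) + 1)⁻¹ * S) := by
    rw [eq_sub_iff_add_eq, Finset.sum_erase_add _ _ (Finset.mem_univ i), Finset.sum_sub_distrib,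
      Finset.sum_const, Finset.card_univ, Fintype.card_fin, nsmul_eq_mul]
  have hi := hj i
  set A := ((n : ℝ) + 1)⁻¹ * S
  rw [abs_le]
  constructor <;> nlinarith

theorem one_le_det_of_volume {K : Set (Eu n)} (hv : 1 ≤ volume K) {x₀ : Eu n}
    {M : Matrix (Fin n) (Fin n) ℝ} (hM : M.det ≠ 0)
    (h : ∀ x ∈ K, ∀ i, |(Mᵀ⁻¹ *ᵥ ⇑(x - x₀)) i| ≤ 1) : |M.det|⁻¹ ≤ 2 ^ n := by
  have hM' : (Mᵀ⁻¹).det ≠ 0 := by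
    rw [Matrix.det_nonsing_inv, Matrix.det_transpose, Ring.inverse_eq_inv']
    exact inv_ne_zero hM
  have h1 : volume K ≤ volume {x : Eu n | ∀ i, |(Mᵀ⁻¹ *ᵥ ⇑x) i| ≤ 1} := by
    rw [← measure_preimage_add_right volume (-x₀) {x : Eu n | ∀ i, |(Mᵀ⁻¹ *ᵥ ⇑x) i| ≤ 1}]
    refine measure_mono fun x hx => ?_
    rw [mem_preimage, ← sub_eq_add_neg]
    exact h x hx
  rw [volume_setOf_mulVec_le hM' fun _ => zero_le_one, Matrix.det_nonsing_inv,
    Matrix.det_transpose, Ring.inverse_eq_inv', abs_inv, inv_inv] at h1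
  have h2 := hv.trans h1
  rw [ENNReal.one_le_ofReal] at h2
  simp only [mul_one, Finset.prod_const, Finset.card_univ, Fintype.card_fin] at h2
  exact (inv_le_iff_one_le_mul₀' (abs_pos.2 hM)).2 h2

theorem norm_sub_le_of_abs_le {x : Eu n} {M : Matrix (Fin n) (Fin n) ℝ} (hM : M.det ≠ 0)
    (h : ∀ i, |(Mᵀ⁻¹ *ᵥ ⇑x) i| ≤ 1) {L : ℝ} (hL : ∀ i k, |M i k| ≤ L) :
    ‖x‖ ≤ n * (n * L) := by
  have hu : IsUnit Mᵀ.det := by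
    rw [Matrix.det_transpose]
    exact isUnit_iff_ne_zero.2 hM
  have h1 : (⇑x : Fin n → ℝ) = Mᵀ *ᵥ (Mᵀ⁻¹ *ᵥ ⇑x) := by
    rw [Matrix.mulVec_mulVec, Matrix.mul_nonsing_inv _ hu, Matrix.one_mulVec]
  refine (norm_le_sum_abs x).trans ?_
  refine (Finset.sum_le_card_nsmul _ _ (n * L) fun k _ => ?_).trans (by simp)
  rw [h1, Matrix.mulVec, dotProduct]
  refine (Finset.abs_sum_le_sum_abs _ _).trans ?_
  refine (Finset.sum_le_card_nsmul _ _ L fun i _ => ?_).trans (by simp)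
  rw [abs_mul, Matrix.transpose_apply]
  calc |M i k| * _ ≤ |M i k| * 1 := by gcongr; exact h i
    _ ≤ L := by rw [mul_one]; exact hL i k

theorem IsComparable.measure_abs_inner_le (hμ : IsComparable μ c₁ c₂) (hn : 0 < n) {v : Eu n}
    {k : Fin n} {L s : ℝ} (hL : 0 < L) (hk : L < |v k|) (hs : 0 ≤ s) :
    μ {u | |⟪v, u⟫| ≤ s} ≤ ENNReal.ofReal (c₂ * (L⁻¹ * (2 ^ n * s))) := by
  set M : Matrix (Fin n) (Fin n) ℝ := (1 : Matrix (Fin n) (Fin n) ℝ).updateRow k ⇑v with hM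
  have hdet : M.det = v k := by
    have h1 := Matrix.cramer_transpose_apply (1 : Matrix (Fin n) (Fin n) ℝ) (⇑v) k
    rw [Matrix.transpose_one, Matrix.cramer_one] at h1
    exact h1.symm
  have hdet0 : M.det ≠ 0 := by
    rw [hdet]
    exact abs_pos.1 (hL.trans hk)
  set t : Fin n → ℝ := fun j => if j = k then s else 1 with ht
  have ht0 : ∀ j, 0 ≤ t j := fun j => by
    simp only [ht]
    split_ifs
    exacts [hs, zero_le_one]
  have hprod : ∏ j, (2 * t j) = 2 ^ n * s := by
    rw [Finset.prod_mul_distrib, Finset.prod_const, Finset.card_univ, Fintype.card_fin]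
    simp only [ht, Finset.prod_ite_eq', Finset.mem_univ, if_true]
  have h2 := sphMeasure_setOf_mulVec_le hdet0 ht0
  calc μ {u | |⟪v, u⟫| ≤ s} ≤ μ {u : Eu n | ∀ i, |(M *ᵥ ⇑u) i| ≤ t i} := by
        refine measure_mono_ae ?_
        filter_upwards [hμ.ae_mem_sphere hn] with u hu hus i
        have hrow : (M *ᵥ ⇑u) i = M i ⬝ᵥ ⇑u := rfl
        rcases eq_or_ne i k with rfl | hik
        · have h3 : M i ⬝ᵥ ⇑u = ⟪v, u⟫ := by
            rw [hM, Matrix.updateRow_self, PiLp.inner_apply, dotProduct]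
            refine Finset.sum_congr rfl fun j _ => ?_
            simp only [RCLike.inner_apply, conj_trivial]
            ring
          rw [hrow, h3]
          simp only [ht, if_true]
          exact hus
        · have h3 : M i ⬝ᵥ ⇑u = u i := by
            rw [hM, Matrix.updateRow_ne hik, dotProduct]
            simp [Matrix.one_apply]
          rw [hrow, h3]
          simp only [ht, hik, if_false]
          have := PiLp.norm_apply_le u i
          rwa [mem_sphere_zero_iff_norm.1 hu] at this
    _ ≤ c₂ * sphMeasure n {u : Eu n | ∀ i, |(M *ᵥ ⇑u) i| ≤ t i} := hμ.upper _
    _ ≤ c₂ * ENNReal.ofReal (|M.det|⁻¹ * ∏ i, (2 * t i)) := by gcongr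
    _ ≤ c₂ * ENNReal.ofReal (L⁻¹ * (2 ^ n * s)) := by
        rw [hprod, hdet]
        gcongr
    _ = _ := by
        rw [ENNReal.ofReal_mul c₂.coe_nonneg, ENNReal.ofReal_coe_nnreal]

/-- Bodies of volume at least one and bounded energy have bounded diameter. -/
theorem exists_diam_bound_of_maxEnergy_le (hμ : IsComparable μ c₁ c₂) (hn : 0 < n) {p : ℝ}
    (hp : -(n : ℝ) < p) {D : ℝ} (hD : 0 < D) :
    ∃ R : ℝ, ∀ K : Set (Eu n), Convex ℝ K → IsCompact K → (interior K).Nonempty → 1 ≤ volume K →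
      maxEnergy p μ K ≤ powPrim p D * μ.real univ → ∀ x ∈ K, ∀ y ∈ K, ‖x - y‖ ≤ R := by
  have := hμ.isFiniteMeasure
  have hS := hμ.ae_mem_sphere hn
  have hn' : (0 : ℝ) < n := Nat.cast_pos.2 hn
  have hm : 0 < μ.real univ :=
    ENNReal.toReal_pos (Measure.measure_univ_ne_zero.2 (hμ.ne_zero)) (measure_ne_top _ _)
  obtain ⟨q, hq, hqn, hqp, hqD⟩ : ∃ q : ℝ, 0 < q ∧ q < n ∧ -q ≤ p ∧ powPrim p D < 1 / q := by
    rcases lt_or_ge p 0 with h | h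
    · refine ⟨-p, by linarith, by linarith, by linarith, ?_⟩
      rw [powPrim_of_ne_zero h.ne hD, ← neg_div_neg_eq]
      refine (div_lt_div_iff_of_pos_right (by linarith)).2 ?_
      linarith [Real.rpow_pos_of_pos hD p]
    · refine ⟨min (n / 2) (1 / (|powPrim p D| + 1)), by positivity,
        (min_le_left _ _).trans_lt (by linarith), ?_, ?_⟩
      · have : 0 < min ((n : ℝ) / 2) (1 / (|powPrim p D| + 1)) := by positivity
        linarith
      · refine lt_of_lt_of_le ?_ (one_div_le_one_div_of_le (by positivity) (min_le_right _ _))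
        rw [one_div_one_div]
        linarith [le_abs_self (powPrim p D)]
  set ε : ℝ := (1 - q * powPrim p D) * μ.real univ with hε
  have hε0 : 0 < ε := by
    refine mul_pos ?_ hm
    rw [lt_div_iff₀ hq] at hqD
    linarith
  set B : ℝ := c₂ * (2 ^ n * (2 * (n + 1)) ^ n) with hB
  obtain ⟨T, hT, η, hη, hmain⟩ := exists_lintegral_rpow_neg_lt μ hq hqn (B := B)
    (by positivity) hε0
  set L : ℝ := c₂ * (2 ^ n * ((n + 1) * T)) / η + 1 with hL
  have hL0 : 0 < L := by positivity
  have hLη : c₂ * (L⁻¹ * (2 ^ n * ((n + 1) * T))) ≤ η := by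
    have h1 : c₂ * (2 ^ n * ((n + 1) * T)) ≤ L * η := by
      rw [hL, add_mul (_ / η), div_mul_cancel₀ _ hη.ne']
      linarith
    calc _ = L⁻¹ * (c₂ * (2 ^ n * ((n + 1) * T))) := by ring
      _ ≤ L⁻¹ * (L * η) := by gcongr
      _ = η := by rw [inv_mul_cancel_left₀ hL0.ne']
  refine ⟨n * (n * L) + n * (n * L), fun K hc hK hi hv hE => ?_⟩
  obtain ⟨x₀, hx₀, m, hmK, hdet, hcoord⟩ := exists_maximal_simplex hK hi
  set M : Matrix (Fin n) (Fin n) ℝ := Matrix.of fun i k => m i k with hM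
  have hsmall : ∀ i k, |M i k| ≤ L := by
    by_contra! hcon
    obtain ⟨i, k, hik⟩ := hcon
    refine absurd hE (not_le.2 ?_)
    set ξ : Eu n := x₀ + ((n : ℝ) + 1)⁻¹ • ∑ j, m j with hξ
    have hn1 : (0 : ℝ) < n + 1 := by positivity
    have hne : K.Nonempty := ⟨x₀, hx₀⟩
    have hH := abs_inner_le_slack_centroid hK hx₀ hmK
    have hH0 : ∀ u, 0 ≤ slack K ξ u := fun u =>
      (mul_nonneg_iff_of_pos_left hn1).1 ((abs_nonneg _).trans (hH u i))
    have hHpos : ∀ u ∈ sphere (0 : Eu n) 1, 0 < slack K ξ u := by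
      intro u hu
      refine lt_of_le_of_ne (hH0 u) fun h0 => ?_
      have h1 : M *ᵥ ⇑u = 0 := by
        funext j
        have h2 := hH u j
        rw [← h0, mul_zero, abs_nonpos_iff, inner_eq_mulVec] at h2
        exact h2
      have h3 := Matrix.eq_zero_of_mulVec_eq_zero hdet h1
      have h4 : u = 0 := by
        ext j
        exact congrFun h3 j
      rw [h4] at hu
      simp at hu
    have hξi : ξ ∈ interior K := mem_interior_of_inner_lt_suppFn hc hK hne fun u hu =>
      sub_pos.1 (hHpos u hu)
    have hHm : Measurable (slack K ξ) := (continuous_slack hK hne ξ).measurable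
    have hlt : ∫⁻ u, ENNReal.ofReal (slack K ξ u ^ (-q)) ∂μ < ENNReal.ofReal ε := by
      refine hmain (slack K ξ) hHm hH0 (fun s hs => ?_) ?_
      · calc μ {u | slack K ξ u ≤ s} ≤ μ {u : Eu n | ∀ i, |(M *ᵥ ⇑u) i| ≤ (n + 1) * s} := by
              refine measure_mono fun u hu j => ?_
              rw [← inner_eq_mulVec]
              exact (hH u j).trans (mul_le_mul_of_nonneg_left hu hn1.le)
          _ ≤ c₂ * sphMeasure n {u : Eu n | ∀ i, |(M *ᵥ ⇑u) i| ≤ (n + 1) * s} := hμ.upper _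
          _ ≤ c₂ * ENNReal.ofReal (|M.det|⁻¹ * ∏ _i : Fin n, (2 * ((n + 1) * s))) := by
              gcongr
              exact sphMeasure_setOf_mulVec_le hdet fun _ => by positivity
          _ ≤ c₂ * ENNReal.ofReal (2 ^ n * (2 * ((n + 1) * s)) ^ n) := by
              rw [Finset.prod_const, Finset.card_univ, Fintype.card_fin]
              gcongr
              exact one_le_det_of_volume hv hdet hcoord
          _ = _ := by
              rw [← ENNReal.ofReal_coe_nnreal, ← ENNReal.ofReal_mul c₂.coe_nonneg, Real.rpow_natCast]
              congr 1
              rw [hB]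
              simp only [mul_pow]
              ring
      · calc μ {u | slack K ξ u ≤ T} ≤ μ {u | |⟪m i, u⟫| ≤ (n + 1) * T} := by
              refine measure_mono fun u hu => ?_
              exact (hH u i).trans (mul_le_mul_of_nonneg_left hu hn1.le)
          _ ≤ _ := hμ.measure_abs_inner_le hn hL0 hik (by positivity)
          _ ≤ _ := ENNReal.ofReal_le_ofReal hLη
    have hint : Integrable (fun u => slack K ξ u ^ (-q)) μ := by
      refine ⟨(hHm.pow_const _).aestronglyMeasurable, ?_⟩
      rw [hasFiniteIntegral_iff_ofReal (ae_of_all _ fun u => Real.rpow_nonneg (hH0 u) _)]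
      exact hlt.trans ENNReal.ofReal_lt_top
    have hlt' : ∫ u, slack K ξ u ^ (-q) ∂μ < ε := by
      rw [← ENNReal.ofReal_lt_ofReal_iff hε0,
        ofReal_integral_eq_lintegral_ofReal hint
          (ae_of_all _ fun u => Real.rpow_nonneg (hH0 u) _)]
      exact hlt
    calc powPrim p D * μ.real univ = (μ.real univ - ε) / q := by
          rw [hε]
          field_simp
          ring
      _ < (μ.real univ - ∫ u, slack K ξ u ^ (-q) ∂μ) / q := by gcongr
      _ = ∫ u, (1 - slack K ξ u ^ (-q)) / q ∂μ := by
          rw [integral_div, integral_sub (integrable_const _) hint, integral_const, smul_eq_mul,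
            mul_one]
      _ ≤ energyAt p μ K ξ := by
          refine integral_mono_ae (((integrable_const _).sub hint).div_const q)
            (integrable_powPrim_slack hS hK hξi) ?_
          filter_upwards [hS] with u hu
          have h1 := powPrim_mono_exponent hqp (slack K ξ u)
          rw [powPrim_of_ne_zero (neg_ne_zero.2 hq.ne') (hHpos u hu), ← neg_div_neg_eq, neg_neg,
            neg_sub] at h1
          exact h1
      _ ≤ maxEnergy p μ K := energyAt_le_maxEnergy hS hK hξi
  intro x hx y hy
  calc ‖x - y‖ = ‖(x - x₀) - (y - x₀)‖ := by rw [sub_sub_sub_cancel_right]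
    _ ≤ ‖x - x₀‖ + ‖y - x₀‖ := norm_sub_le _ _
    _ ≤ _ := add_le_add (norm_sub_le_of_abs_le hdet (hcoord x hx) hsmall)
      (norm_sub_le_of_abs_le hdet (hcoord y hy) hsmall)

end Coercivity

section Minimizer

open scoped Topology
open TopologicalSpace

variable {n : ℕ} {p : ℝ} {μ : Measure (Eu n)} {c₁ c₂ : ℝ≥0}

theorem interior_nonempty_of_volume {K : Set (Eu n)} (hc : Convex ℝ K) (hv : 1 ≤ volume K) :
    (interior K).Nonempty := by
  rw [nonempty_iff_ne_empty]
  intro h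
  have h1 : K ⊆ frontier K := by
    rw [frontier, h, sdiff_empty]
    exact subset_closure
  have h2 := (measure_mono h1).trans_eq (hc.addHaar_frontier volume)
  exact absurd (hv.trans h2) (by simp)

theorem suppFn_le_add_dist (K L : NonemptyCompacts (Eu n)) {u : Eu n}
    (hu : u ∈ sphere (0 : Eu n) 1) {ε : ℝ} (h : dist K L < ε) :
    suppFn (K : Set (Eu n)) u ≤ suppFn (L : Set (Eu n)) u + ε := by
  refine suppFn_le K.nonempty fun x hx => ?_
  rw [NonemptyCompacts.dist_eq] at h
  obtain ⟨y, hy, hxy⟩ := exists_dist_lt_of_hausdorffDist_lt hx h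
    (hausdorffEDist_ne_top_of_nonempty_of_bounded K.nonempty L.nonempty K.isCompact.isBounded
      L.isCompact.isBounded)
  have h1 := inner_le_suppFn L.isCompact hy u
  have h2 := real_inner_le_norm (x - y) u
  rw [mem_sphere_zero_iff_norm.1 hu, mul_one, inner_sub_left, ← dist_eq_norm] at h2
  linarith

theorem isClosed_setOf_map_eq (A : Eu n ≃ₗᵢ[ℝ] Eu n) :
    IsClosed {K : NonemptyCompacts (Eu n) | A '' (K : Set (Eu n)) = K} := by
  have h : {K : NonemptyCompacts (Eu n) | A '' (K : Set (Eu n)) = K} =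
      {K | K.map A A.continuous = K} := by
    ext K
    simp only [mem_ofPred_eq, ← SetLike.coe_set_eq, NonemptyCompacts.coe_map]
  rw [h]
  exact isClosed_eq A.continuous.nonemptyCompacts_map continuous_id

theorem isClosed_setOf_convex : IsClosed {K : NonemptyCompacts (Eu n) | Convex ℝ (K : Set (Eu n))} := by
  have hf : ∀ a b : ℝ, Continuous fun z : Eu n × Eu n => a • z.1 + b • z.2 := fun a b => by fun_prop
  have h : {K : NonemptyCompacts (Eu n) | Convex ℝ (K : Set (Eu n))} =
      ⋂ (a : ℝ) (b : ℝ) (_ : 0 ≤ a) (_ : 0 ≤ b) (_ : a + b = 1),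
        {K | (K ×ˢ K).map _ (hf a b) ⊔ K = K} := by
    ext K
    simp only [mem_ofPred_eq, mem_iInter, sup_eq_right]
    have h1 : ∀ a b : ℝ, (K ×ˢ K).map _ (hf a b) ≤ K ↔
        ∀ x ∈ K, ∀ y ∈ K, a • x + b • y ∈ K := by
      intro a b
      rw [← SetLike.coe_subset_coe, NonemptyCompacts.coe_map, image_subset_iff]
      constructor
      · intro h x hx y hy
        exact h (show (x, y) ∈ ((K ×ˢ K : NonemptyCompacts (Eu n × Eu n)) : Set (Eu n × Eu n))
          from ⟨hx, hy⟩)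
      · rintro h ⟨x, y⟩ ⟨hx, hy⟩
        exact h x hx y hy
    simp only [h1]
    constructor
    · intro h a b ha hb hab x hx y hy
      exact h hx hy ha hb hab
    · intro h x hx y hy a b ha hb hab
      exact h a b ha hb hab x hx y hy
  rw [h]
  refine isClosed_iInter fun a => isClosed_iInter fun b => isClosed_iInter fun _ =>
    isClosed_iInter fun _ => isClosed_iInter fun _ => isClosed_eq ?_ continuous_id
  have h2 : Continuous fun K : NonemptyCompacts (Eu n) => (K ×ˢ K).map _ (hf a b) :=
    (hf a b).nonemptyCompacts_map.comp
      (NonemptyCompacts.continuous_prod.comp (continuous_id.prodMk continuous_id))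
  exact h2.sup continuous_id

theorem isClosed_setOf_one_le_volume :
    IsClosed {K : NonemptyCompacts (Eu n) | 1 ≤ volume (K : Set (Eu n))} := by
  rw [← isOpen_compl_iff, isOpen_iff_mem_nhds]
  intro K hK
  rw [mem_compl_iff, mem_ofPred_eq, not_le] at hK
  obtain ⟨U, hKU, hU, hU1⟩ := Set.exists_isOpen_lt_of_lt _ _ hK
  filter_upwards [(NonemptyCompacts.isOpen_subsets_of_isOpen hU).mem_nhds hKU] with L hL
  rw [mem_compl_iff, mem_ofPred_eq, not_le]
  exact (measure_mono hL).trans_lt hU1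

theorem image_image_sub_of_map_eq {K : Set (Eu n)} {A : Eu n ≃ₗᵢ[ℝ] Eu n} (hA : A '' K = K)
    {ξ : Eu n} (hξ : A ξ = ξ) :
    A '' ((fun z => z - ξ) '' K) = (fun z => z - ξ) '' K := by
  conv_rhs => rw [← hA]
  rw [image_image, image_image]
  simp only [map_sub, hξ]

/-- An invariant body of volume at least one minimizing the maximal energy, translated so that its
optimal point is the origin. -/
theorem exists_isOpt_forall_maxEnergy_le (hμ : IsComparable μ c₁ c₂) (hn : 0 < n)
    (hp : -(n : ℝ) < p) (hp1 : p < 1) (𝒢 : Set (Eu n ≃ₗᵢ[ℝ] Eu n)) (h𝒢 : ∀ A ∈ 𝒢, μ.map A = μ) :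
    ∃ K : Set (Eu n), Convex ℝ K ∧ IsCompact K ∧ 1 ≤ volume K ∧ IsOpt p μ K 0 ∧
      (∀ A ∈ 𝒢, A '' K = K) ∧
      ∀ L : Set (Eu n), Convex ℝ L → IsCompact L → 1 ≤ volume L → (∀ A ∈ 𝒢, A '' L = L) →
        maxEnergy p μ K ≤ maxEnergy p μ L := by
  have := hμ.isFiniteMeasure
  have hS := hμ.ae_mem_sphere hn
  have hnt := nontrivial_eu hn
  obtain ⟨r, hr, hrv⟩ : ∃ r : ℝ, 0 < r ∧ 1 ≤ volume (closedBall (0 : Eu n) r) := by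
    have h1 : ∀ r : ℝ, 0 ≤ r → volume (closedBall (0 : Eu n) r) =
        ENNReal.ofReal (r ^ n) * volume (ball (0 : Eu n) 1) := fun r hr => by
      rw [Measure.addHaar_closedBall _ _ hr, finrank_euclideanSpace_fin]
    set v := volume.real (ball (0 : Eu n) 1) with hv
    have hv0 : 0 < v := ENNReal.toReal_pos (measure_ball_pos _ _ one_pos).ne' measure_ball_lt_top.ne
    refine ⟨max 1 v⁻¹, by positivity, ?_⟩
    rw [h1 _ (by positivity), ← ofReal_measureReal, ← ENNReal.ofReal_mul (by positivity),
      ENNReal.one_le_ofReal]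
    calc 1 = v⁻¹ * v := (inv_mul_cancel₀ hv0.ne').symm
      _ ≤ max 1 v⁻¹ * v := by gcongr; exact le_max_right _ _
      _ ≤ max 1 v⁻¹ ^ n * v := by
          gcongr
          exact le_self_pow₀ (le_max_left _ _) hn.ne'
  set B := closedBall (0 : Eu n) r with hB
  have hBc : Convex ℝ B := convex_closedBall _ _
  have hBK : IsCompact B := isCompact_closedBall _ _
  have hBi := interior_nonempty_of_volume hBc hrv
  have hBG : ∀ A ∈ 𝒢, A '' B = B := fun A _ => by
    rw [hB, A.image_closedBall, map_zero]
  have hBF : maxEnergy p μ B ≤ powPrim p (2 * r) * μ.real univ := by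
    refine csSup_le (hBi.image _) ?_
    rintro _ ⟨ξ, hξ, rfl⟩
    obtain ⟨s, hs, hsl⟩ := exists_le_slack hBK hξ
    calc energyAt p μ B ξ ≤ ∫ _, powPrim p (2 * r) ∂μ := by
          refine integral_mono_ae (integrable_powPrim_slack hS hBK hξ) (integrable_const _) ?_
          filter_upwards [hS] with u hu
          refine powPrim_mono (hs.trans_le (hsl u hu)) ?_
          have hu1 := mem_sphere_zero_iff_norm.1 hu
          have h1 : suppFn B u ≤ r := suppFn_le ⟨ξ, interior_subset hξ⟩ fun x hx => by
            refine (real_inner_le_norm x u).trans ?_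
            rw [hu1, mul_one]
            exact mem_closedBall_zero_iff.1 hx
          have h2 := real_inner_le_norm (-ξ) u
          have h3 := mem_closedBall_zero_iff.1 (interior_subset hξ)
          rw [hu1, mul_one, norm_neg, inner_neg_left] at h2
          rw [slack]
          linarith
      _ = _ := by rw [integral_const, smul_eq_mul, mul_comm]
  obtain ⟨R, hR⟩ := exists_diam_bound_of_maxEnergy_le hμ hn hp (D := 2 * r) (by positivity)
  set 𝒯 : Set (NonemptyCompacts (Eu n)) := {K | (K : Set (Eu n)) ⊆ closedBall 0 R} ∩
    ({K | Convex ℝ (K : Set (Eu n))} ∩ ({K | ((K : Set (Eu n)) ∩ {0}).Nonempty} ∩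
      ({K | 1 ≤ volume (K : Set (Eu n))} ∩ ⋂ A ∈ 𝒢, {K | A '' (K : Set (Eu n)) = K}))) with h𝒯
  have h𝒯c : IsCompact 𝒯 := by
    refine (NonemptyCompacts.isCompact_subsets_of_isCompact (isCompact_closedBall _ _)).inter_right ?_
    refine isClosed_setOf_convex.inter (IsClosed.inter ?_ (isClosed_setOf_one_le_volume.inter ?_))
    · exact NonemptyCompacts.isClosed_inter_nonempty_of_isClosed isClosed_singleton
    · exact isClosed_biInter fun A _ => isClosed_setOf_map_eq A
  have hmem : ∀ L : Set (Eu n), Convex ℝ L → (hL : IsCompact L) → 1 ≤ volume L →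
      (∀ A ∈ 𝒢, A '' L = L) → (h0 : (0 : Eu n) ∈ L) → maxEnergy p μ L ≤ maxEnergy p μ B →
      (⟨⟨L, hL⟩, ⟨0, h0⟩⟩ : NonemptyCompacts (Eu n)) ∈ 𝒯 := by
    intro L hc hL hv hG h0 hF
    refine ⟨fun x hx => ?_, hc, ⟨0, h0, rfl⟩, hv, mem_iInter₂.2 hG⟩
    rw [mem_closedBall]
    rw [dist_eq_norm]
    exact hR L hc hL (interior_nonempty_of_volume hc hv) hv (hF.trans hBF) x hx 0 h0
  have hlsc : LowerSemicontinuousOn (fun K : NonemptyCompacts (Eu n) => maxEnergy p μ K) 𝒯 := by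
    intro K hK c hc
    obtain ⟨ε, hε, h⟩ := exists_lt_maxEnergy_of_suppFn_close hS hp1 K.isCompact
      (interior_nonempty_of_volume hK.2.1 hK.2.2.2.1) hc
    filter_upwards [self_mem_nhdsWithin, mem_nhdsWithin_of_mem_nhds (ball_mem_nhds K hε)]
      with L hL hLK
    refine h L hL.2.1 L.isCompact L.nonempty fun u hu => ?_
    rw [mem_ball] at hLK
    have h1 := suppFn_le_add_dist L K hu hLK
    have h2 := suppFn_le_add_dist K L hu (by rwa [dist_comm])
    rw [abs_le]
    constructor <;> linarith
  have h0B : (0 : Eu n) ∈ B := mem_closedBall_self hr.le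
  have hB𝒯 := hmem B hBc hBK hrv hBG h0B le_rfl
  obtain ⟨K, hK, hmin⟩ := hlsc.exists_isMinOn ⟨_, hB𝒯⟩ h𝒯c
  rw [isMinOn_iff] at hmin
  have hcentre : ∀ L : Set (Eu n), Convex ℝ L → IsCompact L → 1 ≤ volume L →
      (∀ A ∈ 𝒢, A '' L = L) → ∃ ξ : Eu n, IsOpt p μ L ξ ∧ 1 ≤ volume ((fun z => z - ξ) '' L) ∧
        (∀ A ∈ 𝒢, A '' ((fun z => z - ξ) '' L) = (fun z => z - ξ) '' L) := by
    intro L hc hL hv hG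
    obtain ⟨ξ, hξ⟩ := exists_isOpt hμ hn hp1 hc hL (interior_nonempty_of_volume hc hv)
    refine ⟨ξ, hξ, ?_, fun A hA =>
      image_image_sub_of_map_eq (hG A hA) (hξ.map_eq hμ hn hp1 (hG A hA) (h𝒢 A hA))⟩
    simp only [sub_eq_add_neg, image_add_right, measure_preimage_add_right]
    exact hv
  have hKG : ∀ A ∈ 𝒢, A '' (K : Set (Eu n)) = K := fun A hA =>
    (mem_iInter₂ (s := fun (A : Eu n ≃ₗᵢ[ℝ] Eu n) (_ : A ∈ 𝒢) =>
      {K : NonemptyCompacts (Eu n) | A '' (K : Set (Eu n)) = K})).1 hK.2.2.2.2 A hA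
  obtain ⟨ξ, hξ, hξv, hξG⟩ := hcentre K hK.2.1 K.isCompact hK.2.2.2.1 hKG
  refine ⟨(fun z => z - ξ) '' K, convex_image_sub hK.2.1 ξ, K.isCompact.image (by fun_prop), hξv,
    hξ.image_sub K.isCompact, hξG, fun L hc hL hv hG => ?_⟩
  rw [maxEnergy_image_sub K.isCompact K.nonempty]
  rcases le_total (maxEnergy p μ L) (maxEnergy p μ B) with h | h
  · obtain ⟨η, hη, hηv, hηG⟩ := hcentre L hc hL hv hG
    have h1 := hmem ((fun z => z - η) '' L) (convex_image_sub hc η) (hL.image (by fun_prop)) hηv hηG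
      ⟨η, hη.mem, sub_self η⟩ (by rwa [maxEnergy_image_sub hL ⟨η, hη.mem⟩])
    have h2 := hmin _ h1
    rw [← maxEnergy_image_sub hL ⟨η, hη.mem⟩ η]
    exact h2
  · exact (hmin _ hB𝒯).trans h

end Minimizer

section Variation

open scoped Topology

variable {n : ℕ} {p : ℝ} {μ : Measure (Eu n)} {c₁ c₂ : ℝ≥0} {K : Set (Eu n)}

theorem image_wulff_comp (A : Eu n ≃ₗᵢ[ℝ] Eu n) (f : Eu n → ℝ) :
    A '' wulff (fun u => f (A u)) = wulff f := by
  ext x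
  constructor
  · rintro ⟨y, hy, rfl⟩ u hu
    have h := hy (A.symm u) (by simpa using hu)
    change _ ≤ f (A (A.symm u)) at h
    rwa [← A.inner_map_map, A.apply_symm_apply] at h
  · intro hx
    refine ⟨A.symm x, fun u hu => ?_, A.apply_symm_apply x⟩
    have h := hx (A u) (by simpa using hu)
    rwa [← A.inner_map_map, A.apply_symm_apply]

theorem image_smul_wulff {c : ℝ} (hc : 0 < c) (f : Eu n → ℝ) :
    (fun x => c • x) '' wulff f = wulff fun u => c * f u := by
  ext x
  constructor
  · rintro ⟨y, hy, rfl⟩ u hu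
    rw [real_inner_smul_left]
    exact mul_le_mul_of_nonneg_left (hy u hu) hc.le
  · intro hx
    refine ⟨c⁻¹ • x, fun u hu => ?_, smul_inv_smul₀ hc.ne' x⟩
    rw [real_inner_smul_left, inv_mul_le_iff₀ hc]
    exact hx u hu

theorem volume_real_image_isometry (A : Eu n ≃ₗᵢ[ℝ] Eu n) (s : Set (Eu n)) :
    volume.real (A '' s) = volume.real s := by
  rw [Measure.real, Measure.real]
  congr 1
  have h : A '' s = A.symm ⁻¹' s := A.toEquiv.image_eq_preimage_symm s
  rw [h]
  exact A.symm.measurePreserving.measure_preimage_equiv (f := A.symm.toHomeomorph.toMeasurableEquiv) s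

theorem volume_real_image_smul {c : ℝ} (hc : 0 < c) (s : Set (Eu n)) :
    volume.real ((fun x => c • x) '' s) = c ^ n * volume.real s := by
  rw [Measure.real, Measure.real, ← Set.image_smul.symm, Measure.addHaar_smul,
    finrank_euclideanSpace_fin, ENNReal.toReal_mul, ENNReal.toReal_ofReal (abs_nonneg _),
    abs_of_pos (pow_pos hc n)]

theorem volume_real_image_sub (y : Eu n) (s : Set (Eu n)) :
    volume.real ((fun x => x - y) '' s) = volume.real s := by
  simp only [sub_eq_add_neg]
  rw [Measure.real, Measure.real, Set.image_add_right, neg_neg, measure_preimage_add_right]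

theorem hasDerivAt_volume_wulff_of_mem_interior (hn : 0 < n) (hc : Convex ℝ K) (hK : IsCompact K)
    {y : Eu n} (hy : y ∈ interior K) {g : Eu n → ℝ} (hg : Continuous g) :
    HasDerivAt (fun t : ℝ => volume.real (wulff fun u => suppFn K u + t * g u))
      (n * ∫ u, g u ∂(surfMeasure ((fun z => z - y) '' K))) 0 := by
  have hne : K.Nonempty := ⟨y, interior_subset hy⟩
  have h0 : (0 : Eu n) ∈ interior ((fun z => z - y) '' K) := by
    have h := (Homeomorph.subRight y).image_interior K
    change _ ∈ interior ((Homeomorph.subRight y) '' K)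
    rw [← h]
    exact ⟨y, hy, sub_self y⟩
  have h := hasDerivAt_volume_wulff hn (convex_image_sub hc y) (hK.image (by fun_prop)) h0 hg
  convert h using 2 with t
  rw [← volume_real_image_sub y, ← wulff_sub_inner]
  congr 2
  funext u
  rw [suppFn_image_sub hK hne]
  ring

theorem integral_surfMeasure_comp (hn : 0 < n) (hc : Convex ℝ K) (hK : IsCompact K)
    {y : Eu n} (hy : y ∈ interior K) {A : Eu n ≃ₗᵢ[ℝ] Eu n} (hA : A '' K = K)
    {g : Eu n → ℝ} (hg : Continuous g) :
    ∫ u, g (A u) ∂(surfMeasure ((fun z => z - y) '' K)) =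
      ∫ u, g u ∂(surfMeasure ((fun z => z - y) '' K)) := by
  have h1 := hasDerivAt_volume_wulff_of_mem_interior hn hc hK hy hg
  have h2 := hasDerivAt_volume_wulff_of_mem_interior hn hc hK hy
    (g := fun u => g (A u)) (hg.comp A.continuous)
  have h3 : (fun t : ℝ => volume.real (wulff fun u => suppFn K u + t * g (A u))) =
      fun t : ℝ => volume.real (wulff fun u => suppFn K u + t * g u) := by
    funext t
    rw [← image_wulff_comp A fun u => suppFn K u + t * g u, volume_real_image_isometry]
    simp only [suppFn_map_of_image_eq hA]
  rw [h3] at h2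
  exact mul_left_cancel₀ (Nat.cast_ne_zero.2 hn.ne') (h2.unique h1)

theorem integral_surfMeasure_image_smul (hn : 0 < n) (hc : Convex ℝ K) (hK : IsCompact K)
    {y : Eu n} (hy : y ∈ interior K) {c : ℝ} (hc0 : 0 < c)
    (hyc : c • y ∈ interior ((fun z => c • z) '' K)) {g : Eu n → ℝ} (hg : Continuous g) :
    c * ∫ u, g u ∂(surfMeasure ((fun z => z - c • y) '' ((fun z => c • z) '' K))) =
      c ^ n * ∫ u, g u ∂(surfMeasure ((fun z => z - y) '' K)) := by
  have hne : K.Nonempty := ⟨y, interior_subset hy⟩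
  have h1 := (hasDerivAt_volume_wulff_of_mem_interior hn hc hK hy hg).const_mul (c ^ n)
  have hcc : Convex ℝ ((fun z => c • z) '' K) := by
    simpa only [Set.image_smul] using hc.smul c
  have h2 := hasDerivAt_volume_wulff_of_mem_interior hn hcc
    (hK.image (by fun_prop)) hyc hg
  have h2' : HasDerivAt (fun t : ℝ => volume.real
      (wulff fun u => suppFn ((fun z => c • z) '' K) u + t * g u))
      (n * ∫ u, g u ∂(surfMeasure ((fun z => z - c • y) '' ((fun z => c • z) '' K))))
      (c * 0) := by rwa [mul_zero]
  have h3 := h2'.comp (0 : ℝ) ((hasDerivAt_id' (0 : ℝ)).const_mul c)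
  have h4 : ((fun t : ℝ => volume.real
      (wulff fun u => suppFn ((fun z => c • z) '' K) u + t * g u)) ∘ (c * ·)) =
      fun t : ℝ => c ^ n * volume.real (wulff fun u => suppFn K u + t * g u) := by
    funext t
    rw [← volume_real_image_smul hc0, image_smul_wulff hc0]
    simp only [Function.comp_apply, suppFn_image_smul hK hne hc0.le, mul_add, mul_assoc]
  rw [h4] at h3
  have h5 := h3.unique h1
  have hn' : (n : ℝ) ≠ 0 := Nat.cast_ne_zero.2 hn.ne'
  apply mul_left_cancel₀ hn'
  linear_combination h5

/-- Euler-Lagrange equation against test functions invariant under the symmetries. -/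
theorem integral_rpow_mul_eq_of_forall_maxEnergy_le (hμ : IsComparable μ c₁ c₂) (hn : 0 < n)
    (hp1 : p < 1) (hc : Convex ℝ K) (hK : IsCompact K) (hv : 1 ≤ volume K) (h : IsOpt p μ K 0)
    {𝒢 : Set (Eu n ≃ₗᵢ[ℝ] Eu n)} (h𝒢 : ∀ A ∈ 𝒢, A '' K = K)
    (hmin : ∀ L : Set (Eu n), Convex ℝ L → IsCompact L → 1 ≤ volume L →
      (∀ A ∈ 𝒢, A '' L = L) → maxEnergy p μ K ≤ maxEnergy p μ L)
    {y : Eu n} (hy : y ∈ interior K) {g : Eu n → ℝ} (hg : Continuous g)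
    (hgA : ∀ A ∈ 𝒢, ∀ u, g (A u) = g u)
    {I : Eu n} (hI : I = ∫ u, suppFn K u ^ (p - 1) • u ∂μ) :
    volume.real K * (∫ u, suppFn K u ^ (p - 1) * g u ∂μ + ‖I‖ * g (-‖I‖⁻¹ • I)) =
      (∫ u, suppFn K u ^ (p - 1) * suppFn K u ∂μ) *
        ∫ u, g u ∂(surfMeasure ((fun z => z - y) '' K)) := by
  have hne : K.Nonempty := ⟨0, h.mem⟩
  have hi : (interior K).Nonempty := ⟨y, hy⟩
  have hh := continuous_suppFn hK hne
  set a := ∫ u, suppFn K u ^ (p - 1) * suppFn K u ∂μ with ha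
  set b := ∫ u, suppFn K u ^ (p - 1) * g u ∂μ + ‖I‖ * g (-‖I‖⁻¹ • I) with hb
  set D := ∫ u, g u ∂(surfMeasure ((fun z => z - y) '' K)) with hD
  set V : ℝ → ℝ := fun t => volume.real (wulff fun u => suppFn K u + t * g u) with hV
  set v := volume.real K with hvdef
  have hVd : HasDerivAt V (n * D) 0 := hasDerivAt_volume_wulff_of_mem_interior hn hc hK hy hg
  have hV0 : V 0 = v := by
    simp only [hV, zero_mul, add_zero]
    rw [show (fun u => suppFn K u) = suppFn K from rfl, wulff_suppFn hc hK hne]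
  have hv1 : 1 ≤ v := by
    rw [hvdef, Measure.real, ← ENNReal.toReal_one]
    exact ENNReal.toReal_mono hK.measure_lt_top.ne hv
  have hv0 : 0 < v := zero_lt_one.trans_le hv1
  have hn' : (n : ℝ) ≠ 0 := Nat.cast_ne_zero.2 hn.ne'
  set s : ℝ → ℝ := fun t => (v / V t) ^ ((n : ℝ)⁻¹) with hs
  have hs0 : s 0 = 1 := by simp only [hs, hV0, div_self hv0.ne', Real.one_rpow]
  have hsd : HasDerivAt s (-(D / v)) 0 := by
    have h1 : HasDerivAt (fun t => v / V t) (-(v * (n * D)) / V 0 ^ 2) 0 := by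
      have := (hasDerivAt_const (0 : ℝ) v).div hVd (by rw [hV0]; exact hv0.ne')
      rw [zero_mul, zero_sub] at this
      exact this
    have h2 := h1.rpow_const (p := (n : ℝ)⁻¹) (Or.inl (by rw [hV0, div_self hv0.ne']; exact one_ne_zero))
    convert h2 using 1
    rw [hV0, div_self hv0.ne', Real.one_rpow]
    field_simp
  set J : ℝ → ℝ := fun t => (s t - 1) * a + s t * t * b with hJ
  have hJd : HasDerivAt J (-(D / v) * a + b) 0 := by
    have h1 := ((hsd.sub_const 1).mul_const a).add
      ((hsd.mul (hasDerivAt_id (0 : ℝ))).mul_const b)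
    rw [hs0] at h1
    refine HasDerivAt.congr_deriv h1 ?_
    simp
  have hJ0 : J 0 = 0 := by simp [hJ, hs0]
  have hVpos : ∀ᶠ t in 𝓝 (0 : ℝ), 0 < V t :=
    hVd.continuousAt.eventually (lt_mem_nhds (by rw [hV0]; exact hv0))
  have hJnonneg : ∀ᶠ t in 𝓝 (0 : ℝ), J 0 ≤ J t := by
    filter_upwards [hVpos] with t ht
    have hst : 0 < s t := Real.rpow_pos_of_pos (div_pos hv0 ht) _
    set L := wulff fun u => s t * (suppFn K u + t * g u) with hL
    have hcont : Continuous fun u => s t * (suppFn K u + t * g u) := by fun_prop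
    have hLc : Convex ℝ L := convex_wulff _
    have hLK : IsCompact L := isCompact_wulff hcont
    have hLv : volume.real L = v := by
      rw [hL, ← image_smul_wulff hst, volume_real_image_smul hst]
      change s t ^ n * V t = v
      rw [← Real.rpow_natCast, ← Real.rpow_mul (div_pos hv0 ht).le, inv_mul_cancel₀ hn',
        Real.rpow_one, div_mul_cancel₀ _ ht.ne']
    have hLv1 : 1 ≤ volume L := by
      rw [← ENNReal.ofReal_toReal hLK.measure_lt_top.ne]
      change 1 ≤ ENNReal.ofReal (volume.real L)
      rw [hLv]
      exact ENNReal.one_le_ofReal.2 hv1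
    have hLi := interior_nonempty_of_volume hLc hLv1
    have h1 := hmin L hLc hLK hLv1 fun A hA => by
      conv_rhs => rw [hL, ← image_wulff_comp A]
      simp only [suppFn_map_of_image_eq (h𝒢 A hA), hgA A hA]
      rfl
    have h2 := maxEnergy_le_of_suppFn_le hμ hn hp1 hc hK hi h hLK hLi hg (s := s t) (t := t)
      (fun u hu => suppFn_wulff_le (hLi.mono interior_subset) hu) hI
    rw [hJ0]
    have h3 := h1.trans h2
    rw [← ha, ← hb] at h3
    simpa only [le_add_iff_nonneg_right] using h3
  have hloc : IsLocalMin J 0 := hJnonneg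
  have := hloc.hasDerivAt_eq_zero hJd
  field_simp at this
  linear_combination this

end Variation

section Averaging

open scoped Topology BoundedContinuousFunction

/-- Two measures with the same symmetries coincide if they agree on invariant functions. -/
theorem measure_eq_of_integral_invariant_eq {Γ X : Type*} [Group Γ] [TopologicalSpace Γ]
    [IsTopologicalGroup Γ] [CompactSpace Γ] [SecondCountableTopology Γ] [TopologicalSpace X]
    [SecondCountableTopology X] [LocallyCompactSpace X] [MeasurableSpace X] [BorelSpace X] [HasOuterApproxClosed X]
    {ρ : Γ → X → X} (hmul : ∀ a b x, ρ (a * b) x = ρ a (ρ b x))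
    (hρ : Continuous fun q : Γ × X => ρ q.1 q.2)
    {ν₁ ν₂ : Measure X} [IsFiniteMeasure ν₁] [IsFiniteMeasure ν₂]
    (h₁ : ∀ (γ : Γ) (g : X → ℝ), Continuous g → ∫ u, g (ρ γ u) ∂ν₁ = ∫ u, g u ∂ν₁)
    (h₂ : ∀ (γ : Γ) (g : X → ℝ), Continuous g → ∫ u, g (ρ γ u) ∂ν₂ = ∫ u, g u ∂ν₂)
    (h : ∀ g : X → ℝ, Continuous g → (∀ γ u, g (ρ γ u) = g u) →
      ∫ u, g u ∂ν₁ = ∫ u, g u ∂ν₂) : ν₁ = ν₂ := by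
  refine ext_of_forall_integral_eq_of_IsFiniteMeasure fun g => ?_
  let _ : MeasurableSpace Γ := borel Γ
  have _ : BorelSpace Γ := ⟨rfl⟩
  set m : Measure Γ := Measure.haar with hm
  have hF : Continuous fun q : X × Γ => g (ρ q.2⁻¹ q.1) :=
    g.continuous.comp (hρ.comp (continuous_snd.inv.prodMk continuous_fst))
  set G : X → ℝ := fun u => ∫ γ, g (ρ γ⁻¹ u) ∂m with hG
  have hGc : Continuous G := by
    have := continuous_parametric_integral_of_continuous (μ := m)
      (f := fun (u : X) (γ : Γ) => g (ρ γ⁻¹ u)) hF isCompact_univ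
    simpa only [Measure.restrict_univ] using this
  have hGinv : ∀ β u, G (ρ β u) = G u := fun β u => by
    have h1 := integral_mul_left_eq_self (μ := m) (fun γ => g (ρ γ⁻¹ u)) β⁻¹
    rw [hG]
    simp only
    rw [← h1]
    refine integral_congr_ae (Filter.Eventually.of_forall fun γ => ?_)
    simp only [mul_inv_rev, inv_inv, hmul]
  have key : ∀ ν : Measure X, IsFiniteMeasure ν →
      (∀ (γ : Γ) (g : X → ℝ), Continuous g → ∫ u, g (ρ γ u) ∂ν = ∫ u, g u ∂ν) →
      ∫ u, G u ∂ν = m.real univ * ∫ u, g u ∂ν := fun ν _ hν => by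
    have hint : Integrable (Function.uncurry fun u γ => g (ρ γ⁻¹ u)) (ν.prod m) := by
      refine Integrable.of_bound hF.aestronglyMeasurable ‖g‖
        (Filter.Eventually.of_forall fun q => g.norm_coe_le_norm _)
    rw [hG, integral_integral_swap hint]
    simp only [hν _ _ g.continuous, integral_const, smul_eq_mul]
  have h3 := h G hGc hGinv
  rw [key ν₁ ‹_› h₁, key ν₂ ‹_› h₂] at h3
  refine mul_left_cancel₀ (ENNReal.toReal_pos ?_ (measure_ne_top m univ)).ne' h3
  exact (isOpen_univ.measure_pos m univ_nonempty).ne'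

end Averaging

section Orthogonal

open scoped Matrix

variable {n : ℕ}

theorem isCompact_setOf_mem_orthogonalGroup (n : ℕ) :
    IsCompact {A : Matrix (Fin n) (Fin n) ℝ | A ∈ Matrix.orthogonalGroup (Fin n) ℝ} := by
  have h1 : IsCompact (Set.pi univ fun _ : Fin n => Set.pi univ fun _ : Fin n =>
      Set.Icc (-1 : ℝ) 1) :=
    isCompact_univ_pi fun _ => isCompact_univ_pi fun _ => isCompact_Icc
  refine IsCompact.of_isClosed_subset (s := (Set.pi univ fun _ : Fin n => Set.pi univ
    fun _ : Fin n => Set.Icc (-1 : ℝ) 1 : Set (Matrix (Fin n) (Fin n) ℝ))) h1 ?_ ?_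
  · have h2 : {A : Matrix (Fin n) (Fin n) ℝ | A ∈ Matrix.orthogonalGroup (Fin n) ℝ} =
        {A | A * Aᵀ = 1} := by
      ext A
      exact Matrix.mem_orthogonalGroup_iff (Fin n) ℝ
    rw [h2]
    exact isClosed_eq (by fun_prop) continuous_const
  · intro A hA i _ j _
    have h := entry_norm_bound_of_unitary hA i j
    exact abs_le.1 h

instance compactSpace_orthogonalGroup (n : ℕ) :
    CompactSpace (Matrix.orthogonalGroup (Fin n) ℝ) :=
  isCompact_iff_compactSpace.1 (isCompact_setOf_mem_orthogonalGroup n)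

theorem matAct_mul (A B : Matrix (Fin n) (Fin n) ℝ) (x : Eu n) :
    matAct (A * B) x = matAct A (matAct B x) := by
  rw [matAct, matAct, matAct, ContinuousLinearEquiv.apply_symm_apply, Matrix.mulVec_mulVec]

theorem matAct_one (x : Eu n) : matAct 1 x = x := by
  simp [matAct]

theorem continuous_matAct :
    Continuous fun q : Matrix (Fin n) (Fin n) ℝ × Eu n => matAct q.1 q.2 := by
  unfold matAct
  exact (EuclideanSpace.equiv (Fin n) ℝ).symm.continuous.comp
    (continuous_fst.matrix_mulVec ((EuclideanSpace.equiv (Fin n) ℝ).continuous.comp continuous_snd))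

theorem norm_matAct {A : Matrix (Fin n) (Fin n) ℝ} (hA : A ∈ Matrix.orthogonalGroup (Fin n) ℝ)
    (x : Eu n) : ‖matAct A x‖ = ‖x‖ := by
  have h1 : ∀ y : Eu n, ‖y‖ ^ 2 = (EuclideanSpace.equiv (Fin n) ℝ y) ⬝ᵥ
      (EuclideanSpace.equiv (Fin n) ℝ y) := fun y => by
    rw [EuclideanSpace.norm_sq_eq]
    simp [dotProduct, pow_two]
  have h2 : ‖matAct A x‖ ^ 2 = ‖x‖ ^ 2 := by
    rw [h1, h1, matAct, ContinuousLinearEquiv.apply_symm_apply, Matrix.dotProduct_mulVec,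
      Matrix.vecMul_mulVec, (Matrix.mem_orthogonalGroup_iff' (Fin n) ℝ).1 hA, Matrix.vecMul_one]
  exact (sq_eq_sq₀ (norm_nonneg _) (norm_nonneg _)).1 h2

/-- The linear isometry of Euclidean space given by an orthogonal matrix. -/
def orthogonalIsometry (A : Matrix.orthogonalGroup (Fin n) ℝ) : Eu n ≃ₗᵢ[ℝ] Eu n where
  toFun := matAct (A : Matrix (Fin n) (Fin n) ℝ)
  invFun := matAct ((A⁻¹ : Matrix.orthogonalGroup (Fin n) ℝ) : Matrix (Fin n) (Fin n) ℝ)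
  map_add' x y := by simp [matAct, Matrix.mulVec_add]
  map_smul' c x := by simp [matAct, Matrix.mulVec_smul]
  left_inv x := by
    rw [← matAct_mul, ← Submonoid.coe_mul, inv_mul_cancel, Submonoid.coe_one, matAct_one]
  right_inv x := by
    rw [← matAct_mul, ← Submonoid.coe_mul, mul_inv_cancel, Submonoid.coe_one, matAct_one]
  norm_map' x := norm_matAct A.2 x

end Orthogonal

section EulerMeasure

open scoped Topology

variable {n : ℕ} {p : ℝ} {μ : Measure (Eu n)} {c₁ c₂ : ℝ≥0} {K : Set (Eu n)}

/-- The weighted measure of a body, balanced by an atom so that its barycenter vanishes. -/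
def eulerMeasure (p : ℝ) (μ : Measure (Eu n)) (K : Set (Eu n)) : Measure (Eu n) :=
  μ.withDensity (fun u => ENNReal.ofReal (suppFn K u ^ (p - 1))) +
    ENNReal.ofReal ‖∫ u, suppFn K u ^ (p - 1) • u ∂μ‖ •
      Measure.dirac (-‖∫ u, suppFn K u ^ (p - 1) • u ∂μ‖⁻¹ • ∫ u, suppFn K u ^ (p - 1) • u ∂μ)

theorem IsOpt.integrable_suppFn_rpow (h : IsOpt p μ K 0) :
    Integrable (fun u => suppFn K u ^ (p - 1)) μ := by
  simpa only [slack_zero] using h.integrable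

theorem IsOpt.suppFn_pos (h : IsOpt p μ K 0) : ∀ᵐ u ∂μ, 0 < suppFn K u := by
  simpa only [slack_zero] using h.pos

theorem IsOpt.isFiniteMeasure_withDensity (h : IsOpt p μ K 0) :
    IsFiniteMeasure (μ.withDensity fun u => ENNReal.ofReal (suppFn K u ^ (p - 1))) :=
  isFiniteMeasure_withDensity_ofReal h.integrable_suppFn_rpow.2

theorem IsOpt.isFiniteMeasure_eulerMeasure (h : IsOpt p μ K 0) :
    IsFiniteMeasure (eulerMeasure p μ K) := by
  have := h.isFiniteMeasure_withDensity
  have : IsFiniteMeasure (ENNReal.ofReal ‖∫ u, suppFn K u ^ (p - 1) • u ∂μ‖ •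
      Measure.dirac (-‖∫ u, suppFn K u ^ (p - 1) • u ∂μ‖⁻¹ •
        ∫ u, suppFn K u ^ (p - 1) • u ∂μ)) :=
    Measure.smul_finite _ ENNReal.ofReal_ne_top
  rw [eulerMeasure]
  infer_instance

theorem integral_eulerMeasure (hμ : IsComparable μ c₁ c₂) (hn : 0 < n) (hK : IsCompact K)
    (h : IsOpt p μ K 0) {g : Eu n → ℝ} (hg : Continuous g) {I : Eu n}
    (hI : I = ∫ u, suppFn K u ^ (p - 1) • u ∂μ) :
    ∫ u, g u ∂(eulerMeasure p μ K) =
      ∫ u, suppFn K u ^ (p - 1) * g u ∂μ + ‖I‖ * g (-‖I‖⁻¹ • I) := by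
  have := hμ.isFiniteMeasure
  have hS := hμ.ae_mem_sphere hn
  have hwm : Measurable fun u => suppFn K u ^ (p - 1) :=
    (continuous_suppFn hK ⟨0, h.mem⟩).measurable.pow_const _
  have hwm' : Measurable fun u => ENNReal.ofReal (suppFn K u ^ (p - 1)) := hwm.ennreal_ofReal
  have hfin : ∀ᵐ u ∂μ, ENNReal.ofReal (suppFn K u ^ (p - 1)) < ∞ :=
    Filter.Eventually.of_forall fun _ => ENNReal.ofReal_lt_top
  have hsw : ∀ᵐ u ∂μ, (ENNReal.ofReal (suppFn K u ^ (p - 1))).toReal • g u =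
      suppFn K u ^ (p - 1) * g u := by
    filter_upwards [h.suppFn_pos] with u hu
    rw [ENNReal.toReal_ofReal (Real.rpow_nonneg hu.le _), smul_eq_mul]
  have hint := integrable_mul_continuous hS h.integrable_suppFn_rpow hg
  rw [eulerMeasure, ← hI, integral_add_measure]
  · rw [integral_withDensity_eq_integral_toReal_smul hwm' hfin, integral_congr_ae hsw,
      integral_smul_measure, integral_dirac, ENNReal.toReal_ofReal (norm_nonneg _), smul_eq_mul]
  · rw [integrable_withDensity_iff_integrable_smul' hwm' hfin]
    exact hint.congr (hsw.mono fun _ hu => hu.symm)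
  · refine Integrable.smul_measure ?_ ENNReal.ofReal_ne_top
    exact integrable_dirac (by finiteness)

theorem integral_eulerMeasure_comp (hμ : IsComparable μ c₁ c₂) (hn : 0 < n) (hK : IsCompact K)
    (h : IsOpt p μ K 0) {A : Eu n ≃ₗᵢ[ℝ] Eu n} (hA : A '' K = K) (hAμ : μ.map A = μ)
    {g : Eu n → ℝ} (hg : Continuous g) :
    ∫ u, g (A u) ∂(eulerMeasure p μ K) = ∫ u, g u ∂(eulerMeasure p μ K) := by
  have hmp : MeasurePreserving A μ μ := ⟨A.continuous.measurable, hAμ⟩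
  have hemb : MeasurableEmbedding A := A.toHomeomorph.measurableEmbedding
  set I := ∫ u, suppFn K u ^ (p - 1) • u ∂μ with hI
  have hAI : A I = I := by
    have h1 : A I = ∫ u, A (suppFn K u ^ (p - 1) • u) ∂μ :=
      (A.toLinearIsometry.toContinuousLinearMap.integral_comp_comm
        (integrable_smul_self (hμ.ae_mem_sphere hn) h.integrable_suppFn_rpow)).symm
    rw [h1, hI, ← hmp.integral_comp hemb fun u => suppFn K u ^ (p - 1) • u]
    simp only [map_smul, suppFn_map_of_image_eq hA]
  rw [integral_eulerMeasure hμ hn hK h hg hI,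
    integral_eulerMeasure (g := fun u => g (A u)) hμ hn hK h (hg.comp A.continuous) hI, map_smul,
    hAI, ← hmp.integral_comp hemb fun u => suppFn K u ^ (p - 1) * g u]
  simp only [suppFn_map_of_image_eq hA]

theorem setLIntegral_eulerMeasure (hK : IsCompact K) (h : IsOpt p μ K 0) (hp : p < 1)
    [IsFiniteMeasure μ] {ω : Set (Eu n)} (hω : MeasurableSet ω) :
    ∫⁻ u in ω, ENNReal.ofReal (suppFn K u ^ (1 - p)) ∂(eulerMeasure p μ K) = μ ω := by
  have hh := (continuous_suppFn hK ⟨0, h.mem⟩).measurable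
  have hF : Measurable fun u => ENNReal.ofReal (suppFn K u ^ (1 - p)) :=
    (hh.pow_const _).ennreal_ofReal
  have hw : Measurable fun u => ENNReal.ofReal (suppFn K u ^ (p - 1)) :=
    (hh.pow_const _).ennreal_ofReal
  rw [eulerMeasure, Measure.restrict_add, lintegral_add_measure]
  have h1 : ∫⁻ u in ω, ENNReal.ofReal (suppFn K u ^ (1 - p))
      ∂(ENNReal.ofReal ‖∫ u, suppFn K u ^ (p - 1) • u ∂μ‖ •
        Measure.dirac (-‖∫ u, suppFn K u ^ (p - 1) • u ∂μ‖⁻¹ •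
          ∫ u, suppFn K u ^ (p - 1) • u ∂μ)) = 0 := by
    refine le_antisymm ((setLIntegral_le_lintegral _ _).trans ?_) bot_le
    rw [lintegral_smul_measure, lintegral_dirac' _ hF, h.norm_mul_suppFn_eq_zero hK rfl,
      Real.zero_rpow (by linarith), ENNReal.ofReal_zero, smul_zero]
  rw [h1, add_zero, setLIntegral_withDensity_eq_setLIntegral_mul _ hw hF hω]
  rw [← setLIntegral_one]
  refine lintegral_congr_ae (ae_restrict_of_ae ?_)
  filter_upwards [h.suppFn_pos] with u hu
  rw [Pi.mul_apply, ← ENNReal.ofReal_mul (Real.rpow_nonneg hu.le _), ← Real.rpow_add hu]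
  simp

/-- A minimizing body solves the equation up to a factor. -/
theorem eulerMeasure_eq_smul_surfMeasure (hμ : IsComparable μ c₁ c₂) (hn : 0 < n)
    (hp1 : p < 1) (hc : Convex ℝ K) (hK : IsCompact K) (hv : 1 ≤ volume K) (h : IsOpt p μ K 0)
    {Γ : Type*} [Group Γ] [TopologicalSpace Γ] [IsTopologicalGroup Γ] [CompactSpace Γ]
    [SecondCountableTopology Γ] {ρ : Γ → Eu n ≃ₗᵢ[ℝ] Eu n}
    (hmul : ∀ a b x, ρ (a * b) x = ρ a (ρ b x))
    (hρ : Continuous fun q : Γ × Eu n => ρ q.1 q.2)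
    (hρμ : ∀ γ, μ.map (ρ γ) = μ) (hρK : ∀ γ, ρ γ '' K = K)
    (hmin : ∀ L : Set (Eu n), Convex ℝ L → IsCompact L → 1 ≤ volume L →
      (∀ A ∈ Set.range ρ, A '' L = L) → maxEnergy p μ K ≤ maxEnergy p μ L)
    {y : Eu n} (hy : y ∈ interior K) :
    ∃ c : ℝ, 0 < c ∧
      eulerMeasure p μ K = ENNReal.ofReal c • surfMeasure ((fun z => z - y) '' K) := by
  have := hμ.isFiniteMeasure
  have hS := hμ.ae_mem_sphere hn
  have hcont := continuous_suppFn hK ⟨0, h.mem⟩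
  set a := ∫ u, suppFn K u ^ (p - 1) * suppFn K u ∂μ with ha
  have ha0 : 0 < a := by
    refine (integral_pos_iff_support_of_nonneg_ae ?_
      (integrable_mul_continuous hS h.integrable_suppFn_rpow hcont)).2 ?_
    · filter_upwards [h.suppFn_pos] with u hu
      exact (mul_pos (Real.rpow_pos_of_pos hu _) hu).le
    · rw [pos_iff_ne_zero]
      intro h0
      have h1 : ∀ᵐ u ∂μ, False := by
        filter_upwards [h.suppFn_pos, measure_eq_zero_iff_ae_notMem.1 h0] with u hu hu'
        exact hu' (mul_pos (Real.rpow_pos_of_pos hu _) hu).ne'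
      exact hμ.ne_zero (ae_eq_bot.1 (Filter.eventually_false_iff_eq_bot.1 h1))
  set v := volume.real K with hvdef
  have hv0 : 0 < v :=
    ENNReal.toReal_pos (zero_lt_one.trans_le hv).ne' hK.measure_lt_top.ne
  have hcc := convex_image_sub hc y
  have hKc : IsCompact ((fun z => z - y) '' K) := hK.image (by fun_prop)
  have h0 : (0 : Eu n) ∈ interior ((fun z => z - y) '' K) := by
    have h := (Homeomorph.subRight y).image_interior K
    change _ ∈ interior ((Homeomorph.subRight y) '' K)
    rw [← h]
    exact ⟨y, hy, sub_self y⟩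
  have hf1 := h.isFiniteMeasure_eulerMeasure
  have hf2 := isFiniteMeasure_surfMeasure hcc h0 hKc hn
  have hf3 : IsFiniteMeasure (ENNReal.ofReal (a / v) • surfMeasure ((fun z => z - y) '' K)) :=
    Measure.smul_finite _ ENNReal.ofReal_ne_top
  have hi : ∀ g : Eu n → ℝ, ∫ u, g u ∂(ENNReal.ofReal (a / v) •
      surfMeasure ((fun z => z - y) '' K)) =
      a / v * ∫ u, g u ∂(surfMeasure ((fun z => z - y) '' K)) := fun g => by
    rw [integral_smul_measure, ENNReal.toReal_ofReal (div_pos ha0 hv0).le, smul_eq_mul]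
  refine ⟨a / v, div_pos ha0 hv0, ?_⟩
  refine measure_eq_of_integral_invariant_eq (ρ := fun γ => ρ γ) hmul hρ ?_ ?_ ?_
  · exact fun γ g hg => integral_eulerMeasure_comp hμ hn hK h (hρK γ) (hρμ γ) hg
  · intro γ g hg
    rw [hi, hi, integral_surfMeasure_comp hn hc hK hy (hρK γ) hg]
  · intro g hg hgρ
    rw [hi, integral_eulerMeasure hμ hn hK h hg rfl]
    have h1 := integral_rpow_mul_eq_of_forall_maxEnergy_le hμ hn hp1 hc hK hv h
      (𝒢 := Set.range ρ) (by rintro _ ⟨γ, rfl⟩; exact hρK γ) hmin hy hg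
      (by rintro _ ⟨γ, rfl⟩; exact hgρ γ) rfl
    rw [← ha, ← hvdef] at h1
    rw [div_mul_eq_mul_div, eq_div_iff hv0.ne', mul_comm, h1]

end EulerMeasure

section Interior

open scoped Topology

variable {n : ℕ} {p : ℝ} {μ : Measure (Eu n)} {c₁ c₂ : ℝ≥0} {K : Set (Eu n)}

theorem norm_inv_smul_sub_le {v x : Eu n} (hv : ‖v‖ = 1) {s r : ℝ} (hs : 1 / 2 ≤ s) (hr : 0 < r)
    (hr1 : r ≤ 1) (hx : ‖x - s • v‖ < r / 8) : ‖‖x‖⁻¹ • x - v‖ ≤ r := by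
  have hsv : ‖s • v‖ = s := by
    rw [norm_smul, hv, mul_one, Real.norm_eq_abs, abs_of_nonneg (by linarith)]
  have h1 : |‖x‖ - s| ≤ ‖x - s • v‖ := by
    have := abs_norm_sub_norm_le x (s • v)
    rwa [hsv] at this
  have h2 := (abs_le.1 h1).1
  have hx0 : 0 < ‖x‖ := by linarith
  have h3 : ‖x‖⁻¹ • x - v = ‖x‖⁻¹ • ((x - s • v) + (s - ‖x‖) • v) := by
    rw [sub_smul, sub_add_sub_cancel, smul_sub, inv_smul_smul₀ hx0.ne']
  rw [h3, norm_smul, norm_inv, norm_norm, inv_mul_le_iff₀ hx0]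
  refine (norm_add_le _ _).trans ?_
  rw [norm_smul, hv, mul_one, Real.norm_eq_abs, abs_sub_comm]
  have h4 : 1 / 4 * r ≤ ‖x‖ * r := mul_le_mul_of_nonneg_right (by linarith) hr.le
  linarith

/-- Spherical caps of radius `r` have measure at least of order `r ^ (n - 1)`. -/
theorem le_sphMeasure_closedBall {v : Eu n} (hv : ‖v‖ = 1) {r : ℝ} (hr : 0 < r) (hr1 : r ≤ 1) :
    ENNReal.ofReal (r⁻¹ * ((r / 8) ^ n * volume.real (ball (0 : Eu n) 1))) ≤
      sphMeasure n (closedBall v r) := by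
  rw [sphMeasure_apply isClosed_closedBall.measurableSet]
  set s : ℕ → ℝ := fun k => 1 / 2 + k * (r / 4) with hs
  set m := ⌈r⁻¹⌉₊ with hm
  have hsub : (⋃ k ∈ Finset.range m, ball (s k • v) (r / 8)) ⊆
      {x : Eu n | ‖x‖⁻¹ • x ∈ closedBall v r} ∩ ball 0 1 := by
    refine iUnion₂_subset fun k hk x hx => ?_
    have hk1 : (k : ℝ) < r⁻¹ := Nat.lt_ceil.1 (Finset.mem_range.1 hk)
    have hk2 : (k : ℝ) * r < 1 := by
      have := mul_lt_mul_of_pos_right hk1 hr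
      rwa [inv_mul_cancel₀ hr.ne'] at this
    have hx' : ‖x - s k • v‖ < r / 8 := mem_ball_iff_norm.1 hx
    have hs1 : s k = 1 / 2 + k * r / 4 := by
      simp only [hs]
      ring
    have hs2 : 1 / 2 ≤ s k := by
      have : 0 ≤ (k : ℝ) * r := mul_nonneg (Nat.cast_nonneg k) hr.le
      linarith
    have hcap : ‖‖x‖⁻¹ • x - v‖ ≤ r := norm_inv_smul_sub_le hv hs2 hr hr1 hx'
    have hcap' : ‖x‖⁻¹ • x ∈ closedBall v r := by rwa [mem_closedBall_iff_norm]
    suffices hb : x ∈ ball (0 : Eu n) 1 from mem_inter hcap' hb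
    rw [mem_ball_zero_iff]
    have h1 := norm_sub_norm_le x (s k • v)
    rw [norm_smul, hv, mul_one, Real.norm_eq_abs, abs_of_nonneg (by linarith)] at h1
    linarith
  refine le_trans ?_ (measure_mono hsub)
  rw [measure_biUnion_finset]
  · simp only [Measure.addHaar_ball_of_pos _ _ (show (0 : ℝ) < r / 8 by positivity),
      finrank_euclideanSpace_fin, Finset.sum_const, Finset.card_range, nsmul_eq_mul]
    rw [ENNReal.ofReal_mul (by positivity), ENNReal.ofReal_mul (by positivity), Measure.real,
      ENNReal.ofReal_toReal measure_ball_lt_top.ne]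
    refine mul_le_mul_left ?_ _
    rw [ENNReal.ofReal_le_natCast]
    exact Nat.le_ceil _
  · intro j _ k _ hjk
    refine ball_disjoint_ball ?_
    rw [dist_eq_norm, ← sub_smul, norm_smul, hv, mul_one, Real.norm_eq_abs]
    have h1 : s j - s k = ((j : ℝ) - k) * (r / 4) := by
      simp only [hs]
      ring
    have h2 : (1 : ℝ) ≤ |(j : ℝ) - k| := by
      have h3 : (1 : ℤ) ≤ |(j : ℤ) - k| := Int.one_le_abs (sub_ne_zero.2 (by exact_mod_cast hjk))
      exact_mod_cast h3
    rw [h1, abs_mul, abs_of_pos (show 0 < r / 4 by positivity)]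
    have h4 : 1 * (r / 4) ≤ |(j : ℝ) - k| * (r / 4) :=
      mul_le_mul_of_nonneg_right h2 (by positivity)
    linarith
  · exact fun _ _ => isOpen_ball.measurableSet

theorem IsOpt.zero_mem_interior (hμ : IsComparable μ c₁ c₂) (hp1 : p < 1)
    (hp : p ≤ 2 - (n : ℝ)) (hc : Convex ℝ K) (hK : IsCompact K) (h : IsOpt p μ K 0) :
    (0 : Eu n) ∈ interior K := by
  have hne : K.Nonempty := ⟨0, h.mem⟩
  have := hμ.isFiniteMeasure
  by_contra h0
  obtain ⟨v, hv, hhv⟩ : ∃ v ∈ sphere (0 : Eu n) 1, suppFn K v ≤ 0 := by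
    by_contra! hcon
    refine h0 (mem_interior_of_inner_lt_suppFn hc hK hne fun u hu => ?_)
    rw [inner_zero_left]
    exact hcon u hu
  have hv1 : ‖v‖ = 1 := by simpa using hv
  obtain ⟨R', hR'⟩ := hK.isBounded.exists_norm_le
  set R := max R' 1 with hR
  have hR0 : 0 < R := zero_lt_one.trans_le (le_max_right _ _)
  have hRK : K ⊆ closedBall 0 R := fun x hx =>
    mem_closedBall_zero_iff.2 ((hR' x hx).trans (le_max_left _ _))
  have hub : ∀ u, suppFn K u ≤ R * ‖u - v‖ := fun u => by
    have := suppFn_sub_le hK hne hRK u v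
    linarith
  have hfin := h.isFiniteMeasure_withDensity
  set ν := μ.withDensity fun u => ENNReal.ofReal (suppFn K u ^ (p - 1)) with hν
  set V := volume.real (ball (0 : Eu n) 1) with hV
  have hV0 : 0 < V := ENNReal.toReal_pos (measure_ball_pos _ _ one_pos).ne' measure_ball_lt_top.ne
  set κ : ℝ := R ^ (p - 1) * (c₁ * ((1 / 8) ^ n * V)) with hκ
  have hκ0 : 0 < κ := by
    have := hμ.pos
    have hc1 : (0 : ℝ) < c₁ := by exact_mod_cast this
    positivity
  have hlow : ∀ r : ℝ, 0 < r → r ≤ 1 → ENNReal.ofReal κ ≤ ν (closedBall v r) := by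
    intro r hr hr1
    rw [hν, withDensity_apply _ isClosed_closedBall.measurableSet]
    have h1 : ENNReal.ofReal ((R * r) ^ (p - 1)) * μ (closedBall v r) ≤
        ∫⁻ u in closedBall v r, ENNReal.ofReal (suppFn K u ^ (p - 1)) ∂μ := by
      rw [← setLIntegral_const]
      refine lintegral_mono_ae ?_
      filter_upwards [ae_restrict_of_ae h.suppFn_pos,
        ae_restrict_mem isClosed_closedBall.measurableSet] with u hu hur
      refine ENNReal.ofReal_le_ofReal (Real.rpow_le_rpow_of_nonpos hu ?_ (by linarith))
      exact (hub u).trans (mul_le_mul_of_nonneg_left (mem_closedBall_iff_norm.1 hur) hR0.le)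
    refine le_trans ?_ h1
    have h2 : ENNReal.ofReal (c₁ * (r⁻¹ * ((r / 8) ^ n * V))) ≤ μ (closedBall v r) := by
      refine le_trans ?_ (hμ.lower _)
      rw [Measure.smul_apply, ENNReal.smul_def, smul_eq_mul, ENNReal.ofReal_mul c₁.coe_nonneg,
        ENNReal.ofReal_coe_nnreal]
      exact mul_le_mul_right (le_sphMeasure_closedBall hv1 hr hr1) _
    refine le_trans ?_ (mul_le_mul_right h2 _)
    rw [← ENNReal.ofReal_mul (by positivity)]
    refine ENNReal.ofReal_le_ofReal ?_
    have h3 : (1 : ℝ) ≤ r ^ (p - 1) * (r⁻¹ * r ^ n) := by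
      rw [← Real.rpow_neg_one r, ← Real.rpow_natCast, ← Real.rpow_add hr, ← Real.rpow_add hr]
      exact Real.one_le_rpow_of_pos_of_le_one_of_nonpos hr hr1 (by linarith)
    have h4 : (R * r) ^ (p - 1) * (c₁ * (r⁻¹ * ((r / 8) ^ n * V))) =
        κ * (r ^ (p - 1) * (r⁻¹ * r ^ n)) := by
      rw [Real.mul_rpow hR0.le hr.le, hκ, div_pow, div_pow, one_pow]
      ring
    rw [h4]
    exact le_mul_of_one_le_right hκ0.le h3
  have hzero : ν {v} = 0 := by
    refine withDensity_absolutelyContinuous _ _ ?_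
    refine measure_mono_null ?_ (ae_iff.1 h.suppFn_pos)
    rintro u rfl
    exact not_lt.2 hhv
  have hlim : Tendsto (fun k : ℕ => ν (closedBall v (1 / ((k : ℝ) + 1)))) atTop
      (𝓝 (ν (⋂ k : ℕ, closedBall v (1 / ((k : ℝ) + 1))))) := by
    refine tendsto_measure_iInter_atTop
      (fun _ => isClosed_closedBall.measurableSet.nullMeasurableSet) ?_ ⟨0, measure_ne_top _ _⟩
    intro j k hjk
    refine closedBall_subset_closedBall (one_div_le_one_div_of_le (by positivity) ?_)
    have : (j : ℝ) ≤ k := by exact_mod_cast hjk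
    linarith
  have hint : ⋂ k : ℕ, closedBall v (1 / ((k : ℝ) + 1)) ⊆ {v} := by
    intro u hu
    rw [mem_iInter] at hu
    have h1 : dist u v ≤ 0 :=
      ge_of_tendsto' tendsto_one_div_add_atTop_nhds_zero_nat fun k => hu k
    exact dist_le_zero.1 h1
  rw [measure_mono_null hint hzero] at hlim
  have h5 := ge_of_tendsto' hlim fun k => hlow _ Nat.one_div_pos_of_nat
    (by rw [div_le_one (by positivity)]; linarith [(Nat.cast_nonneg k : (0 : ℝ) ≤ k)])
  exact (ENNReal.ofReal_pos.2 hκ0).not_ge h5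

end Interior

section Conclusion

open scoped Topology

variable {n : ℕ} {p : ℝ} {μ : Measure (Eu n)} {c₁ c₂ : ℝ≥0} {K : Set (Eu n)}

theorem smul_mem_interior_image_smul {t : ℝ} (ht : 0 < t) {y : Eu n} (hy : y ∈ interior K) :
    t • y ∈ interior ((fun z => t • z) '' K) := by
  change _ ∈ interior ((Homeomorph.smulOfNeZero t ht.ne') '' K)
  rw [← Homeomorph.image_interior]
  exact ⟨y, hy, rfl⟩

theorem zero_mem_interior_image_sub {y : Eu n} (hy : y ∈ interior K) :
    (0 : Eu n) ∈ interior ((fun z => z - y) '' K) := by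
  change _ ∈ interior ((Homeomorph.subRight y) '' K)
  rw [← Homeomorph.image_interior]
  exact ⟨y, hy, sub_self y⟩

theorem surfMeasure_image_smul (hn : 0 < n) (hc : Convex ℝ K) (hK : IsCompact K) {y : Eu n}
    (hy : y ∈ interior K) {t : ℝ} (ht : 0 < t) :
    surfMeasure ((fun z => z - t • y) '' ((fun z => t • z) '' K)) =
      ENNReal.ofReal (t ^ n / t) • surfMeasure ((fun z => z - y) '' K) := by
  have hyt := smul_mem_interior_image_smul ht hy
  have hct : Convex ℝ ((fun z => t • z) '' K) := by
    simpa only [Set.image_smul] using hc.smul t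
  have hKt : IsCompact ((fun z => t • z) '' K) := hK.image (by fun_prop)
  have hf1 := isFiniteMeasure_surfMeasure (convex_image_sub hc y) (zero_mem_interior_image_sub hy)
    (hK.image (by fun_prop)) hn
  have hf2 := isFiniteMeasure_surfMeasure (convex_image_sub hct (t • y))
    (zero_mem_interior_image_sub hyt) (hKt.image (by fun_prop)) hn
  have hf3 : IsFiniteMeasure (ENNReal.ofReal (t ^ n / t) • surfMeasure ((fun z => z - y) '' K)) :=
    Measure.smul_finite _ ENNReal.ofReal_ne_top
  refine ext_of_forall_integral_eq_of_IsFiniteMeasure fun g => ?_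
  have h := integral_surfMeasure_image_smul hn hc hK hy ht hyt g.continuous
  rw [integral_smul_measure, ENNReal.toReal_ofReal (by positivity), smul_eq_mul,
    div_mul_eq_mul_div, eq_div_iff ht.ne', mul_comm, h]

theorem exists_image_smul_eq_lpSurf [IsFiniteMeasure μ] (hn : 0 < n) (hp1 : p < 1) {C : ℝ≥0∞}
    (hC0 : C ≠ 0) (hCt : C ≠ ∞)
    (hC : ∀ K : Set (Eu n), Convex ℝ K → IsCompact K →
      (0 : Eu n) ∈ interior K → (μH[(n : ℝ) - 1]).restrict (frontier K) = C • coneMeasure K)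
    (hc : Convex ℝ K) (hK : IsCompact K) (h : IsOpt p μ K 0) {y : Eu n} (hy : y ∈ interior K)
    {l : ℝ} (hl : 0 < l)
    (hE : eulerMeasure p μ K = ENNReal.ofReal l • surfMeasure ((fun z => z - y) '' K)) :
    ∃ t : ℝ, 0 < t ∧ ∀ ω : Set (Eu n), MeasurableSet ω →
      μ ω = lpSurf p ((fun z => t • z) '' K) ω := by
  have hne : K.Nonempty := ⟨y, interior_subset hy⟩
  have hr0 : 0 < C.toReal := ENNReal.toReal_pos hC0 hCt
  have hnp : (0 : ℝ) < n - p := by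
    have : (1 : ℝ) ≤ n := by exact_mod_cast hn
    linarith
  set t : ℝ := (l / C.toReal) ^ ((n - p : ℝ)⁻¹) with ht
  have ht0 : 0 < t := Real.rpow_pos_of_pos (div_pos hl hr0) _
  have hconst : C.toReal * (t ^ (1 - p) * (t ^ n / t)) = l := by
    have h1 : t ^ (1 - p) * (t ^ n / t) = t ^ ((n : ℝ) - p) := by
      rw [div_eq_mul_inv, ← Real.rpow_neg_one t, ← Real.rpow_natCast, ← Real.rpow_add ht0,
        ← Real.rpow_add ht0]
      congr 1
      ring
    rw [h1, ht, ← Real.rpow_mul (div_pos hl hr0).le, inv_mul_cancel₀ hnp.ne', Real.rpow_one,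
      mul_div_cancel₀ _ hr0.ne']
  refine ⟨t, ht0, fun ω hω => ?_⟩
  have hct : Convex ℝ ((fun z => t • z) '' K) := by
    simpa only [Set.image_smul] using hc.smul t
  have hmeas : Measurable fun u => ENNReal.ofReal (suppFn K u ^ (1 - p)) :=
    ((continuous_suppFn hK hne).measurable.pow_const _).ennreal_ofReal
  rw [lpSurf_eq_lintegral_surfMeasure hn hC hct (hK.image (by fun_prop))
    (smul_mem_interior_image_smul ht0 hy) p hω, surfMeasure_image_smul hn hc hK hy ht0,
    ← setLIntegral_eulerMeasure hK h hp1 hω, hE]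
  have hsupp : ∀ u, ENNReal.ofReal (suppFn ((fun z => t • z) '' K) u ^ (1 - p)) =
      ENNReal.ofReal (t ^ (1 - p)) * ENNReal.ofReal (suppFn K u ^ (1 - p)) := fun u => by
    rw [suppFn_image_smul hK hne ht0.le, Real.mul_rpow ht0.le (suppFn_nonneg hK h.mem u),
      ENNReal.ofReal_mul (by positivity)]
  simp only [hsupp]
  rw [Measure.restrict_smul, Measure.restrict_smul, lintegral_smul_measure,
    lintegral_smul_measure, lintegral_const_mul _ hmeas, smul_eq_mul, smul_eq_mul, ← hconst,
    ENNReal.ofReal_mul hr0.le, ENNReal.ofReal_mul (by positivity), ENNReal.ofReal_toReal hCt]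
  ring

theorem exists_convexBody_lpSurf_eq (hn : 0 < n) (hp : -(n : ℝ) < p) (hp1 : p < 1)
    {C : ℝ≥0∞} (hC0 : C ≠ 0) (hCt : C ≠ ∞)
    (hC : ∀ K : Set (Eu n), Convex ℝ K → IsCompact K →
      (0 : Eu n) ∈ interior K → (μH[(n : ℝ) - 1]).restrict (frontier K) = C • coneMeasure K)
    (hμ : IsComparable μ c₁ c₂) {Γ : Type*} [Group Γ] [TopologicalSpace Γ]
    [IsTopologicalGroup Γ] [CompactSpace Γ] [SecondCountableTopology Γ]
    {ρ : Γ → Eu n ≃ₗᵢ[ℝ] Eu n} (hmul : ∀ a b x, ρ (a * b) x = ρ a (ρ b x))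
    (hρ : Continuous fun q : Γ × Eu n => ρ q.1 q.2) (hρμ : ∀ γ, μ.map (ρ γ) = μ) :
    ∃ K : Set (Eu n), IsConvexBody K ∧ (0 : Eu n) ∈ K ∧
      (∀ ω : Set (Eu n), MeasurableSet ω → μ ω = lpSurf p K ω) ∧ (∀ γ, ρ γ '' K = K) ∧
      (p ≤ 2 - (n : ℝ) → (0 : Eu n) ∈ interior K) := by
  have := hμ.isFiniteMeasure
  obtain ⟨K, hc, hK, hv, h, hinv, hmin⟩ := exists_isOpt_forall_maxEnergy_le hμ hn hp hp1
    (Set.range ρ) (by rintro _ ⟨γ, rfl⟩; exact hρμ γ)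
  have hρK : ∀ γ, ρ γ '' K = K := fun γ => hinv _ ⟨γ, rfl⟩
  obtain ⟨y, hy⟩ := interior_nonempty_of_volume hc hv
  obtain ⟨l, hl, hE⟩ := eulerMeasure_eq_smul_surfMeasure hμ hn hp1 hc hK hv h hmul hρ hρμ hρK
    hmin hy
  obtain ⟨t, ht, hlp⟩ := exists_image_smul_eq_lpSurf hn hp1 hC0 hCt hC hc hK h hy hl hE
  have hct : Convex ℝ ((fun z => t • z) '' K) := by
    simpa only [Set.image_smul] using hc.smul t
  refine ⟨(fun z => t • z) '' K, ⟨hct, hK.image (by fun_prop), t • y,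
    smul_mem_interior_image_smul ht hy⟩, ⟨0, h.mem, smul_zero t⟩, hlp, fun γ => ?_, fun hp2 => ?_⟩
  · conv_rhs => rw [← hρK γ]
    rw [image_image, image_image]
    simp only [map_smul]
  · have h0 := smul_mem_interior_image_smul ht (h.zero_mem_interior hμ hp1 hp2 hc hK)
    rwa [smul_zero] at h0

end Conclusion

/-- Chou–Wang: For `p ∈ (-n, 1)` and a Borel measure `μ = f dH^{n-1}` on
the sphere with `f` bounded and bounded away from `0`, the measure `μ` is the `L_p`-surface
area measure of a convex body containing the origin; moreover if `μ` is invariant under a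
closed subgroup `G` of `O(n)`, the body can be chosen `G`-invariant, and for
`p ∈ (-n, 2-n]` the origin is interior to the body. -/
theorem lp_minkowski_existence_chou_wang
    (n : ℕ) (p : ℝ) (hp : -(n : ℝ) < p ∧ p < 1)
    (f : Eu n → ℝ)
    (hf : ∃ τ₁ τ₂ : ℝ, 0 < τ₁ ∧ ∀ u ∈ sphere (0 : Eu n) 1, τ₁ ≤ f u ∧ f u ≤ τ₂)
    (μ : Measure (Eu n))
    (hμ : μ = ((μH[(n:ℝ) - 1]).restrict (sphere (0 : Eu n) 1)).withDensity
      (fun x => ENNReal.ofReal (f x)))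
    (G : Subgroup (Matrix.orthogonalGroup (Fin n) ℝ))
    (hGclosed : IsClosed (G : Set (Matrix.orthogonalGroup (Fin n) ℝ)))
    (hGμ : ∀ A ∈ G, Measure.map (matAct (A : Matrix (Fin n) (Fin n) ℝ)) μ = μ) :
    ∃ K : Set (Eu n), IsConvexBody K ∧ (0 : Eu n) ∈ K ∧
      (∀ ω : Set (Eu n), MeasurableSet ω → μ ω = lpSurf p K ω) ∧
      (∀ A ∈ G, matAct (A : Matrix (Fin n) (Fin n) ℝ) '' K = K) ∧
      (p ≤ 2 - (n : ℝ) → (0 : Eu n) ∈ interior K) := by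
  rcases Nat.eq_zero_or_pos n with rfl | hn
  · have hS : sphere (0 : Eu 0) 1 = ∅ := by
      ext x
      simp [Subsingleton.elim x 0]
    refine ⟨univ, ⟨convex_univ, (Set.toFinite _).isCompact, ?_⟩, mem_univ _, fun ω _ => ?_,
      fun A _ => ?_, fun _ => ?_⟩
    · rw [interior_univ]
      exact univ_nonempty
    · rw [hμ, hS, Measure.restrict_empty, withDensity_zero_left, Measure.coe_zero, Pi.zero_apply,
        lpSurf, frontier_univ]
      simp
    · exact Subsingleton.eq_univ_of_nonempty (univ_nonempty.image _)
    · rw [interior_univ]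
      exact mem_univ _
  · obtain ⟨C, hC0, hCt, hC⟩ := exists_hausdorffMeasure_restrict_frontier_eq hn
    obtain ⟨c₁, c₂, hc₁, hlo, hup⟩ := withDensity_hausdorffMeasure_sphere_bounds hn hC0 hCt hC hf
    rw [← hμ] at hlo hup
    have hcomp : IsComparable μ c₁ c₂ := ⟨hc₁, hlo, hup⟩
    have : CompactSpace G := isCompact_iff_compactSpace.1 hGclosed.isCompact
    have : SecondCountableTopology (Matrix (Fin n) (Fin n) ℝ) :=
      inferInstanceAs (SecondCountableTopology (Fin n → Fin n → ℝ))
    have : SecondCountableTopology (Matrix.orthogonalGroup (Fin n) ℝ) :=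
      TopologicalSpace.Subtype.secondCountableTopology
        {A : Matrix (Fin n) (Fin n) ℝ | A ∈ Matrix.orthogonalGroup (Fin n) ℝ}
    have : SecondCountableTopology G :=
      TopologicalSpace.Subtype.secondCountableTopology (G : Set (Matrix.orthogonalGroup (Fin n) ℝ))
    obtain ⟨K, hK, h0, hlp, hinv, hint⟩ := exists_convexBody_lpSurf_eq (Γ := G)
      (ρ := fun A => orthogonalIsometry A.1) hn hp.1 hp.2 hC0 hCt hC hcomp
      (fun A B x => matAct_mul A.1.1 B.1.1 x)
      (continuous_matAct.comp ((continuous_subtype_val.comp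
        (continuous_subtype_val.comp continuous_fst)).prodMk continuous_snd))
      (fun A => hGμ A.1 A.2)
    exact ⟨K, hK, h0, hlp, fun A hA => hinv ⟨A, hA⟩, hint⟩

end
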